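/- Let g ≥ 0, n ≥ 1, a, b ≥ 0 be integers, and let r_1,…,r_a ≥ 0, s_1,…,s_b ≥ 0, d_1,…,d_n ≥ 1 be integers with Σ_j r_j + Σ_j s_j + Σ_j d_j = g+n+1. Put u = #{j : r_j = 0}, v = #{j : s_j = 0}, w = #{j : d_j = 1}, and assume 2g+n+a+b−3−w ≠ 0. Then the coefficient of y^{2g−5+a+b} Π_{j=1}^a z_j^{r_j} Π_{j=1}^b w_j^{s_j} Π_{j=1}^n x_j^{d_j} in L_g(y; z_1,…,z_a; w_1,…,w_b; x_1,…,x_n) equals (C/(Π_{j=1}^a (2r_j+1)!! Π_{j=1}^b (2s_j+1)!!)) · (−1)^b (2g−3+n+a+b)!/(4^g (2g−4+a+b)! Π_{j=1}^n (2d_j−1)!!), where C = Σ_{j=1}^a r_j − Σ_{j=1}^b s_j + (a−b)/2 + ((5−u)u − (5−v)v)/(2(2g+n+a+b−3−w)), and (2g−3+n+a+b)!/(2g−4+a+b)! is to be read as the product Π_{i=1}^{n+1} (2g−4+a+b+i). -/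

import Mathlib

open MvPolynomial Finset

noncomputable section

/-- The polynomial ring `ℚ[x_1,…,x_n]`. -/
abbrev R (n : ℕ) : Type := MvPolynomial (Fin n) ℚ

/-- The field of rational functions `ℚ(x_1,…,x_n)`. -/
abbrev K (n : ℕ) : Type := FractionRing (R n)

/-- `x_1 + ⋯ + x_n` as an element of `K n`. -/
def SX (n : ℕ) : K n := algebraMap (R n) (K n) (∑ j, X j)

/-- `x_1^3 + ⋯ + x_n^3` as an element of `K n`. -/
def SX3 (n : ℕ) : K n := algebraMap (R n) (K n) (∑ j, (X j)^3)

/-- `Δ(x_1,…,x_n) = ((Σ x_j)^3 − Σ x_j^3)/3`. -/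
def Dlt (n : ℕ) : K n := ((SX n)^3 - SX3 n) / 3

/-- The ring homomorphism `ℚ[x_1,…,x_{|I|}] → ℚ(x_1,…,x_n)` substituting the variables
of the subset `I` (in increasing order). -/
def embRH {n : ℕ} (I : Finset (Fin n)) : R I.card →+* K n :=
  (algebraMap (R n) (K n)).comp
    (MvPolynomial.rename (fun i : Fin I.card => ((I.orderIsoOfFin rfl) i : Fin n))).toRingHom

lemma embRH_inj {n : ℕ} (I : Finset (Fin n)) : Function.Injective (embRH I) := by
  have h1 : Function.Injective (fun i : Fin I.card => ((I.orderIsoOfFin rfl) i : Fin n)) := by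
    intro i j hij
    exact (I.orderIsoOfFin rfl).injective (Subtype.val_injective hij)
  have h2 := (IsFractionRing.injective (R n) (K n)).comp (MvPolynomial.rename_injective _ h1)
  simpa [embRH, RingHom.coe_comp] using h2

/-- The field embedding `ℚ(x_1,…,x_{|I|}) → ℚ(x_1,…,x_n)` substituting the variables
of the subset `I` (in increasing order).  Used for expressions like `G_{r'}(x_I)`. -/
def emb {n : ℕ} (I : Finset (Fin n)) : K I.card →+* K n :=
  IsFractionRing.lift (embRH_inj I)

/-- The normalized `n`-point functions `G_g(x_1,…,x_n)`, defined with a fuel parameter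
(first argument) for structural recursion; for `fuel ≥ n` this computes the recursively
defined normalized `n`-point function:  `G_0(x) = x^{-2}`, `G_g(x) = 0` for `g ≥ 1`, and
for `n ≥ 2`,
`G_g = Σ_{r+s=g} ((2r+n−3)!!/(4^s(2r+2s+n−1)!!)) P_r Δ^s` where
`P_r = (1/(2Σx_j)) Σ_{I⊔J={1..n}, I,J≠∅} (Σ_I x)²(Σ_J x)² Σ_{r'≤r} G_{r'}(x_I)G_{r−r'}(x_J)`. -/
def Gf : (fuel : ℕ) → (n : ℕ) → ℕ → K n
  | _, 0, _ => 0
  | _, 1, 0 => (algebraMap (R 1) (K 1) (X 0)) ^ (-2 : ℤ)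
  | _, 1, _+1 => 0
  | 0, _+2, _ => 0
  | fuel+1, n+2, g =>
      ∑ s ∈ Finset.range (g+1),
        (((Nat.doubleFactorial (2*(g-s)+(n+2)-3) : ℚ) /
          (4^s * (Nat.doubleFactorial (2*g+(n+2)-1) : ℚ))) : K (n+2)) *
        ((2 * SX (n+2))⁻¹ *
          ∑ I : Finset (Fin (n+2)),
            if I ≠ ∅ ∧ I ≠ univ then
              (algebraMap (R (n+2)) (K (n+2)) (∑ i ∈ I, X i))^2 *
              (algebraMap (R (n+2)) (K (n+2)) (∑ i ∈ Iᶜ, X i))^2 *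
              ∑ r' ∈ Finset.range ((g-s)+1),
                emb I (Gf fuel I.card r') * emb Iᶜ (Gf fuel Iᶜ.card ((g-s) - r'))
            else 0) *
        (Dlt (n+2))^s

/-- The normalized `n`-point function `G_g(x_1,…,x_n)` as an element of `ℚ(x_1,…,x_n)`. -/
def Gnpt (n g : ℕ) : K n := Gf n n g

/-- `P_r(x_1,…,x_n)`. -/
def Ppoly (n r : ℕ) : K n :=
  (2 * SX n)⁻¹ *
    ∑ I : Finset (Fin n),
      if I ≠ ∅ ∧ I ≠ univ then
        (algebraMap (R n) (K n) (∑ i ∈ I, X i))^2 *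
        (algebraMap (R n) (K n) (∑ i ∈ Iᶜ, X i))^2 *
        ∑ r' ∈ Finset.range (r+1), emb I (Gnpt I.card r') * emb Iᶜ (Gnpt Iᶜ.card (r - r'))
      else 0

/-- The `n`-point function `F_g(x_1,…,x_n) = Σ_{h+d=g} (1/d!)((Σx_j^3)/24)^d G_h(x_1,…,x_n)`. -/
def Fnpt (n g : ℕ) : K n :=
  ∑ d ∈ Finset.range (g+1),
    ((1 / (Nat.factorial d : ℚ)) : K n) * (SX3 n / 24)^d * Gnpt n (g-d)

open Classical in
/-- The coefficient of the monomial `Π x_j^{d_j}` of an element of `ℚ(x_1,…,x_n)` which is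
a polynomial (junk value `0` otherwise). -/
def coeffK {n : ℕ} (f : K n) (d : Fin n → ℕ) : ℚ :=
  if h : ∃ p : R n, algebraMap (R n) (K n) p = f then
    MvPolynomial.coeff (Finsupp.equivFunOnFinite.symm d) h.choose
  else 0

/-- The intersection index `⟨τ_{d_1} ⋯ τ_{d_n}⟩_g`, i.e. the coefficient of `Π x_j^{d_j}`
in `F_g(x_1,…,x_n)`.  For `(g,n) = (0,1), (0,2)` and nonnegative `d_j` the value is `0`
(the conventional values `⟨τ_{-2}⟩_0 = 1`, `⟨τ_k τ_{-1-k}⟩_0 = (-1)^k` have a negative index). -/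
def bracket (g : ℕ) {n : ℕ} (d : Fin n → ℕ) : ℚ :=
  if g = 0 ∧ n ≤ 2 then 0 else coeffK (Fnpt n g) d

/-- `⟨τ_j Π_{i ∈ I} τ_{d_i}⟩_g` for a subset `I ⊆ {1,…,n}`. -/
def bracketI (g : ℕ) {n : ℕ} (j : ℕ) (I : Finset (Fin n)) (d : Fin n → ℕ) : ℚ :=
  bracket g (Fin.cons j (fun i : Fin I.card => d ((I.orderIsoOfFin rfl) i)))


/-! ### Laurent expansions in `y` (formal series in `ℚ[x_1,…,x_n][[y,y⁻¹]]` of bounded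
`y`-degree, realized as Hahn/Laurent series in the variable `t = y⁻¹`, so that the
coefficient of `y^k` is the Hahn coefficient at `-k`). -/

/-- Laurent series in `t = y⁻¹` with coefficients in `ℚ[x_1,…,x_n]`. -/
abbrev Lau (n : ℕ) : Type := LaurentSeries (R n)

/-- The generalized binomial coefficient `C(p,k) = p(p−1)⋯(p−k+1)/k!` for `p : ℤ`, `k : ℕ`. -/
def binomZ (p : ℤ) (k : ℕ) : ℚ := (∏ i ∈ Finset.range k, ((p : ℚ) - i)) / (Nat.factorial k)

/-- The expansion of `(y + c)^m = Σ_{k≥0} C(m,k) c^k y^{m−k}` as a Laurent series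
in `t = y⁻¹` (for `m ≥ 0` this is the usual binomial expansion of the polynomial). -/
def yExpAdd {n : ℕ} (c : R n) (m : ℤ) : Lau n :=
  (HahnSeries.single (-m) (1 : R n)) *
    HahnSeries.ofPowerSeries ℤ (R n)
      (PowerSeries.mk fun k => MvPolynomial.C (binomZ m k) * c^k)

/-- The expansion of `(±y + c)^m`, where the sign is `+` if `σ = true` and `−` otherwise;
it is computed as `(±1)^m (y ± c)^m`. -/
def LExp {n : ℕ} (σ : Bool) (c : R n) (m : ℤ) : Lau n :=
  (if σ then 1 else if Even m then 1 else -1 : Lau n) *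
    yExpAdd ((if σ then 1 else -1 : R n) * c) m

open Classical in
/-- The polynomial representing an element of `ℚ(x_1,…,x_n)` lying in `ℚ[x_1,…,x_n]`
(junk value `0` otherwise). -/
def polyOf {n : ℕ} (f : K n) : R n :=
  if h : ∃ p : R n, algebraMap (R n) (K n) p = f then h.choose else 0

/-- `±y` as a Laurent series in `t = y⁻¹`. -/
def yLau (n : ℕ) (σ : Bool) : Lau n :=
  (if σ then 1 else -1 : Lau n) * HahnSeries.single (-1 : ℤ) (1 : R n)

/-- The expansion of `F_g(±y, x_I)` as a Laurent series in `t = y⁻¹` with coefficients in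
`ℚ[x_1,…,x_n]`: for `(g,|I|+1) = (0,1)` it is `(±y)^{-2} = y^{-2}`, for `(g,|I|+1) = (0,2)`
it is `1/(±y + x_i) = Σ_{k≥0} (−1)^k x_i^k (±y)^{−k−1}`, and otherwise it is obtained by
substituting `±y` and the variables of `I` into the polynomial `F_g`. -/
def FExp {n : ℕ} (σ : Bool) (g : ℕ) (I : Finset (Fin n)) : Lau n :=
  if g = 0 ∧ I.card = 0 then HahnSeries.single (2 : ℤ) (1 : R n)
  else if g = 0 ∧ I.card = 1 then LExp σ (∑ i ∈ I, X i) (-1)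
  else
    MvPolynomial.eval₂ ((HahnSeries.C).comp (algebraMap ℚ (R n)))
      (Fin.cons (yLau n σ)
        (fun i : Fin I.card => HahnSeries.C (X ((I.orderIsoOfFin rfl) i : Fin n))))
      (polyOf (Fnpt (I.card + 1) g))

/-- `L_g^{a,b}(y, x_1,…,x_n) = Σ_{g'=0}^{g} Σ_{I⊔J={1,…,n}} (y+Σ_I x)^a (−y+Σ_J x)^b
F_{g'}(y,x_I) F_{g−g'}(−y,x_J)` as a Laurent series in `t = y⁻¹`. -/
def LL (g n : ℕ) (a b : ℤ) : Lau n :=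
  ∑ gp ∈ Finset.range (g+1), ∑ I : Finset (Fin n),
    LExp true (∑ i ∈ I, X i) a * LExp false (∑ i ∈ Iᶜ, X i) b *
      FExp true gp I * FExp false (g - gp) Iᶜ

/-- The coefficient of `y^k Π_j x_j^{d_j}` in a Laurent series in `t = y⁻¹` with coefficients
in `ℚ[x_1,…,x_n]`. -/
def coeffL {n : ℕ} (f : Lau n) (k : ℤ) (d : Fin n → ℕ) : ℚ :=
  MvPolynomial.coeff (Finsupp.equivFunOnFinite.symm d) (f.coeff (-k))

/-- The index of the variable `z_i` among the `a + b + n` variables `z, w, x`. -/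
def zIdx (a b n : ℕ) (i : Fin a) : Fin (a+b+n) := ⟨i.1, by have := i.2; omega⟩

/-- The index of the variable `w_i` among the `a + b + n` variables `z, w, x`. -/
def wIdx (a b n : ℕ) (i : Fin b) : Fin (a+b+n) := ⟨a + i.1, by have := i.2; omega⟩

/-- The index of the variable `x_i` among the `a + b + n` variables `z, w, x`. -/
def xIdx (a b n : ℕ) (i : Fin n) : Fin (a+b+n) := ⟨a + b + i.1, by have := i.2; omega⟩

/-- `L_g(y; z_1,…,z_a; w_1,…,w_b; x_1,…,x_n)
 = Σ_{g'=0}^{g} Σ_{I⊔J={1,…,n}} F_{g'}(y, z, x_I) F_{g−g'}(−y, w, x_J)`,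
as a Laurent series in `t = y⁻¹` with coefficients in `ℚ[z,w,x]`. -/
def LLm (g n a b : ℕ) : Lau (a+b+n) :=
  ∑ gp ∈ Finset.range (g+1), ∑ I : Finset (Fin n),
    FExp true gp ((univ.image (zIdx a b n)) ∪ I.image (xIdx a b n)) *
    FExp false (g - gp) ((univ.image (wIdx a b n)) ∪ Iᶜ.image (xIdx a b n))

/-- The exponent vector of the monomial `Π z_j^{r_j} Π w_j^{s_j} Π x_j^{d_j}`. -/
def expVec (a b n : ℕ) (r : Fin a → ℕ) (s : Fin b → ℕ) (d : Fin n → ℕ) :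
    Fin (a+b+n) → ℕ :=
  fun v =>
    if h : v.1 < a then r ⟨v.1, h⟩
    else if h2 : v.1 < a + b then s ⟨v.1 - a, by omega⟩
    else d ⟨v.1 - (a+b), by have := v.2; omega⟩


open scoped PowerSeries

namespace NPoint

/-- The Euler derivation `ħ d/dħ` on power series in `ħ`. -/
def theta (A : Type*) [CommRing A] : Derivation A A⟦X⟧ A⟦X⟧ :=
  (PowerSeries.X : A⟦X⟧) • PowerSeries.derivative A

section Theta

variable {A : Type*} [CommRing A]


lemma coeff_theta (f : A⟦X⟧) (g : ℕ) : PowerSeries.coeff g (theta A f) = g * PowerSeries.coeff g f := by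
  cases g with
  | zero => simp [theta]
  | succ g =>
    simp only [theta, Derivation.smul_apply, smul_eq_mul, PowerSeries.coeff_succ_X_mul, PowerSeries.coeff_derivative]
    push_cast; ring

lemma theta_mul (f g : A⟦X⟧) : theta A (f * g) = theta A f * g + f * theta A g := by
  rw [Derivation.leibniz, smul_eq_mul, smul_eq_mul]; ring

lemma theta_C (a : A) : theta A (PowerSeries.C a) = 0 := (theta A).map_algebraMap a

lemma theta_C_mul (a : A) (f : A⟦X⟧) : theta A (PowerSeries.C a * f) = PowerSeries.C a * theta A f := by
  rw [theta_mul, theta_C, zero_mul, zero_add]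

lemma theta_X : theta A (PowerSeries.X : A⟦X⟧) = PowerSeries.X := by
  simp [theta]

lemma map_theta {B : Type*} [CommRing B] (φ : A →+* B) (f : A⟦X⟧) :
    PowerSeries.map φ (theta A f) = theta B (PowerSeries.map φ f) := by
  ext g; simp [coeff_theta]

end Theta

section Rational

variable {A : Type*} [CommRing A] [Algebra ℚ A]


lemma natCast_mul_cancel {k : ℕ} (hk : k ≠ 0) {x y : A} (h : (k : A) * x = k * y) : x = y := by
  have e : ∀ z : A, z = algebraMap ℚ A (1 / k) * ((k : A) * z) := by
    intro z
    have : (k : A) = algebraMap ℚ A k := by simp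
    rw [this, ← mul_assoc, ← map_mul, one_div, inv_mul_cancel₀ (by exact_mod_cast hk), map_one,
      one_mul]
  rw [e x, h, ← e y]

lemma euler_unique {m : ℕ} {s : A} {q f f' : A⟦X⟧}
    (h : 24 * theta A f + 12 * (m : A⟦X⟧) * f = PowerSeries.X * PowerSeries.C s * f + q)
    (h' : 24 * theta A f' + 12 * (m : A⟦X⟧) * f' = PowerSeries.X * PowerSeries.C s * f' + q)
    (h0 : m = 0 → PowerSeries.coeff 0 f = PowerSeries.coeff 0 f') : f = f' := by
  have e : 24 * theta A (f - f') + 12 * (m : A⟦X⟧) * (f - f') = PowerSeries.X * (PowerSeries.C s * (f - f')) := by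
    rw [map_sub]; linear_combination h - h'
  have e24 : (24 : A⟦X⟧) = PowerSeries.C (24 : A) := (map_ofNat PowerSeries.C 24).symm
  have e12 : (12 * (m : A⟦X⟧)) = PowerSeries.C (12 * (m : A)) := by
    rw [map_mul, map_natCast, map_ofNat]
  rw [e24, e12] at e
  rw [← sub_eq_zero]
  ext g
  have eg := congrArg (PowerSeries.coeff g) e
  induction g with
  | zero =>
    by_cases hm : m = 0
    · rw [map_sub, h0 hm, sub_self, map_zero]
    · simp only [map_add, PowerSeries.coeff_C_mul, coeff_theta, PowerSeries.coeff_zero_X_mul] at eg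
      rw [map_zero]
      refine natCast_mul_cancel (k := 12 * m) (by omega) ?_
      push_cast at eg ⊢
      linear_combination eg
  | succ g ih =>
    have ih := ih (congrArg (PowerSeries.coeff g) e)
    simp only [map_add, PowerSeries.coeff_C_mul, coeff_theta, PowerSeries.coeff_succ_X_mul] at eg
    rw [ih, map_zero, mul_zero] at eg
    rw [map_zero]
    refine natCast_mul_cancel (k := 24 * (g + 1) + 12 * m) (by omega) ?_
    push_cast at eg ⊢
    linear_combination eg

/-- The solution of `24 θ f + 12 m f = ħ s f + q`, normalized by `f(0) = 1` when `m = 0`. -/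
def eulerCoeff (m : ℕ) (s : A) (q : ℕ → A) : ℕ → A
  | 0 => if m = 0 then 1 else algebraMap ℚ A (1 / (12 * m)) * q 0
  | g + 1 => algebraMap ℚ A (1 / (24 * (g + 1) + 12 * m)) * (s * eulerCoeff m s q g + q (g + 1))

lemma euler_exists (m : ℕ) (s : A) (q : A⟦X⟧) (hq : m = 0 → PowerSeries.coeff 0 q = 0) :
    24 * theta A (PowerSeries.mk (eulerCoeff m s (fun g => PowerSeries.coeff g q))) +
      12 * (m : A⟦X⟧) * PowerSeries.mk (eulerCoeff m s (fun g => PowerSeries.coeff g q)) =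
    PowerSeries.X * PowerSeries.C s * PowerSeries.mk (eulerCoeff m s (fun g => PowerSeries.coeff g q)) + q := by
  have e24 : (24 : A⟦X⟧) = PowerSeries.C (24 : A) := (map_ofNat PowerSeries.C 24).symm
  have e12 : (12 * (m : A⟦X⟧)) = PowerSeries.C (12 * (m : A)) := by
    rw [map_mul, map_natCast, map_ofNat]
  have key : ∀ k : ℚ, k ≠ 0 → ∀ z : A, algebraMap ℚ A k * (algebraMap ℚ A (1 / k) * z) = z := by
    intro k hk z
    rw [← mul_assoc, ← map_mul, mul_one_div_cancel hk, map_one, one_mul]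
  rw [e24, e12, mul_assoc]
  ext g
  cases g with
  | zero =>
    simp only [map_add, PowerSeries.coeff_C_mul, coeff_theta, PowerSeries.coeff_zero_X_mul, PowerSeries.coeff_mk, eulerCoeff]
    by_cases hm : m = 0
    · simp [hm, hq hm]
    · have := key (12 * m) (by positivity) (PowerSeries.coeff 0 q)
      rw [if_neg hm]
      simp only [map_mul, map_ofNat, map_natCast] at this ⊢
      push_cast
      linear_combination this
  | succ g =>
    simp only [map_add, PowerSeries.coeff_C_mul, coeff_theta, PowerSeries.coeff_succ_X_mul, PowerSeries.coeff_mk]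
    rw [eulerCoeff]
    have := key (24 * (g + 1) + 12 * m) (by positivity)
      (s * eulerCoeff m s (fun g => PowerSeries.coeff g q) g + PowerSeries.coeff (g + 1) q)
    simp only [map_add, map_mul, map_ofNat, map_natCast, map_one] at this
    push_cast
    linear_combination this

end Rational

section Convolution

variable {κ B : Type*} [DecidableEq κ] [AddCommMonoid B]

lemma sum_powerset_sdiff (U : Finset κ) (f : Finset κ → Finset κ → B) :
    ∑ J ∈ U.powerset, f J (U \ J) = ∑ J ∈ U.powerset, f (U \ J) J := by
  refine Finset.sum_nbij' (fun J => U \ J) (fun J => U \ J) ?_ ?_ ?_ ?_ ?_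
  · intro J _; simp
  · intro J _; simp
  · intro J hJ; simpa using Finset.sdiff_sdiff_eq_self (mem_powerset.1 hJ)
  · intro J hJ; simpa using Finset.sdiff_sdiff_eq_self (mem_powerset.1 hJ)
  · intro J hJ; rw [Finset.sdiff_sdiff_eq_self (mem_powerset.1 hJ)]

lemma sum_powerset_powerset (U : Finset κ) (f : Finset κ → Finset κ → Finset κ → B) :
    ∑ J ∈ U.powerset, ∑ C ∈ J.powerset, f C (J \ C) (U \ J) =
      ∑ C ∈ U.powerset, ∑ D ∈ (U \ C).powerset, f C D ((U \ C) \ D) := by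
  rw [Finset.sum_sigma', Finset.sum_sigma']
  refine Finset.sum_nbij' (fun x => ⟨x.2, x.1 \ x.2⟩) (fun x => ⟨x.1 ∪ x.2, x.1⟩) ?_ ?_ ?_ ?_ ?_
  · rintro ⟨J, C⟩ h
    simp only [mem_sigma, mem_powerset] at h ⊢
    exact ⟨h.2.trans h.1, sdiff_subset_sdiff h.1 le_rfl⟩
  · rintro ⟨C, D⟩ h
    simp only [mem_sigma, mem_powerset] at h ⊢
    exact ⟨union_subset h.1 (h.2.trans sdiff_subset), subset_union_left⟩
  · rintro ⟨J, C⟩ h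
    simp only [mem_sigma, mem_powerset] at h
    simp [union_sdiff_of_subset h.2]
  · rintro ⟨C, D⟩ h
    simp only [mem_sigma, mem_powerset] at h
    have hd : Disjoint D C := disjoint_of_subset_left h.2 sdiff_disjoint
    simp [union_sdiff_cancel_left hd.symm]
  · rintro ⟨J, C⟩ h
    simp only [mem_sigma, mem_powerset] at h
    simp only
    congr 1
    rw [_root_.sdiff_sdiff_left]
    congr 1
    exact (union_sdiff_of_subset h.2).symm

end Convolution

section Psi

variable {κ A : Type*} [DecidableEq κ] [CommRing A] [Algebra ℚ A]


/-- The sum of the values of `c` over `I`. -/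
def sm (c : κ → A) (I : Finset κ) : A := ∑ i ∈ I, c i

omit [DecidableEq κ] [Algebra ℚ A] in
@[simp] lemma sm_empty (c : κ → A) : sm c ∅ = 0 := rfl

omit [DecidableEq κ] [Algebra ℚ A] in
@[simp] lemma sm_singleton (c : κ → A) (i : κ) : sm c {i} = c i := by simp [sm]

omit [Algebra ℚ A] in
lemma sm_insert (c : κ → A) {i : κ} {I : Finset κ} (h : i ∉ I) :
    sm c (insert i I) = c i + sm c I := sum_insert h

omit [Algebra ℚ A] in
lemma sm_sdiff (c : κ → A) {J I : Finset κ} (h : J ⊆ I) : sm c J + sm c (I \ J) = sm c I := by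
  rw [add_comm]; exact sum_sdiff h

/-- The polynomial multiples `(Σ_I c)^2 F_g(c_I)` of the `n`-point functions, collected into a
power series in the genus variable. -/
def psi (c : κ → A) (I : Finset κ) : A⟦X⟧ :=
  if I = ∅ then 0 else
    PowerSeries.mk (eulerCoeff (#I - 1) (sm c I ^ 3) (fun g => PowerSeries.coeff g
      (6 * PowerSeries.C (sm c I) * ∑ J ∈ (I.ssubsets.erase ∅).attach, psi c J.1 * psi c (I \ J.1))))
termination_by #I
decreasing_by
  · have := J.2
    rw [mem_erase, mem_ssubsets] at this
    exact card_lt_card this.2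
  · have := J.2
    rw [mem_erase, mem_ssubsets] at this
    exact card_lt_card (sdiff_ssubset this.2.1 (nonempty_iff_ne_empty.2 this.1))

@[simp] lemma psi_empty (c : κ → A) : psi c ∅ = 0 := by rw [psi]; simp

omit [Algebra ℚ A] in
lemma sum_powerset_eq_ssubsets {w : Finset κ → A⟦X⟧} (h0 : w ∅ = 0) {I : Finset κ} :
    ∑ J ∈ I.powerset, w J * w (I \ J) = ∑ J ∈ I.ssubsets.erase ∅, w J * w (I \ J) := by
  symm
  refine sum_subset ?_ ?_
  · intro J hJ
    rw [mem_erase, mem_ssubsets] at hJ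
    exact mem_powerset.2 hJ.2.1
  · intro J hJ hJ'
    rw [mem_powerset] at hJ
    by_cases h : J = ∅
    · simp [h, h0]
    · have : J = I := by
        by_contra hne
        exact hJ' (mem_erase.2 ⟨h, mem_ssubsets.2 (Finset.ssubset_iff_subset_ne.2 ⟨hJ, hne⟩)⟩)
      simp [this, h0]

lemma psi_singleton_coeff (c : κ → A) (i : κ) : PowerSeries.coeff 0 (psi c {i}) = 1 := by
  rw [psi]; simp [eulerCoeff]

/-- The Korteweg-de Vries equation for the `n`-point functions. -/
lemma psi_kdv (c : κ → A) (I : Finset κ) :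
    24 * theta A (psi c I) + 12 * ((#I : A⟦X⟧) - 1) * psi c I =
      PowerSeries.X * PowerSeries.C (sm c I ^ 3) * psi c I +
        6 * PowerSeries.C (sm c I) * ∑ J ∈ I.powerset, psi c J * psi c (I \ J) := by
  by_cases hI : I = ∅
  · subst hI; simp
  · have hc : 1 ≤ #I := card_pos.2 (nonempty_iff_ne_empty.2 hI)
    have e : psi c I = PowerSeries.mk (eulerCoeff (#I - 1) (sm c I ^ 3) (fun g => PowerSeries.coeff g
      (6 * PowerSeries.C (sm c I) * ∑ J ∈ I.powerset, psi c J * psi c (I \ J)))) := by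
      rw [sum_powerset_eq_ssubsets (psi_empty c)]
      conv_lhs => rw [psi]
      rw [if_neg hI, sum_attach _ (fun J => psi c J * psi c (I \ J))]
    have := euler_exists (#I - 1) (sm c I ^ 3)
      (6 * PowerSeries.C (sm c I) * ∑ J ∈ I.powerset, psi c J * psi c (I \ J)) (by
        intro h
        obtain ⟨i, rfl⟩ := card_eq_one.1 (by omega : #I = 1)
        rw [sum_powerset_eq_ssubsets (psi_empty c), show ({i} : Finset κ).ssubsets.erase ∅ = ∅ by
          ext J; simp [Finset.ssubset_singleton_iff]]
        simp)
    rw [← e] at this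
    rw [← this, Nat.cast_sub hc, Nat.cast_one]

/-- Uniqueness of the solution of the KdV recursion. -/
lemma eq_psi {c : κ → A} {w : Finset κ → A⟦X⟧} (h0 : w ∅ = 0)
    (h1 : ∀ i, PowerSeries.coeff 0 (w {i}) = 1)
    (hw : ∀ I, 24 * theta A (w I) + 12 * ((#I : A⟦X⟧) - 1) * w I =
      PowerSeries.X * PowerSeries.C (sm c I ^ 3) * w I + 6 * PowerSeries.C (sm c I) * ∑ J ∈ I.powerset, w J * w (I \ J))
    (I : Finset κ) : w I = psi c I := by
  induction I using Finset.strongInduction with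
  | H I ih =>
    by_cases hI : I = ∅
    · rw [hI, h0, psi_empty]
    · have hc : 1 ≤ #I := card_pos.2 (nonempty_iff_ne_empty.2 hI)
      have a := hw I
      have b := psi_kdv c I
      have hs : ∑ J ∈ I.powerset, w J * w (I \ J) =
          ∑ J ∈ I.powerset, psi c J * psi c (I \ J) := by
        rw [sum_powerset_eq_ssubsets h0, sum_powerset_eq_ssubsets (psi_empty c)]
        refine sum_congr rfl fun J hJ => ?_
        rw [mem_erase, mem_ssubsets] at hJ
        rw [ih J hJ.2, ih _ (sdiff_ssubset hJ.2.1 (nonempty_iff_ne_empty.2 hJ.1))]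
      rw [hs] at a
      have hm : ((#I : A⟦X⟧) - 1) = ((#I - 1 : ℕ) : A⟦X⟧) := by
        rw [Nat.cast_sub hc, Nat.cast_one]
      rw [hm] at a b
      refine euler_unique a b ?_
      intro h
      obtain ⟨i, rfl⟩ := card_eq_one.1 (by omega : #I = 1)
      rw [h1, psi_singleton_coeff]

lemma psi_map {A' : Type*} [CommRing A'] [Algebra ℚ A'] (φ : A →+* A') (c : κ → A)
    (I : Finset κ) : psi (fun i => φ (c i)) I = PowerSeries.map φ (psi c I) := by
  refine (eq_psi (w := fun I => PowerSeries.map φ (psi c I)) (by simp)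
    (fun i => by simp [psi_singleton_coeff]) (fun I => ?_) I).symm
  have := congrArg (PowerSeries.map φ) (psi_kdv c I)
  have hs : φ (sm c I) = sm (fun i => φ (c i)) I := map_sum φ _ _
  have h6 : PowerSeries.map φ 6 = 6 := map_ofNat _ 6
  have h12 : PowerSeries.map φ 12 = 12 := map_ofNat _ 12
  have h24 : PowerSeries.map φ 24 = 24 := map_ofNat _ 24
  simpa [map_theta, map_sum, hs, h6, h12, h24] using this

lemma psi_comp {κ' : Type*} [DecidableEq κ'] (f : κ' ↪ κ) (c : κ → A) (I : Finset κ') :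
    psi (fun i => c (f i)) I = psi c (I.map f) := by
  refine (eq_psi (w := fun I => psi c (I.map f)) (by simp)
    (fun i => by simp [psi_singleton_coeff]) (fun I => ?_) I).symm
  have := psi_kdv c (I.map f)
  have hs : sm c (I.map f) = sm (fun i => c (f i)) I := by simp [sm]
  rw [hs, card_map] at this
  rw [this]
  congr 2
  symm
  refine sum_nbij (fun J => J.map f) ?_ ?_ ?_ ?_
  · intro J hJ
    exact mem_powerset.2 (map_subset_map.2 (mem_powerset.1 hJ))
  · intro J _ J' _ h; exact map_injective f h
  · intro J hJ
    obtain ⟨J', h, rfl⟩ := subset_map_iff.1 (mem_powerset.1 hJ)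
    exact ⟨J', mem_powerset.2 h, rfl⟩
  · intro J hJ
    rw [Finset.map_sdiff]

end Psi

section Linear

variable {κ A : Type*} [DecidableEq κ] [CommRing A] [Algebra ℚ A]

/-- The equation satisfied by the `n`-point functions with one marked argument `y`. -/
def IsMarked (c : κ → A) (y : A) (V : Finset κ → A⟦X⟧) (I : Finset κ) : Prop :=
  24 * theta A (V I) + 12 * (#I : A⟦X⟧) * V I =
    PowerSeries.X * PowerSeries.C ((y + sm c I) ^ 3) * V I +
      12 * PowerSeries.C (y + sm c I) * ∑ J ∈ I.powerset, psi c J * V (I \ J)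

lemma IsMarked.unique {c : κ → A} {y : A} {V V' : Finset κ → A⟦X⟧} {U : Finset κ}
    (h : ∀ I ⊆ U, IsMarked c y V I) (h' : ∀ I ⊆ U, IsMarked c y V' I)
    (h0 : PowerSeries.coeff 0 (V ∅) = PowerSeries.coeff 0 (V' ∅)) {I : Finset κ} (hI : I ⊆ U) :
    V I = V' I := by
  induction I using Finset.strongInduction with
  | H I ih =>
    have a := h I hI
    have b := h' I hI
    have hs : ∑ J ∈ I.powerset, psi c J * V (I \ J) = ∑ J ∈ I.powerset, psi c J * V' (I \ J) := by
      refine sum_congr rfl fun J hJ => ?_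
      by_cases hJ0 : J = ∅
      · simp [hJ0]
      · have hlt := sdiff_ssubset (mem_powerset.1 hJ) (nonempty_iff_ne_empty.2 hJ0)
        rw [ih _ hlt (hlt.1.trans hI)]
    rw [IsMarked] at a b
    rw [hs] at a
    refine euler_unique a b fun hm => ?_
    rw [card_eq_zero.1 hm, h0]

lemma isMarked_insert (c : κ → A) {i : κ} {I : Finset κ} (hi : i ∉ I) :
    IsMarked c (c i) (fun J => psi c (insert i J)) I := by
  have := psi_kdv c (insert i I)
  rw [sm_insert c hi, card_insert_of_notMem hi, sum_powerset_insert hi] at this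
  have h1 : ∑ J ∈ I.powerset, psi c J * psi c (insert i I \ J) =
      ∑ J ∈ I.powerset, psi c J * psi c (insert i (I \ J)) := by
    refine sum_congr rfl fun J hJ => ?_
    rw [insert_sdiff_of_notMem _ (fun h => hi (mem_powerset.1 hJ h))]
  have h2 : ∑ J ∈ I.powerset, psi c (insert i J) * psi c (insert i I \ insert i J) =
      ∑ J ∈ I.powerset, psi c J * psi c (insert i (I \ J)) := by
    rw [← sum_powerset_sdiff I (fun J K => psi c K * psi c (insert i J))]
    refine sum_congr rfl fun J hJ => ?_
    rw [insert_sdiff_insert, sdiff_insert_of_notMem hi, mul_comm]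
  rw [h1, h2] at this
  rw [IsMarked]
  push_cast at this
  linear_combination this

lemma sum_psi_mul_theta (c : κ → A) (I : Finset κ) :
    2 * ∑ J ∈ I.powerset, psi c J *
        (2 * theta A (psi c (I \ J)) + (#(I \ J) : A⟦X⟧) * psi c (I \ J)) =
      2 * theta A (∑ J ∈ I.powerset, psi c J * psi c (I \ J)) +
        (#I : A⟦X⟧) * ∑ J ∈ I.powerset, psi c J * psi c (I \ J) := by
  have e := sum_powerset_sdiff I (fun J K => psi c J *
        (2 * theta A (psi c K) + (#K : A⟦X⟧) * psi c K))
  rw [two_mul]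
  nth_rewrite 1 [e]
  rw [map_sum, mul_sum, mul_sum, ← sum_add_distrib, ← sum_add_distrib]
  refine sum_congr rfl fun J hJ => ?_
  have hc : (#I : A⟦X⟧) = #J + #(I \ J) := by
    rw [← Nat.cast_add, add_comm, card_sdiff_add_card_eq_card (mem_powerset.1 hJ)]
  rw [theta_mul, hc]
  ring

lemma sum_psi_mul_sm (c : κ → A) (I : Finset κ) :
    2 * ∑ J ∈ I.powerset, psi c J * (PowerSeries.C (sm c (I \ J)) * psi c (I \ J)) =
      PowerSeries.C (sm c I) * ∑ J ∈ I.powerset, psi c J * psi c (I \ J) := by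
  have e := sum_powerset_sdiff I (fun J K => psi c J * (PowerSeries.C (sm c K) * psi c K))
  rw [two_mul]
  nth_rewrite 1 [e]
  rw [mul_sum, ← sum_add_distrib]
  refine sum_congr rfl fun J hJ => ?_
  rw [← sm_sdiff c (mem_powerset.1 hJ), map_add]
  ring

/-- The string and dilaton equations: insertion of an argument of square zero. -/
lemma psi_insert_of_sq_eq_zero (c : κ → A) {i : κ} (hi : c i ^ 2 = 0) {I : Finset κ}
    (hI : i ∉ I) :
    psi c (insert i I) = (if I = ∅ then 1 else 0) + PowerSeries.C (sm c I) * psi c I +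
      PowerSeries.C (c i) * (2 * theta A (psi c I) + (#I : A⟦X⟧) * psi c I) := by
  refine IsMarked.unique (c := c) (y := c i) (U := I) (V := fun J => psi c (insert i J))
    (V' := fun J => (if J = ∅ then 1 else 0) + PowerSeries.C (sm c J) * psi c J +
      PowerSeries.C (c i) * (2 * theta A (psi c J) + (#J : A⟦X⟧) * psi c J))
    (fun J hJ => isMarked_insert c fun h => hI (hJ h)) (fun J hJ => ?_) ?_ Subset.rfl
  · rw [IsMarked]
    set ε : A⟦X⟧ := PowerSeries.C (c i) with hε
    have hε2 : ε ^ 2 = 0 := by rw [hε, ← map_pow, hi, map_zero]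
    set S : A⟦X⟧ := PowerSeries.C (sm c J) with hS
    set p := psi c J with hp
    set Ee := ∑ K ∈ J.powerset, psi c K * psi c (J \ K) with hE
    set F := ∑ K ∈ J.powerset, psi c K *
        (2 * theta A (psi c (J \ K)) + (#(J \ K) : A⟦X⟧) * psi c (J \ K)) with hF
    set G := ∑ K ∈ J.powerset, psi c K * (PowerSeries.C (sm c (J \ K)) * psi c (J \ K)) with hG
    have kdv := psi_kdv c J
    have h1 := sum_psi_mul_theta c J
    have h2 := sum_psi_mul_sm c J
    rw [← hE, ← hF] at h1
    rw [← hE, ← hG, ← hS] at h2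
    rw [← hE, ← hp, map_pow, ← hS] at kdv
    have dkdv := congrArg (theta A) kdv
    have t24 : ∀ f : A⟦X⟧, theta A (24 * f) = 24 * theta A f := fun f => by
      rw [show (24 : A⟦X⟧) = PowerSeries.C 24 from (map_ofNat PowerSeries.C 24).symm, theta_C_mul]
    have t2 : ∀ f : A⟦X⟧, theta A (2 * f) = 2 * theta A f := fun f => by
      rw [show (2 : A⟦X⟧) = PowerSeries.C 2 from (map_ofNat PowerSeries.C 2).symm, theta_C_mul]
    have tn : ∀ (n : ℕ) (f : A⟦X⟧), theta A (n * f) = n * theta A f := fun n f => by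
      rw [show (n : A⟦X⟧) = PowerSeries.C (n : A) from (map_natCast PowerSeries.C n).symm,
        theta_C_mul]
    have t12 : theta A (12 * ((#J : A⟦X⟧) - 1) * p) = 12 * ((#J : A⟦X⟧) - 1) * theta A p := by
      rw [show 12 * ((#J : A⟦X⟧) - 1) = PowerSeries.C (12 * ((#J : A) - 1)) by
        rw [map_mul, map_sub, map_natCast, map_one, map_ofNat], theta_C_mul]
    have tS3 : theta A (PowerSeries.X * S ^ 3 * p) =
        PowerSeries.X * S ^ 3 * p + PowerSeries.X * S ^ 3 * theta A p := by
      rw [mul_assoc, theta_mul, theta_X, hS, ← map_pow, theta_C_mul]; ring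
    have t6 : theta A (6 * S * Ee) = 6 * S * theta A Ee := by
      rw [show 6 * S = PowerSeries.C (6 * sm c J) by rw [map_mul, map_ofNat], theta_C_mul]
    rw [map_add, map_add, t24, t12, tS3, t6] at dkdv
    have hsum : ∑ K ∈ J.powerset, psi c K * ((if J \ K = ∅ then 1 else 0) +
        PowerSeries.C (sm c (J \ K)) * psi c (J \ K) + ε *
          (2 * theta A (psi c (J \ K)) + (#(J \ K) : A⟦X⟧) * psi c (J \ K))) =
        p + G + ε * F := by
      simp only [mul_add, sum_add_distrib, hG, hF, mul_sum]
      have : ∑ K ∈ J.powerset, psi c K * (if J \ K = ∅ then 1 else 0) = p := by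
        rw [sum_eq_single J]
        · simp [hp]
        · intro K hK hne
          rw [if_neg, mul_zero]
          intro h
          exact hne (Subset.antisymm (mem_powerset.1 hK) (Finset.sdiff_eq_empty_iff_subset.1 h))
        · simp
      rw [this]
      simp only [← sum_add_distrib, add_assoc]
      congr 1
      refine sum_congr rfl fun K _ => ?_
      ring
    rw [hsum]
    have hδ : theta A (if J = ∅ then 1 else 0) = 0 := by split_ifs <;> simp
    have hδS : S * (if J = ∅ then 1 else 0) = 0 := by
      split_ifs with h
      · simp [hS, h]
      · simp
    have hδN : (#J : A⟦X⟧) * (if J = ∅ then 1 else 0) = 0 := by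
      split_ifs with h
      · simp [h]
      · simp
    set δ : A⟦X⟧ := if J = ∅ then 1 else 0
    rw [map_add, map_add, hδ, hS, theta_C_mul, ← hS, hε, theta_C_mul, ← hε, map_add, t2, tn,
      map_pow, map_add, ← hε, ← hS]
    refine natCast_mul_cancel (k := 2) two_ne_zero ?_
    push_cast
    linear_combination 2 * S * kdv + 2 * ε * (2 * dkdv + (#J : A⟦X⟧) * kdv) + 2 * ε * kdv -
      12 * S * ε * h1 - 12 * (S + ε) * h2 + 24 * hδN -
      2 * PowerSeries.X * (S ^ 2 + 3 * S * ε) * hδS -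
      2 * (PowerSeries.X * ((3 * S + ε) * (δ + S * p + ε * (2 * theta A p + (#J : A⟦X⟧) * p)) +
        3 * S ^ 2 * (2 * theta A p + (#J : A⟦X⟧) * p)) + 12 * F) * hε2
  · simp [psi_singleton_coeff]

end Linear

section Marked

variable {κ A : Type*} [DecidableEq κ] [CommRing A] [Algebra ℚ A]

/-- Extension of a family of arguments by a marked argument. -/
def withMark (c : κ → A) (y : A) : Option κ → A := fun o => o.elim y c

/-- The `n`-point functions with a marked argument `y`. -/
def psiMark (c : κ → A) (y : A) (I : Finset κ) : A⟦X⟧ := psi (withMark c y) (insertNone I)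

lemma insertNone_eq_insert (I : Finset κ) : insertNone I = insert none (I.map .some) := by
  ext (_ | x) <;> simp

lemma psi_withMark_map (c : κ → A) (y : A) (I : Finset κ) :
    psi (withMark c y) (I.map .some) = psi c I := (psi_comp .some (withMark c y) I).symm

lemma psiMark_isMarked (c : κ → A) (y : A) (I : Finset κ) : IsMarked c y (psiMark c y) I := by
  have h := isMarked_insert (withMark c y) (i := none) (I := I.map .some) (by simp)
  have hs : sm (withMark c y) (I.map .some) = sm c I := by simp [sm, withMark]
  rw [IsMarked, card_map, hs] at h
  simp only [psiMark, IsMarked, insertNone_eq_insert]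
  rw [show withMark c y none = y from rfl] at h
  rw [h]
  congr 2
  symm
  refine sum_nbij (fun J => J.map .some) ?_ ?_ ?_ ?_
  · intro J hJ
    exact mem_powerset.2 (map_subset_map.2 (mem_powerset.1 hJ))
  · intro J _ J' _ h; exact map_injective .some h
  · intro J hJ
    obtain ⟨J', h, rfl⟩ := subset_map_iff.1 (mem_powerset.1 hJ)
    exact ⟨J', mem_powerset.2 h, rfl⟩
  · intro J hJ
    rw [psi_withMark_map, Finset.map_sdiff]

lemma psiMark_empty_coeff (c : κ → A) (y : A) : PowerSeries.coeff 0 (psiMark c y ∅) = 1 := by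
  rw [psiMark, insertNone_eq_insert]
  exact psi_singleton_coeff _ _

lemma psiMark_map {A' : Type*} [CommRing A'] [Algebra ℚ A'] (φ : A →+* A') (c : κ → A) (y : A)
    (I : Finset κ) :
    psiMark (fun i => φ (c i)) (φ y) I = PowerSeries.map φ (psiMark c y I) := by
  rw [psiMark, psiMark, ← psi_map]
  congr 1
  funext o
  cases o <;> rfl

lemma psiMark_insert_of_sq_eq_zero (c : κ → A) (y : A) {i : κ} (hi : c i ^ 2 = 0) {I : Finset κ}
    (hI : i ∉ I) :
    psiMark c y (insert i I) = PowerSeries.C (y + sm c I) * psiMark c y I +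
      PowerSeries.C (c i) * (2 * theta A (psiMark c y I) + ((#I : A⟦X⟧) + 1) * psiMark c y I) := by
  have h := psi_insert_of_sq_eq_zero (withMark c y) (i := some i) hi (I := insertNone I)
    (by simpa using hI)
  have hne : insertNone I ≠ ∅ := by
    rw [insertNone_eq_insert]; exact insert_ne_empty _ _
  have hs : sm (withMark c y) (insertNone I) = y + sm c I := by
    rw [insertNone_eq_insert, sm_insert _ (by simp)]
    simp [sm, withMark]
  have hins : insertNone (insert i I) = insert (some i) (insertNone I) := by
    ext (_ | x) <;> simp
  rw [if_neg hne, zero_add, hs, card_insertNone] at h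
  rw [psiMark, hins, h, psiMark]
  push_cast
  rfl

lemma psiMark_insert_dvd (c : κ → A) (y : A) {i : κ} {I : Finset κ} (hI : i ∉ I) (g : ℕ) :
    c i ^ 2 ∣ PowerSeries.coeff g (psiMark c y (insert i I) -
      (PowerSeries.C (y + sm c I) * psiMark c y I + PowerSeries.C (c i) *
        (2 * theta A (psiMark c y I) + ((#I : A⟦X⟧) + 1) * psiMark c y I))) := by
  rw [← Ideal.mem_span_singleton, ← Ideal.Quotient.eq_zero_iff_mem]
  set φ := Ideal.Quotient.mk (Ideal.span {c i ^ 2}) with hφ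
  have h0 : (fun j => φ (c j)) i ^ 2 = 0 := by
    rw [← map_pow, hφ, Ideal.Quotient.eq_zero_iff_mem]
    exact Ideal.mem_span_singleton_self _
  have h := psiMark_insert_of_sq_eq_zero (fun j => φ (c j)) (φ y) h0 hI
  have hs : sm (fun j => φ (c j)) I = φ (sm c I) := (map_sum φ _ _).symm
  rw [psiMark_map, psiMark_map, hs, ← map_theta] at h
  have h2 : PowerSeries.map φ 2 = 2 := map_ofNat _ 2
  have h' : PowerSeries.map φ (psiMark c y (insert i I) -
      (PowerSeries.C (y + sm c I) * psiMark c y I + PowerSeries.C (c i) *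
        (2 * theta A (psiMark c y I) + ((#I : A⟦X⟧) + 1) * psiMark c y I))) = 0 := by
    rw [map_sub, h]
    simp [h2]
  rw [← PowerSeries.coeff_map, h', map_zero]

end Marked

section Binomial

variable {A : Type*} [CommRing A] [Algebra ℚ A]

lemma binomZ_zero (p : ℤ) : binomZ p 0 = 1 := by simp [binomZ]

lemma binomZ_one (p : ℤ) : binomZ p 1 = p := by simp [binomZ]

lemma binomZ_two (p : ℤ) : binomZ p 2 = p * (p - 1) / 2 := by
  simp [binomZ, prod_range_succ]

lemma binomZ_succ_succ (p : ℤ) (k : ℕ) :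
    binomZ (p + 1) (k + 1) = binomZ p k + binomZ p (k + 1) := by
  have h1 : ∏ i ∈ range (k + 1), (((p + 1 : ℤ) : ℚ) - i) =
      (p + 1) * ∏ i ∈ range k, ((p : ℚ) - i) := by
    rw [prod_range_succ']
    push_cast
    rw [mul_comm]
    congr 1
    · ring
    · refine prod_congr rfl fun i _ => by ring
  simp only [binomZ]
  rw [h1, prod_range_succ, Nat.factorial_succ]
  have := Nat.factorial_ne_zero k
  have : (k.factorial : ℚ) ≠ 0 := by exact_mod_cast this
  push_cast
  field_simp
  ring

/-- The truncated binomial expansion of `(u + s)^m`. -/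
def binomSum (u : Aˣ) (s : A) (m : ℤ) (T : ℕ) : A :=
  ∑ k ∈ range T, algebraMap ℚ A (binomZ m k) * s ^ k * ↑(u ^ (m - k))

lemma binomSum_succ_dvd (u : Aˣ) (s : A) (m : ℤ) (T : ℕ) :
    s ^ T ∣ binomSum u s (m + 1) T - (u + s) * binomSum u s m T := by
  cases T with
  | zero => simp
  | succ T =>
    refine ⟨- (algebraMap ℚ A (binomZ m T) * ↑(u ^ (m - T))), ?_⟩
    have hu : ∀ k : ℕ, (u : A) * ↑(u ^ (m - k)) = ↑(u ^ (m + 1 - k)) := by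
      intro k
      rw [← Units.val_mul, ← zpow_one_add]
      congr 2; ring
    have e1 : binomSum u s (m + 1) (T + 1) = ↑(u ^ (m + 1)) +
        ∑ k ∈ range T, algebraMap ℚ A (binomZ m k) * s ^ (k + 1) * ↑(u ^ (m - k)) +
        ∑ k ∈ range T, algebraMap ℚ A (binomZ m (k + 1)) * s ^ (k + 1) * ↑(u ^ (m - k)) := by
      rw [binomSum, sum_range_succ', add_assoc, ← sum_add_distrib, add_comm]
      congr 1
      · simp [binomZ_zero]
      · refine sum_congr rfl fun k _ => ?_
        rw [binomZ_succ_succ, map_add]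
        push_cast
        rw [show m + 1 - (k + 1 : ℤ) = m - k by ring]
        ring
    have e2 : s * binomSum u s m (T + 1) =
        ∑ k ∈ range T, algebraMap ℚ A (binomZ m k) * s ^ (k + 1) * ↑(u ^ (m - k)) +
          algebraMap ℚ A (binomZ m T) * s ^ (T + 1) * ↑(u ^ (m - T)) := by
      rw [binomSum, sum_range_succ, mul_add, mul_sum]
      congr 1
      · refine sum_congr rfl fun k _ => by ring
      · ring
    have e3 : (u : A) * binomSum u s m (T + 1) = ↑(u ^ (m + 1)) +
        ∑ k ∈ range T, algebraMap ℚ A (binomZ m (k + 1)) * s ^ (k + 1) * ↑(u ^ (m - k)) := by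
      rw [binomSum, sum_range_succ', mul_add, add_comm, mul_sum]
      congr 1
      · simp [binomZ_zero, ← zpow_one_add, ← Units.val_mul, add_comm]
      · refine sum_congr rfl fun k _ => ?_
        rw [mul_left_comm, hu]
        push_cast
        rw [show m + 1 - (k + 1 : ℤ) = m - k by ring]
    rw [add_mul, e1, e2, e3]
    ring

/-- The binomial theorem with integral exponents, modulo powers of the increment. -/
lemma zpow_sub_binomSum_dvd (u v : Aˣ) (s : A) (h : (v : A) = u + s) (m : ℤ) (T : ℕ) :
    s ^ T ∣ ↑(v ^ m) - binomSum u s m T := by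
  have up : ∀ m : ℤ, s ^ T ∣ ↑(v ^ m) - binomSum u s m T →
      s ^ T ∣ ↑(v ^ (m + 1)) - binomSum u s (m + 1) T := by
    intro m hm
    have e : (↑(v ^ (m + 1)) : A) - binomSum u s (m + 1) T =
        v * (↑(v ^ m) - binomSum u s m T) -
          (binomSum u s (m + 1) T - (u + s) * binomSum u s m T) := by
      rw [zpow_add_one, Units.val_mul, ← h]; ring
    rw [e]
    exact dvd_sub (hm.mul_left _) (binomSum_succ_dvd u s m T)
  have down : ∀ m : ℤ, s ^ T ∣ ↑(v ^ (m + 1)) - binomSum u s (m + 1) T →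
      s ^ T ∣ ↑(v ^ m) - binomSum u s m T := by
    intro m hm
    have e : (↑(v ^ m) : A) - binomSum u s m T =
        ↑v⁻¹ * ((↑(v ^ (m + 1)) - binomSum u s (m + 1) T) +
          (binomSum u s (m + 1) T - (u + s) * binomSum u s m T)) := by
      rw [zpow_add_one, Units.val_mul, ← h]
      have : (↑v⁻¹ : A) * v = 1 := Units.inv_mul v
      linear_combination (binomSum u s m T - ↑(v ^ m)) * this
    rw [e]
    exact (dvd_add hm (binomSum_succ_dvd u s m T)).mul_left _
  induction m using Int.induction_on with
  | zero =>
    cases T with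
    | zero => simp
    | succ T =>
      have : binomSum u s 0 (T + 1) = 1 := by
        rw [binomSum, sum_range_succ', sum_eq_zero]
        · simp [binomZ_zero]
        · intro k _
          have : binomZ 0 (k + 1) = 0 := by
            rw [binomZ, prod_range_succ']; simp
          simp [this]
      simp [this]
  | succ k ih => exact up _ ih
  | pred k ih => exact down _ (by rwa [sub_add_cancel])

end Binomial

/-- Arguments `c`, weights `l`, `r` for the two factors, and units `α I = 1 + Σ_I c`,
`β I = -1 + Σ_I c`. -/
structure Args (ι A : Type*) [CommRing A] where
  c : ι → A
  l : ι → A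
  r : ι → A
  α : Finset ι → Aˣ
  β : Finset ι → Aˣ
  hα : ∀ I, (α I : A) = 1 + sm c I
  hβ : ∀ I, (β I : A) = -1 + sm c I

namespace Args

variable {ι A : Type*} [DecidableEq ι] [CommRing A] [Algebra ℚ A] (D : Args ι A)

/-- The product of the two families of marked `n`-point functions at `y = 1` and `y = -1`. -/
def vv (I J : Finset ι) : A⟦X⟧ := psiMark D.c 1 I * psiMark D.c (-1) J

/-- `Σ_I (1 + Σ_I c)^p (-1 + Σ_J c)^q V_1(I) V_{-1}(J)` over weighted splittings `U = I ⊔ J`,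
with `(1 + Σ_{I ∪ E} c)^p` instead if `E` is nonempty. -/
def NL (E : Finset ι) (p q : ℤ) (U : Finset ι) : A⟦X⟧ :=
  ∑ I ∈ U.powerset, PowerSeries.C ((∏ i ∈ I, D.l i) * (∏ i ∈ U \ I, D.r i) *
    ↑(D.α (E ∪ I) ^ p) * ↑(D.β (U \ I) ^ q)) * D.vv I (U \ I)

/-- The variant of `NL` with the shift in the second factor. -/
def NR (E : Finset ι) (p q : ℤ) (U : Finset ι) : A⟦X⟧ :=
  ∑ I ∈ U.powerset, PowerSeries.C ((∏ i ∈ I, D.l i) * (∏ i ∈ U \ I, D.r i) *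
    ↑(D.α I ^ p) * ↑(D.β (E ∪ U \ I) ^ q)) * D.vv I (U \ I)

/-- `Σ_I (1 + Σ_I c)^p (-1 + Σ_J c)^q V_1(I) V_{-1}(J)` over weighted splittings `U = I ⊔ J`. -/
def M (p q : ℤ) (U : Finset ι) : A⟦X⟧ :=
  ∑ I ∈ U.powerset, PowerSeries.C ((∏ i ∈ I, D.l i) * (∏ i ∈ U \ I, D.r i) *
    ↑(D.α I ^ p) * ↑(D.β (U \ I) ^ q)) * D.vv I (U \ I)

omit [Algebra ℚ A] in
lemma zpow_cube_identity {U I : Finset ι} (hI : I ⊆ U) (p q : ℤ) :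
    (↑(D.α I ^ p) * ↑(D.β (U \ I) ^ q) : A) * ((1 + sm D.c I) ^ 3 + (-1 + sm D.c (U \ I)) ^ 3) =
      sm D.c U ^ 3 * (↑(D.α I ^ p) * ↑(D.β (U \ I) ^ q)) -
        3 * sm D.c U * (↑(D.α I ^ (p + 1)) * ↑(D.β (U \ I) ^ (q + 1))) := by
  rw [zpow_add_one, zpow_add_one, Units.val_mul, Units.val_mul, D.hα, D.hβ, ← sm_sdiff D.c hI]
  ring

lemma psiMark_theta (y : A) (I : Finset ι) :
    24 * theta A (psiMark D.c y I) + 12 * (#I : A⟦X⟧) * psiMark D.c y I =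
    PowerSeries.X * PowerSeries.C ((y + sm D.c I) ^ 3) * psiMark D.c y I +
      12 * PowerSeries.C (y + sm D.c I) * ∑ J ∈ I.powerset, psi D.c J * psiMark D.c y (I \ J) :=
  psiMark_isMarked D.c y I

lemma sum_left (p q : ℤ) (U : Finset ι) :
    ∑ I ∈ U.powerset, PowerSeries.C ((∏ i ∈ I, D.l i) * (∏ i ∈ U \ I, D.r i) *
        ↑(D.α I ^ p) * ↑(D.β (U \ I) ^ q)) *
        ((∑ J ∈ I.powerset, psi D.c J * psiMark D.c 1 (I \ J)) * psiMark D.c (-1) (U \ I)) =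
      ∑ E ∈ U.powerset, psi D.c E * (PowerSeries.C (∏ i ∈ E, D.l i) * D.NL E p q (U \ E)) := by
  have h := sum_powerset_powerset U (fun E I J => PowerSeries.C ((∏ i ∈ E, D.l i) *
    (∏ i ∈ I, D.l i) * (∏ i ∈ J, D.r i) * ↑(D.α (E ∪ I) ^ p) * ↑(D.β J ^ q)) *
      (psi D.c E * psiMark D.c 1 I * psiMark D.c (-1) J))
  refine Eq.trans ?_ (h.trans ?_)
  · refine sum_congr rfl fun I _ => ?_
    rw [sum_mul, mul_sum]
    refine sum_congr rfl fun E hE => ?_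
    rw [union_sdiff_of_subset (mem_powerset.1 hE), ← prod_sdiff (mem_powerset.1 hE),
      mul_comm (∏ i ∈ I \ E, D.l i)]
  · refine sum_congr rfl fun E _ => ?_
    rw [NL, mul_sum, mul_sum]
    refine sum_congr rfl fun I _ => ?_
    simp only [map_mul, vv]
    ring

lemma sum_right (p q : ℤ) (U : Finset ι) :
    ∑ I ∈ U.powerset, PowerSeries.C ((∏ i ∈ I, D.l i) * (∏ i ∈ U \ I, D.r i) *
        ↑(D.α I ^ p) * ↑(D.β (U \ I) ^ q)) *
        (psiMark D.c 1 I *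
          ∑ J ∈ (U \ I).powerset, psi D.c J * psiMark D.c (-1) ((U \ I) \ J)) =
      ∑ E ∈ U.powerset, psi D.c E * (PowerSeries.C (∏ i ∈ E, D.r i) * D.NR E p q (U \ E)) := by
  have h := sum_powerset_powerset U (fun E J I => PowerSeries.C ((∏ i ∈ I, D.l i) *
    ((∏ i ∈ E, D.r i) * (∏ i ∈ J, D.r i)) * ↑(D.α I ^ p) * ↑(D.β (E ∪ J) ^ q)) *
      (psiMark D.c 1 I * (psi D.c E * psiMark D.c (-1) J)))
  refine Eq.trans ?_ (h.trans ?_)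
  · have h' := sum_powerset_sdiff U (fun I J => PowerSeries.C ((∏ i ∈ I, D.l i) *
        (∏ i ∈ J, D.r i) * ↑(D.α I ^ p) * ↑(D.β J ^ q)) *
        (psiMark D.c 1 I * ∑ E ∈ J.powerset, psi D.c E * psiMark D.c (-1) (J \ E)))
    refine h'.trans (sum_congr rfl fun J _ => ?_)
    rw [mul_sum, mul_sum]
    refine sum_congr rfl fun E hE => ?_
    rw [union_sdiff_of_subset (mem_powerset.1 hE), ← prod_sdiff (mem_powerset.1 hE),
      mul_comm (∏ i ∈ J \ E, D.r i)]
  · refine sum_congr rfl fun E _ => ?_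
    rw [sum_powerset_sdiff (U \ E) (fun J I => PowerSeries.C ((∏ i ∈ I, D.l i) *
      ((∏ i ∈ E, D.r i) * (∏ i ∈ J, D.r i)) * ↑(D.α I ^ p) * ↑(D.β (E ∪ J) ^ q)) *
      (psiMark D.c 1 I * (psi D.c E * psiMark D.c (-1) J)))]
    rw [NR, mul_sum, mul_sum]
    refine sum_congr rfl fun I _ => ?_
    simp only [map_mul, vv]
    ring

/-- The recursion for the functions `M`. -/
lemma M_rec (p q : ℤ) (U : Finset ι) :
    24 * theta A (D.M p q U) + 12 * (#U : A⟦X⟧) * D.M p q U =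
      PowerSeries.X * (PowerSeries.C (sm D.c U ^ 3) * D.M p q U -
        3 * PowerSeries.C (sm D.c U) * D.M (p + 1) (q + 1) U) +
      12 * ∑ E ∈ U.powerset, psi D.c E *
        (PowerSeries.C (∏ i ∈ E, D.l i) * D.NL E (p + 1) q (U \ E) +
          PowerSeries.C (∏ i ∈ E, D.r i) * D.NR E p (q + 1) (U \ E)) := by
  simp only [mul_add, sum_add_distrib]
  rw [← sum_left, ← sum_right]
  simp only [M, map_sum, mul_sum, ← sum_add_distrib, ← sum_sub_distrib]
  refine sum_congr rfl fun I hI => ?_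
  have hI := mem_powerset.1 hI
  have h1 := D.psiMark_theta 1 I
  have h2 := D.psiMark_theta (-1) (U \ I)
  have hc : (#U : A⟦X⟧) = #I + #(U \ I) := by
    rw [← Nat.cast_add, add_comm, card_sdiff_add_card_eq_card hI]
  have h3 := congrArg PowerSeries.C (D.zpow_cube_identity hI p q)
  rw [theta_C_mul, vv, theta_mul, hc]
  simp only [zpow_add_one, Units.val_mul, D.hα, D.hβ, ← mul_sum] at h1 h2 h3 ⊢
  have e3 : (PowerSeries.C 3 : A⟦X⟧) = 3 := map_ofNat _ 3
  simp only [map_mul, map_add, map_pow, map_sub, e3] at h1 h2 h3 ⊢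
  linear_combination PowerSeries.C (∏ i ∈ I, D.l i) * PowerSeries.C (∏ i ∈ U \ I, D.r i) *
    PowerSeries.C (↑(D.α I ^ p) : A) * PowerSeries.C (↑(D.β (U \ I) ^ q) : A) *
    (psiMark D.c (-1) (U \ I) * h1 + psiMark D.c 1 I * h2) +
    PowerSeries.X * PowerSeries.C (∏ i ∈ I, D.l i) * PowerSeries.C (∏ i ∈ U \ I, D.r i) *
    psiMark D.c (-1) (U \ I) * psiMark D.c 1 I * h3

lemma disjoint_of_mem {E U I : Finset ι} (hE : Disjoint E U) (hI : I ∈ U.powerset) :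
    Disjoint E I ∧ Disjoint E (U \ I) :=
  ⟨hE.mono_right (mem_powerset.1 hI), hE.mono_right sdiff_subset⟩

lemma NL_dvd {E U : Finset ι} (hE : Disjoint E U) (p q : ℤ) (T g : ℕ) :
    sm D.c E ^ T ∣ PowerSeries.coeff g (D.NL E p q U) -
      ∑ k ∈ range T, algebraMap ℚ A (binomZ p k) * sm D.c E ^ k *
        PowerSeries.coeff g (D.M (p - k) q U) := by
  simp only [NL, M, map_sum, mul_sum]
  rw [sum_comm, ← sum_sub_distrib]
  refine dvd_sum fun I hI => ?_
  have hv : (D.α (E ∪ I) : A) = D.α I + sm D.c E := by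
    rw [D.hα, D.hα, sm, sum_union (disjoint_of_mem hE hI).1, sm, sm]; ring
  have := zpow_sub_binomSum_dvd (D.α I) (D.α (E ∪ I)) (sm D.c E) hv p T
  simp only [PowerSeries.coeff_C_mul]
  convert this.mul_left ((∏ i ∈ I, D.l i) * (∏ i ∈ U \ I, D.r i) * ↑(D.β (U \ I) ^ q) *
    PowerSeries.coeff g (D.vv I (U \ I))) using 1
  rw [binomSum, mul_sub, mul_sum]
  congr 1
  · ring
  · refine sum_congr rfl fun k _ => by ring

lemma NR_dvd {E U : Finset ι} (hE : Disjoint E U) (p q : ℤ) (T g : ℕ) :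
    sm D.c E ^ T ∣ PowerSeries.coeff g (D.NR E p q U) -
      ∑ k ∈ range T, algebraMap ℚ A (binomZ q k) * sm D.c E ^ k *
        PowerSeries.coeff g (D.M p (q - k) U) := by
  simp only [NR, M, map_sum, mul_sum]
  rw [sum_comm, ← sum_sub_distrib]
  refine dvd_sum fun I hI => ?_
  have hv : (D.β (E ∪ U \ I) : A) = D.β (U \ I) + sm D.c E := by
    rw [D.hβ, D.hβ, sm, sum_union (disjoint_of_mem hE hI).2, sm, sm]; ring
  have := zpow_sub_binomSum_dvd (D.β (U \ I)) (D.β (E ∪ U \ I)) (sm D.c E) hv q T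
  simp only [PowerSeries.coeff_C_mul]
  convert this.mul_left ((∏ i ∈ I, D.l i) * (∏ i ∈ U \ I, D.r i) * ↑(D.α I ^ p) *
    PowerSeries.coeff g (D.vv I (U \ I))) using 1
  rw [binomSum, mul_sub, mul_sum]
  congr 1
  · ring
  · refine sum_congr rfl fun k _ => by ring

lemma M_add_M (p q : ℤ) (U : Finset ι) :
    D.M (p + 1) q U + D.M p (q + 1) U = PowerSeries.C (sm D.c U) * D.M p q U := by
  simp only [M, mul_sum, ← sum_add_distrib]
  refine sum_congr rfl fun I hI => ?_
  have hI := mem_powerset.1 hI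
  simp only [zpow_add_one, Units.val_mul, D.hα, D.hβ, ← sm_sdiff D.c hI, map_mul, map_add,
    map_one, map_neg]
  ring

/-- The string and dilaton equations for the functions `M`. -/
lemma M_insert_dvd {i : ι} {U : Finset ι} (hi : i ∉ U) (p q : ℤ) (g : ℕ) :
    D.c i ^ 2 ∣ PowerSeries.coeff g (D.M p q (insert i U)) -
      (D.l i * PowerSeries.coeff g (D.M (p + 1) q U) + D.r i * PowerSeries.coeff g (D.M p (q + 1) U)
        + D.c i * (PowerSeries.coeff g (∑ I ∈ U.powerset,
          PowerSeries.C ((∏ i ∈ I, D.l i) * (∏ i ∈ U \ I, D.r i) *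
          ↑(D.α I ^ p) * ↑(D.β (U \ I) ^ q)) *
          (PowerSeries.C (D.l i) * (2 * theta A (psiMark D.c 1 I) * psiMark D.c (-1) (U \ I) +
              ((#I : A⟦X⟧) + 1 + (p : A⟦X⟧)) * D.vv I (U \ I)) +
            PowerSeries.C (D.r i) * (2 * theta A (psiMark D.c (-1) (U \ I)) * psiMark D.c 1 I +
              ((#(U \ I) : A⟦X⟧) + 1 + (q : A⟦X⟧)) * D.vv I (U \ I)))))) := by
  rw [← Ideal.mem_span_singleton, ← Ideal.Quotient.eq_zero_iff_mem]
  set φ := Ideal.Quotient.mk (Ideal.span {D.c i ^ 2}) with hφ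
  have h0 : φ (D.c i) ^ 2 = 0 := by
    rw [← map_pow, hφ, Ideal.Quotient.eq_zero_iff_mem]
    exact Ideal.mem_span_singleton_self _
  have hΨ : ∀ (y : A) (I : Finset ι), i ∉ I → PowerSeries.map φ (psiMark D.c y (insert i I)) =
      PowerSeries.map φ (PowerSeries.C (y + sm D.c I) * psiMark D.c y I + PowerSeries.C (D.c i) *
        (2 * theta A (psiMark D.c y I) + ((#I : A⟦X⟧) + 1) * psiMark D.c y I)) := by
    intro y I hI
    ext k
    have := psiMark_insert_dvd D.c y hI k
    rw [← Ideal.mem_span_singleton, ← Ideal.Quotient.eq_zero_iff_mem, map_sub, map_sub,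
      sub_eq_zero] at this
    rw [PowerSeries.coeff_map, PowerSeries.coeff_map]
    exact this
  have hA : ∀ (I : Finset ι), i ∉ I → φ (↑(D.α (insert i I) ^ p)) =
      φ (↑(D.α I ^ p) + p * D.c i * ↑(D.α I ^ (p - 1))) := by
    intro I hI
    have := zpow_sub_binomSum_dvd (D.α I) (D.α (insert i I)) (D.c i)
      (by rw [D.hα, D.hα, sm_insert _ hI]; ring) p 2
    rw [← Ideal.mem_span_singleton, ← Ideal.Quotient.eq_zero_iff_mem, map_sub,
      sub_eq_zero] at this
    rw [hφ, this]
    simp [binomSum, sum_range_succ, binomZ_zero, binomZ_one]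
  have hB : ∀ (I : Finset ι), i ∉ I → φ (↑(D.β (insert i I) ^ q)) =
      φ (↑(D.β I ^ q) + q * D.c i * ↑(D.β I ^ (q - 1))) := by
    intro I hI
    have := zpow_sub_binomSum_dvd (D.β I) (D.β (insert i I)) (D.c i)
      (by rw [D.hβ, D.hβ, sm_insert _ hI]; ring) q 2
    rw [← Ideal.mem_span_singleton, ← Ideal.Quotient.eq_zero_iff_mem, map_sub,
      sub_eq_zero] at this
    rw [hφ, this]
    simp [binomSum, sum_range_succ, binomZ_zero, binomZ_one]
  rw [map_sub, sub_eq_zero]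
  simp only [← PowerSeries.coeff_C_mul, ← map_add]
  rw [← PowerSeries.coeff_map, ← PowerSeries.coeff_map]
  congr 1
  simp only [M]
  rw [sum_powerset_insert hi, ← sum_add_distrib]
  simp only [mul_sum, ← sum_add_distrib, map_sum]
  refine sum_congr rfl fun I hI => ?_
  have hI := mem_powerset.1 hI
  have hiI : i ∉ I := fun h => hi (hI h)
  have hiJ : i ∉ U \ I := fun h => hi (mem_sdiff.1 h).1
  rw [insert_sdiff_of_notMem _ hiI, insert_sdiff_insert, sdiff_insert_of_notMem hi,
    prod_insert hiI, prod_insert hiJ]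
  have e2 : PowerSeries.map φ 2 = 2 := map_ofNat _ 2
  have h0' : (PowerSeries.C (φ (D.c i))) ^ 2 = 0 := by rw [← map_pow, h0, map_zero]
  have ha : D.α I ^ (p + 1) = D.α I ^ (p - 1) * D.α I * D.α I := by
    rw [← zpow_add_one, ← zpow_add_one]; congr 1; ring
  have ha' : D.α I ^ p = D.α I ^ (p - 1) * D.α I := by
    rw [← zpow_add_one]; congr 1; ring
  have hb : D.β (U \ I) ^ (q + 1) = D.β (U \ I) ^ (q - 1) * D.β (U \ I) * D.β (U \ I) := by
    rw [← zpow_add_one, ← zpow_add_one]; congr 1; ring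
  have hb' : D.β (U \ I) ^ q = D.β (U \ I) ^ (q - 1) * D.β (U \ I) := by
    rw [← zpow_add_one]; congr 1; ring
  simp only [vv, map_add, map_mul, hΨ _ _ hiI, hΨ _ _ hiJ, PowerSeries.map_C, hA _ hiI, hB _ hiJ]
  rw [ha, hb, ha', hb']
  simp only [map_mul, map_add, Units.val_mul, D.hα, D.hβ, e2, map_intCast, map_natCast, map_neg,
    map_one]
  generalize PowerSeries.C (φ (D.c i)) = e at *
  generalize PowerSeries.C (φ (D.l i)) = l
  generalize PowerSeries.C (φ (D.r i)) = r
  generalize PowerSeries.C (φ (∏ i ∈ I, D.l i)) = L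
  generalize PowerSeries.C (φ (∏ x ∈ U \ I, D.r x)) = R
  generalize PowerSeries.C (φ ↑(D.α I ^ (p - 1))) = a
  generalize PowerSeries.C (φ ↑(D.β (U \ I) ^ (q - 1))) = b
  generalize PowerSeries.map φ (psiMark D.c 1 I) = V
  generalize PowerSeries.map φ (psiMark D.c (-1) (U \ I)) = V'
  generalize PowerSeries.map φ (theta A (psiMark D.c 1 I)) = W
  generalize PowerSeries.map φ (theta A (psiMark D.c (-1) (U \ I))) = W'
  linear_combination (L * r * R * a * (1 + PowerSeries.C (φ (sm D.c I))) * q * b * V *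
      (2 * W' + (#(U \ I) + 1) * V') +
    l * L * R * p * a * b * (-1 + PowerSeries.C (φ (sm D.c (U \ I)))) *
      (2 * W + (#I + 1) * V) * V') * h0'

lemma M_insert_dvd_left {i : ι} {U : Finset ι} (hi : i ∉ U) (hl : D.l i = 1) (hr : D.r i = 0)
    (p q : ℤ) (g : ℕ) :
    D.c i ∣ PowerSeries.coeff g (D.M p q (insert i U)) - PowerSeries.coeff g (D.M (p + 1) q U) := by
  have h := (dvd_pow_self (D.c i) two_ne_zero).trans (D.M_insert_dvd hi p q g)
  rw [hl, hr, one_mul, zero_mul, add_zero, ← sub_sub] at h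
  exact (dvd_sub_left (dvd_mul_right _ _)).1 h

lemma M_insert_dvd_right {i : ι} {U : Finset ι} (hi : i ∉ U) (hl : D.l i = 0) (hr : D.r i = 1)
    (p q : ℤ) (g : ℕ) :
    D.c i ∣ PowerSeries.coeff g (D.M p q (insert i U)) - PowerSeries.coeff g (D.M p (q + 1) U) := by
  have h := (dvd_pow_self (D.c i) two_ne_zero).trans (D.M_insert_dvd hi p q g)
  rw [hl, hr, one_mul, zero_mul, zero_add, ← sub_sub] at h
  exact (dvd_sub_left (dvd_mul_right _ _)).1 h

lemma M_insert_dvd_both {i : ι} {U : Finset ι} (hi : i ∉ U) (hl : D.l i = 1) (hr : D.r i = 1)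
    (p q : ℤ) (g : ℕ) :
    D.c i ^ 2 ∣ PowerSeries.coeff g (D.M p q (insert i U)) -
      (sm D.c U * PowerSeries.coeff g (D.M p q U) +
        D.c i * ((2 * g + #U + 2 + p + q : ℤ) * PowerSeries.coeff g (D.M p q U))) := by
  have h := D.M_insert_dvd hi p q g
  rw [hl, hr, one_mul, one_mul, ← map_add, M_add_M, PowerSeries.coeff_C_mul] at h
  convert h using 5
  have e : ((2 * g + #U + 2 + p + q : ℤ) : A) * PowerSeries.coeff g (D.M p q U) =
      PowerSeries.coeff g (2 * theta A (D.M p q U) + ((#U : A⟦X⟧) + 2 + (p : A⟦X⟧) + (q : A⟦X⟧)) * D.M p q U) := by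
    have e' : 2 * theta A (D.M p q U) + ((#U : A⟦X⟧) + 2 + (p : A⟦X⟧) + (q : A⟦X⟧)) * D.M p q U =
        PowerSeries.C 2 * theta A (D.M p q U) +
          PowerSeries.C ((#U : A) + 2 + (p : A) + (q : A)) * D.M p q U := by
      simp only [map_add, map_natCast, map_intCast, map_ofNat]
    rw [e', map_add, PowerSeries.coeff_C_mul, PowerSeries.coeff_C_mul, coeff_theta]
    push_cast
    ring
  rw [e]
  congr 1
  simp only [M, map_sum, mul_sum, ← sum_add_distrib]
  refine sum_congr rfl fun I hI => ?_
  have hc : (#U : A⟦X⟧) = #I + #(U \ I) := by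
    rw [← Nat.cast_add, add_comm, card_sdiff_add_card_eq_card (mem_powerset.1 hI)]
  rw [theta_C_mul, vv, theta_mul, hc, map_one]
  ring

end Args

section Psi

variable {κ A : Type*} [DecidableEq κ] [CommRing A] [Algebra ℚ A]

lemma mem_of_natCast_mul_mem {P : Submodule ℚ A} {k : ℕ} (hk : k ≠ 0) {x : A}
    (h : (k : A) * x ∈ P) : x ∈ P := by
  have := P.smul_mem (1 / (k : ℚ)) h
  rwa [← nsmul_eq_mul, ← Nat.cast_smul_eq_nsmul ℚ, smul_smul, one_div,
    inv_mul_cancel₀ (by exact_mod_cast hk), one_smul] at this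

/-- An induction principle for the coefficients of the `n`-point functions. -/
lemma psi_induction (c : κ → A) (P : Finset κ → ℕ → Submodule ℚ A) (h1 : ∀ i, 1 ∈ P {i} 0)
    (h3 : ∀ I g x, I ≠ ∅ → x ∈ P I g → sm c I ^ 3 * x ∈ P I (g + 1))
    (h2 : ∀ I J h h' x y, J ⊆ I → J ≠ ∅ → I \ J ≠ ∅ → x ∈ P J h → y ∈ P (I \ J) h' →
      sm c I * (x * y) ∈ P I (h + h')) {I : Finset κ} (hI : I ≠ ∅) (g : ℕ) :
    PowerSeries.coeff g (psi c I) ∈ P I g := by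
  induction I using Finset.strongInduction generalizing g with
  | H I ih =>
    have hconv : ∀ g, sm c I *
        PowerSeries.coeff g (∑ J ∈ I.powerset, psi c J * psi c (I \ J)) ∈ P I g := by
      intro g
      rw [map_sum, mul_sum]
      refine Submodule.sum_mem _ fun J hJ => ?_
      have hJ := mem_powerset.1 hJ
      by_cases hJ0 : J = ∅
      · simp [hJ0]
      by_cases hJ1 : I \ J = ∅
      · simp [hJ1]
      rw [PowerSeries.coeff_mul, mul_sum]
      refine Submodule.sum_mem _ fun x hx => ?_
      rw [← mem_antidiagonal.1 hx]
      refine h2 I J _ _ _ _ hJ hJ0 hJ1 (ih J ?_ hJ0 _) (ih _ ?_ hJ1 _)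
      · rw [Finset.ssubset_iff_subset_ne]
        refine ⟨hJ, ?_⟩
        rintro rfl
        simp at hJ1
      · exact sdiff_ssubset hJ (nonempty_iff_ne_empty.2 hJ0)
    have hc : 1 ≤ #I := card_pos.2 (nonempty_iff_ne_empty.2 hI)
    have kdv := psi_kdv c I
    have hm : 24 * theta A (psi c I) + 12 * ((#I : A⟦X⟧) - 1) * psi c I =
        PowerSeries.C 24 * theta A (psi c I) + PowerSeries.C (12 * ((#I : A) - 1)) * psi c I := by
      simp only [map_mul, map_sub, map_natCast, map_one, map_ofNat]
    have hm' : PowerSeries.X * PowerSeries.C (sm c I ^ 3) * psi c I +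
        6 * PowerSeries.C (sm c I) * ∑ J ∈ I.powerset, psi c J * psi c (I \ J) =
        PowerSeries.X * (PowerSeries.C (sm c I ^ 3) * psi c I) +
        PowerSeries.C 6 * (PowerSeries.C (sm c I) *
          ∑ J ∈ I.powerset, psi c J * psi c (I \ J)) := by
      simp only [map_ofNat]; ring
    rw [hm, hm'] at kdv
    have h6 : ∀ x ∈ P I g, (6 : A) * x ∈ P I g := fun x hx => by
      have := (P I g).smul_mem (6 : ℚ) hx
      rwa [Algebra.smul_def, map_ofNat] at this
    induction g with
    | zero =>
      by_cases h : #I = 1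
      · obtain ⟨i, rfl⟩ := card_eq_one.1 h
        rw [psi_singleton_coeff]
        exact h1 i
      · have e := congrArg (PowerSeries.coeff 0) kdv
        simp only [map_add, PowerSeries.coeff_C_mul, coeff_theta,
          PowerSeries.coeff_zero_X_mul] at e
        refine mem_of_natCast_mul_mem (k := 12 * (#I - 1)) (by omega) ?_
        have : ((12 * (#I - 1) : ℕ) : A) * PowerSeries.coeff 0 (psi c I) =
            6 * (sm c I * PowerSeries.coeff 0 (∑ J ∈ I.powerset, psi c J * psi c (I \ J))) := by
          push_cast [Nat.cast_sub hc] at e ⊢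
          linear_combination e
        rw [this]
        exact h6 _ (hconv 0)
    | succ g ihg =>
      have e := congrArg (PowerSeries.coeff (g + 1)) kdv
      simp only [map_add, PowerSeries.coeff_C_mul, coeff_theta,
        PowerSeries.coeff_succ_X_mul] at e
      refine mem_of_natCast_mul_mem (k := 24 * (g + 1) + 12 * (#I - 1)) (by omega) ?_
      have : ((24 * (g + 1) + 12 * (#I - 1) : ℕ) : A) * PowerSeries.coeff (g + 1) (psi c I) =
          sm c I ^ 3 * PowerSeries.coeff g (psi c I) + 6 * (sm c I *
            PowerSeries.coeff (g + 1) (∑ J ∈ I.powerset, psi c J * psi c (I \ J))) := by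
        push_cast [Nat.cast_sub hc] at e ⊢
        linear_combination e
      rw [this]
      refine Submodule.add_mem _ (h3 _ _ _ hI (ihg fun x hx => ?_)) (h6 _ (hconv _))
      have := (P I g).smul_mem (6 : ℚ) hx
      rwa [Algebra.smul_def, map_ofNat] at this

/-- Homogeneity of the `n`-point functions. -/
lemma psi_smul (c : κ → A) (u : A) (I : Finset κ) (g : ℕ) :
    PowerSeries.coeff g (psi (fun i => u * c i) I) =
      u ^ (3 * g + (#I - 1)) * PowerSeries.coeff g (psi c I) := by
  have hs : ∀ I, sm (fun i => u * c i) I = u * sm c I := fun I => (mul_sum _ _ _).symm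
  have hθ : ∀ f : A⟦X⟧, theta A (PowerSeries.rescale (u ^ 3) f) =
      PowerSeries.rescale (u ^ 3) (theta A f) := by
    intro f
    ext k
    simp only [coeff_theta, PowerSeries.coeff_rescale]
    ring
  have hC : ∀ a : A, PowerSeries.rescale (u ^ 3) (PowerSeries.C a) = PowerSeries.C a := by
    intro a
    ext k
    rw [PowerSeries.coeff_rescale, PowerSeries.coeff_C]
    split_ifs with h <;> simp [h]
  rw [← eq_psi (w := fun I => PowerSeries.C (u ^ (#I - 1)) *
    PowerSeries.rescale (u ^ 3) (psi c I)) (by simp) (fun i => ?_) (fun I => ?_) I]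
  · rw [PowerSeries.coeff_C_mul, PowerSeries.coeff_rescale, pow_add, pow_mul]
    ring
  · rw [PowerSeries.coeff_C_mul, PowerSeries.coeff_rescale, psi_singleton_coeff]
    simp
  · have kdv := congrArg (PowerSeries.rescale (u ^ 3)) (psi_kdv c I)
    have h6 : PowerSeries.rescale (u ^ 3) 6 = 6 := map_ofNat _ 6
    have h12 : PowerSeries.rescale (u ^ 3) 12 = 12 := map_ofNat _ 12
    have h24 : PowerSeries.rescale (u ^ 3) 24 = 24 := map_ofNat _ 24
    have hX : PowerSeries.rescale (u ^ 3) (PowerSeries.X : A⟦X⟧) =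
        PowerSeries.C (u ^ 3) * PowerSeries.X := PowerSeries.rescale_X _
    simp only [map_add, map_mul, map_sub, map_natCast, map_one, hC, h6, h12, h24, hX, ← hθ,
      map_sum] at kdv
    have hconv : PowerSeries.C (u * sm c I) * ∑ J ∈ I.powerset,
        (PowerSeries.C (u ^ (#J - 1)) * PowerSeries.rescale (u ^ 3) (psi c J)) *
        (PowerSeries.C (u ^ (#(I \ J) - 1)) * PowerSeries.rescale (u ^ 3) (psi c (I \ J))) =
        PowerSeries.C (u ^ (#I - 1)) * (PowerSeries.C (sm c I) * ∑ J ∈ I.powerset,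
          PowerSeries.rescale (u ^ 3) (psi c J) * PowerSeries.rescale (u ^ 3) (psi c (I \ J))) := by
      rw [mul_sum, mul_sum, mul_sum]
      refine sum_congr rfl fun J hJ => ?_
      have hJ := mem_powerset.1 hJ
      by_cases hJ0 : J = ∅
      · simp [hJ0]
      by_cases hJ1 : I \ J = ∅
      · simp [hJ1]
      have a := card_pos.2 (nonempty_iff_ne_empty.2 hJ0)
      have b := card_pos.2 (nonempty_iff_ne_empty.2 hJ1)
      have hc := card_sdiff_add_card_eq_card hJ
      rw [show #I - 1 = 1 + (#J - 1) + (#(I \ J) - 1) by omega, pow_add, pow_add, pow_one]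
      simp only [map_mul]
      ring
    simp only [hs]
    rw [mul_assoc 6, hconv, theta_C_mul]
    simp only [map_mul, map_pow] at kdv ⊢
    linear_combination (PowerSeries.C u) ^ (#I - 1) * kdv

lemma psi_congr {c c' : κ → A} {I : Finset κ} (h : ∀ i ∈ I, c i = c' i) : psi c I = psi c' I := by
  have e : ∀ d : κ → A, psi d I =
      psi (fun i : {x // x ∈ I} => d i) I.attach := fun d => by
    have := psi_comp (Function.Embedding.subtype (· ∈ I)) d I.attach
    rw [attach_map_val] at this
    exact this.symm
  rw [e c, e c']
  congr 1
  funext i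
  exact h i i.2

lemma psiMark_congr {c c' : κ → A} (y : A) {I : Finset κ} (h : ∀ i ∈ I, c i = c' i) :
    psiMark c y I = psiMark c' y I := by
  refine psi_congr fun o ho => ?_
  cases o with
  | none => rfl
  | some i => exact h i (by simpa using ho)

end Psi

namespace Args

variable {ι A : Type*} [DecidableEq ι] [CommRing A] [Algebra ℚ A] (D : Args ι A)

lemma M_map_eq (φ : A →+* A) {U : Finset ι} (hc : ∀ i ∈ U, φ (D.c i) = D.c i)
    (hl : ∀ i, φ (D.l i) = D.l i) (hr : ∀ i, φ (D.r i) = D.r i) (p q : ℤ) :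
    PowerSeries.map φ (D.M p q U) = D.M p q U := by
  have hsm : ∀ I ⊆ U, φ (sm D.c I) = sm D.c I := by
    intro I hI
    rw [sm, map_sum]
    exact sum_congr rfl fun i hi => hc i (hI hi)
  have hψ : ∀ (y : A) I, φ y = y → I ⊆ U →
      PowerSeries.map φ (psiMark D.c y I) = psiMark D.c y I := by
    intro y I hy hI
    rw [← psiMark_map, hy]
    exact psiMark_congr y fun i hi => hc i (hI hi)
  have hα : ∀ I ⊆ U, φ ↑(D.α I ^ p) = ↑(D.α I ^ p) := by
    intro I hI
    have : Units.map φ.toMonoidHom (D.α I) = D.α I := by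
      ext
      simp [D.hα, hsm I hI]
    have h := congrArg (fun u => ((u ^ p : Aˣ) : A)) this
    simp only [← map_zpow] at h
    exact h
  have hβ : ∀ I ⊆ U, φ ↑(D.β I ^ q) = ↑(D.β I ^ q) := by
    intro I hI
    have : Units.map φ.toMonoidHom (D.β I) = D.β I := by
      ext
      simp [D.hβ, hsm I hI]
    have h := congrArg (fun u => ((u ^ q : Aˣ) : A)) this
    simp only [← map_zpow] at h
    exact h
  rw [M, map_sum]
  refine sum_congr rfl fun I hI => ?_
  have hI := mem_powerset.1 hI
  simp only [vv, map_mul, PowerSeries.map_C, hψ 1 I (map_one φ) hI,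
    hψ (-1) (U \ I) (by simp) sdiff_subset, hα I hI, hβ (U \ I) sdiff_subset, map_prod, hl, hr]

end Args

section Graded

variable (ι : Type*)

/-- Power series in a degree variable with polynomial coefficients. -/
abbrev T : Type _ := (MvPolynomial ι ℚ)⟦X⟧

variable {ι}

/-- The coefficient of the monomial with exponent `e`, in degree `|e|`. -/
def cf (e : ι →₀ ℕ) (f : T ι) : ℚ := MvPolynomial.coeff e (PowerSeries.coeff e.degree f)

@[simp] lemma cf_zero (e : ι →₀ ℕ) : cf e (0 : T ι) = 0 := by simp [cf]

lemma cf_add (e : ι →₀ ℕ) (f f' : T ι) : cf e (f + f') = cf e f + cf e f' := by simp [cf]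

lemma cf_sub (e : ι →₀ ℕ) (f f' : T ι) : cf e (f - f') = cf e f - cf e f' := by simp [cf]

lemma cf_sum {σ : Type*} (e : ι →₀ ℕ) (s : Finset σ) (f : σ → T ι) :
    cf e (∑ i ∈ s, f i) = ∑ i ∈ s, cf e (f i) := by
  simp [cf, map_sum, MvPolynomial.coeff_sum]

lemma cf_algebraMap_mul (e : ι →₀ ℕ) (a : ℚ) (f : T ι) :
    cf e (algebraMap ℚ (T ι) a * f) = a * cf e f := by
  rw [show algebraMap ℚ (T ι) a = PowerSeries.C (MvPolynomial.C a) from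
    PowerSeries.algebraMap_apply, cf,
    PowerSeries.coeff_C_mul, MvPolynomial.coeff_C_mul, cf]

lemma cf_natCast_mul (e : ι →₀ ℕ) (a : ℕ) (f : T ι) : cf e (a * f) = a * cf e f := by
  rw [← cf_algebraMap_mul, map_natCast]

lemma cf_intCast_mul (e : ι →₀ ℕ) (a : ℤ) (f : T ι) : cf e (a * f) = a * cf e f := by
  rw [← cf_algebraMap_mul, map_intCast]

/-- The variable `x_i`, placed in degree one. -/
def xx (i : ι) : T ι := PowerSeries.X * PowerSeries.C (X i)

variable [DecidableEq ι]

lemma cf_xx_mul (e : ι →₀ ℕ) (i : ι) (f : T ι) :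
    cf e (xx i * f) = if e i = 0 then 0 else cf (e - Finsupp.single i 1) f := by
  have hd : e i ≠ 0 → e.degree = (e - Finsupp.single i 1).degree + 1 := by
    intro h
    conv_lhs => rw [← tsub_add_cancel_of_le (a := Finsupp.single i 1) (b := e)
      (by rwa [Finsupp.single_le_iff, Nat.one_le_iff_ne_zero])]
    rw [map_add, Finsupp.degree_single]
  rw [cf, xx, mul_assoc]
  split_ifs with h
  · cases hn : e.degree with
    | zero => simp
    | succ n =>
      rw [PowerSeries.coeff_succ_X_mul, PowerSeries.coeff_C_mul, MvPolynomial.coeff_X_mul',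
        if_neg (by simpa using h)]
  · rw [hd h, PowerSeries.coeff_succ_X_mul, PowerSeries.coeff_C_mul, MvPolynomial.coeff_X_mul',
      if_pos (by simpa using h), cf]

lemma cf_eq_zero_of_xx_dvd {e : ι →₀ ℕ} {i : ι} (he : e i = 0) {f : T ι} (h : xx i ∣ f) :
    cf e f = 0 := by
  obtain ⟨f, rfl⟩ := h
  rw [cf_xx_mul, if_pos he]

lemma cf_eq_zero_of_xx_sq_dvd {e : ι →₀ ℕ} {i : ι} (he : e i ≤ 1) {f : T ι}
    (h : xx i ^ 2 ∣ f) : cf e f = 0 := by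
  obtain ⟨f, rfl⟩ := h
  rw [pow_two, mul_assoc, cf_xx_mul]
  split_ifs with h
  · rfl
  · rw [cf_xx_mul, if_pos (by simp; omega)]

omit [DecidableEq ι] in
lemma cf_eq_zero_of_X_pow_dvd {e : ι →₀ ℕ} {N : ℕ} (he : e.degree < N) {f : T ι}
    (h : PowerSeries.X ^ N ∣ f) : cf e f = 0 := by
  rw [cf, PowerSeries.X_pow_dvd_iff.1 h _ he, MvPolynomial.coeff_zero]

/-- Only the variables of `U` occur. -/
def IsSupp (U : Finset ι) (f : T ι) : Prop :=
  ∀ m e, MvPolynomial.coeff e (PowerSeries.coeff m f) ≠ 0 → e.support ⊆ U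

omit [DecidableEq ι] in
lemma IsSupp.cf_eq_zero {U : Finset ι} {f : T ι} (h : IsSupp U f) {e : ι →₀ ℕ} {i : ι}
    (hi : i ∉ U) (he : e i ≠ 0) : cf e f = 0 := by
  by_contra hne
  exact hi (h _ _ hne (Finsupp.mem_support_iff.2 he))

/-- The substitution of zero for the variables outside of `U`. -/
def kill (U : Finset ι) : MvPolynomial ι ℚ →ₐ[ℚ] MvPolynomial ι ℚ :=
  aeval fun i => if i ∈ U then X i else 0

lemma kill_mem_supported (U : Finset ι) (f : MvPolynomial ι ℚ) :
    kill U f ∈ supported ℚ (U : Set ι) := by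
  induction f using MvPolynomial.induction_on with
  | C a => simpa [kill] using (supported ℚ (U : Set ι)).algebraMap_mem a
  | add f f' h h' => rw [map_add]; exact add_mem h h'
  | mul_X f i h =>
    rw [map_mul]
    refine mul_mem h ?_
    rw [kill, aeval_X]
    split_ifs with hi
    · exact X_mem_supported.2 hi
    · exact zero_mem _

omit [DecidableEq ι] in
lemma support_subset_of_mem_supported {U : Finset ι} {f : MvPolynomial ι ℚ}
    (hf : f ∈ supported ℚ (U : Set ι)) {e : ι →₀ ℕ} (he : MvPolynomial.coeff e f ≠ 0) :
    e.support ⊆ U := by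
  intro i hi
  have := mem_supported.1 hf
  exact this (mem_vars_iff_mem_support i |>.2 ⟨e, MvPolynomial.mem_support_iff.2 he, hi⟩)

lemma isSupp_of_map_kill {U : Finset ι} {f : T ι}
    (h : PowerSeries.map (kill U : MvPolynomial ι ℚ →+* MvPolynomial ι ℚ) f = f) :
    IsSupp U f := by
  intro m e he
  rw [← h, PowerSeries.coeff_map] at he
  exact support_subset_of_mem_supported (kill_mem_supported U _) he

lemma coeff_psi_X_mem {C : Finset ι} (hC : C ≠ ∅) (h : ℕ) :
    PowerSeries.coeff h (psi (X : ι → MvPolynomial ι ℚ) C) ∈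
      homogeneousSubmodule ι ℚ (3 * h + (#C - 1)) ⊓
        Subalgebra.toSubmodule (supported ℚ (C : Set ι)) := by
  have hs : ∀ I : Finset ι, sm (X : ι → MvPolynomial ι ℚ) I ∈ homogeneousSubmodule ι ℚ 1 :=
    fun I => Submodule.sum_mem _ fun i _ => isHomogeneous_X ℚ i
  have hs' : ∀ I : Finset ι, sm (X : ι → MvPolynomial ι ℚ) I ∈ supported ℚ (I : Set ι) :=
    fun I => sum_mem fun i hi => X_mem_supported.2 hi
  refine psi_induction X (fun I g => homogeneousSubmodule ι ℚ (3 * g + (#I - 1)) ⊓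
    Subalgebra.toSubmodule (supported ℚ (I : Set ι))) ?_ ?_ ?_ hC h
  · intro i
    exact ⟨isHomogeneous_one ι ℚ, (supported ℚ _).one_mem⟩
  · intro I g x _ hx
    refine ⟨?_, (supported ℚ _).mul_mem (pow_mem (hs' I) 3) hx.2⟩
    have := ((hs I : IsHomogeneous _ 1).pow 3).mul (hx.1 : IsHomogeneous _ _)
    rw [show 1 * 3 + (3 * g + (#I - 1)) = 3 * (g + 1) + (#I - 1) by ring] at this
    exact this
  · intro I J h h' x y hJ hJ0 hJ1 hx hy
    have a := card_pos.2 (nonempty_iff_ne_empty.2 hJ0)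
    have b := card_pos.2 (nonempty_iff_ne_empty.2 hJ1)
    have hc := card_sdiff_add_card_eq_card hJ
    refine ⟨?_, (supported ℚ _).mul_mem (hs' I) ((supported ℚ _).mul_mem ?_ ?_)⟩
    · have := (hs I : IsHomogeneous _ 1).mul
        ((hx.1 : IsHomogeneous _ _).mul (hy.1 : IsHomogeneous _ _))
      rw [show 1 + (3 * h + (#J - 1) + (3 * h' + (#(I \ J) - 1))) = 3 * (h + h') + (#I - 1) by
        omega] at this
      exact this
    · exact supported_mono (by exact_mod_cast hJ) hx.2
    · exact supported_mono (by exact_mod_cast sdiff_subset) hy.2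

lemma coeff_psi_xx (C : Finset ι) (h : ℕ) : PowerSeries.coeff h (psi (xx : ι → T ι) C) =
    PowerSeries.X ^ (3 * h + (#C - 1)) *
      PowerSeries.C (PowerSeries.coeff h (psi (X : ι → MvPolynomial ι ℚ) C)) := by
  have h1 := psi_smul (fun i => (PowerSeries.C (X i : MvPolynomial ι ℚ))) PowerSeries.X C h
  have h2 := psi_map (PowerSeries.C (R := MvPolynomial ι ℚ)) X C
  rw [h2, PowerSeries.coeff_map] at h1
  exact h1

lemma cf_mul_ne_zero {C K : Finset ι} (hCK : Disjoint C K) {d N : ℕ} {y : MvPolynomial ι ℚ}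
    (hy : y.IsHomogeneous d) (hy' : y ∈ supported ℚ (C : Set ι)) {f : T ι} (hf : IsSupp K f)
    (hN : PowerSeries.X ^ N ∣ f) {e : ι →₀ ℕ}
    (h : cf e (PowerSeries.X ^ d * PowerSeries.C y * f) ≠ 0) :
    ∑ i ∈ C, e i = d ∧ d + N ≤ e.degree := by
  rw [cf, mul_assoc] at h
  have hd : d ≤ e.degree := by
    by_contra hlt
    rw [PowerSeries.coeff_X_pow_mul', if_neg hlt] at h
    simp at h
  rw [PowerSeries.coeff_X_pow_mul', if_pos hd, PowerSeries.coeff_C_mul,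
    MvPolynomial.coeff_mul] at h
  obtain ⟨⟨e₁, e₂⟩, he, hne⟩ := exists_ne_zero_of_sum_ne_zero h
  have he := mem_antidiagonal.1 he
  have h1 := left_ne_zero_of_mul hne
  have h2 := right_ne_zero_of_mul hne
  constructor
  · have s1 := support_subset_of_mem_supported hy' h1
    have s2 := hf _ _ h2
    have hd1 : e₁.degree = d := by
      by_contra hne
      exact h1 (hy.coeff_eq_zero hne)
    have z : ∑ i ∈ C, e₂ i = 0 := sum_eq_zero fun i hi => by
      by_contra h0
      exact disjoint_left.1 hCK hi (s2 (Finsupp.mem_support_iff.2 h0))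
    rw [← hd1, ← he, Finsupp.degree_apply, sum_subset s1 fun i _ hi => by simpa using hi]
    simp [sum_add_distrib, z]
  · by_contra hlt
    refine h2 ?_
    rw [PowerSeries.X_pow_dvd_iff.1 hN _ (by omega), MvPolynomial.coeff_zero]

end Graded

/-- The arguments `x_i`; those of kind `some true` are only allowed in the first factor, those of
kind `some false` only in the second one. -/
def args {ι : Type*} (kd : ι → Option Bool) : Args ι (T ι) where
  c := xx
  l i := if kd i = some false then 0 else 1
  r i := if kd i = some true then 0 else 1
  α I := (PowerSeries.isUnit_iff_constantCoeff.2 (by simp [sm, xx]) :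
    IsUnit (1 + sm xx I : T ι)).unit
  β I := (PowerSeries.isUnit_iff_constantCoeff.2 (by simp [sm, xx]) :
    IsUnit (-1 + sm xx I : T ι)).unit
  hα I := IsUnit.unit_spec _
  hβ I := IsUnit.unit_spec _

variable {ι : Type*} [DecidableEq ι] (kd : ι → Option Bool)

lemma isSupp_coeff_M (p q : ℤ) (U : Finset ι) (g : ℕ) :
    IsSupp U (PowerSeries.coeff g ((args kd).M p q U)) := by
  refine isSupp_of_map_kill ?_
  rw [← PowerSeries.coeff_map, Args.M_map_eq]
  · intro i hi
    simp [args, xx, kill, hi]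
  · intro i
    simp only [args]; split_ifs <;> simp
  · intro i
    simp only [args]; split_ifs <;> simp

section Order

variable {ι : Type*} [DecidableEq ι] (kd : ι → Option Bool)

/-- The coefficient of `M` in genus `g`. -/
def Mg (g : ℕ) (p q : ℤ) (U : Finset ι) : T ι := PowerSeries.coeff g ((args kd).M p q U)

/-- The indicator of the arguments allowed in both factors. -/
def eta (i : ι) : ℕ := if kd i = none then 1 else 0

/-- The weight of an argument in the first factor. -/
def lwt (i : ι) : ℚ := if kd i = some false then 0 else 1

/-- The weight of an argument in the second factor. -/
def rwt (i : ι) : ℚ := if kd i = some true then 0 else 1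

omit [DecidableEq ι] in
lemma args_l (i : ι) : (args kd).l i = algebraMap ℚ (T ι) (lwt kd i) := by
  simp only [args, lwt]; split_ifs <;> simp

omit [DecidableEq ι] in
lemma args_r (i : ι) : (args kd).r i = algebraMap ℚ (T ι) (rwt kd i) := by
  simp only [args, rwt]; split_ifs <;> simp

/-- The `k`-th term of the expansion in `Σ_E x` in the recursion for `Mg`. -/
def kern (E : Finset ι) (k g : ℕ) (p q : ℤ) (U : Finset ι) : T ι :=
  algebraMap ℚ (T ι) ((∏ i ∈ E, lwt kd i) * binomZ (p + 1) k) * Mg kd g (p + 1 - k) q U +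
    algebraMap ℚ (T ι) ((∏ i ∈ E, rwt kd i) * binomZ (q + 1) k) * Mg kd g p (q + 1 - k) U

lemma Mg_rec (N g : ℕ) (p q : ℤ) (U : Finset ι) :
    (PowerSeries.X : T ι) ^ N ∣ ((24 * g + 12 * #U : ℕ) : T ι) * Mg kd g p q U -
      ((if g = 0 then 0 else sm xx U ^ 3 * Mg kd (g - 1) p q U -
          3 * (sm xx U * Mg kd (g - 1) (p + 1) (q + 1) U)) +
        12 * ∑ E ∈ U.powerset, ∑ h ∈ antidiagonal g, ∑ k ∈ range N,
          PowerSeries.coeff h.1 (psi xx E) * sm xx E ^ k * kern kd E k h.2 p q (U \ E)) := by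
  have hrec := congrArg (PowerSeries.coeff g) ((args kd).M_rec p q U)
  have hX : ∀ E : Finset ι, (PowerSeries.X : T ι) ^ N ∣ sm xx E ^ N := fun E =>
    pow_dvd_pow_of_dvd (dvd_sum fun i _ => dvd_mul_right _ _) N
  have h1 : PowerSeries.coeff g (24 * theta (T ι) ((args kd).M p q U) +
      12 * (#U : (T ι)⟦X⟧) * (args kd).M p q U) =
      ((24 * g + 12 * #U : ℕ) : T ι) * Mg kd g p q U := by
    rw [show (24 : (T ι)⟦X⟧) = PowerSeries.C 24 from (map_ofNat PowerSeries.C 24).symm,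
      show (12 : (T ι)⟦X⟧) * (#U : (T ι)⟦X⟧) = PowerSeries.C (12 * (#U : T ι)) by
      rw [map_mul, map_ofNat, map_natCast],
      map_add, PowerSeries.coeff_C_mul, PowerSeries.coeff_C_mul, coeff_theta, Mg]
    push_cast
    ring
  have h2 : PowerSeries.coeff g (PowerSeries.X * (PowerSeries.C (sm xx U ^ 3) *
      (args kd).M p q U - 3 * PowerSeries.C (sm xx U) * (args kd).M (p + 1) (q + 1) U)) =
      if g = 0 then 0 else sm xx U ^ 3 * Mg kd (g - 1) p q U -
          3 * (sm xx U * Mg kd (g - 1) (p + 1) (q + 1) U) := by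
    cases g with
    | zero => simp
    | succ g =>
      rw [PowerSeries.coeff_succ_X_mul, map_sub,
        show (3 : (T ι)⟦X⟧) = PowerSeries.C 3 from (map_ofNat PowerSeries.C 3).symm, mul_assoc,
        PowerSeries.coeff_C_mul, PowerSeries.coeff_C_mul, PowerSeries.coeff_C_mul]
      simp [Mg]
  rw [h1, map_add] at hrec
  replace hrec := hrec.trans (congrArg₂ _ h2 rfl)
  rw [hrec, add_sub_add_left_eq_sub,
    show (12 : (T ι)⟦X⟧) = PowerSeries.C 12 from (map_ofNat PowerSeries.C 12).symm,
    PowerSeries.coeff_C_mul, ← mul_sub, map_sum, ← sum_sub_distrib]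
  refine dvd_mul_of_dvd_right (dvd_sum fun E hE => ?_) _
  rw [PowerSeries.coeff_mul, ← sum_sub_distrib]
  refine dvd_sum fun h _ => ?_
  have hE' : Disjoint E (U \ E) := disjoint_sdiff
  have a := (hX E).trans ((args kd).NL_dvd hE' (p + 1) q N h.2)
  have b := (hX E).trans ((args kd).NR_dvd hE' p (q + 1) N h.2)
  rw [map_add, PowerSeries.coeff_C_mul, PowerSeries.coeff_C_mul]
  obtain ⟨a', ha⟩ := a
  obtain ⟨b', hb⟩ := b
  rw [sub_eq_iff_eq_add] at ha hb
  refine ⟨PowerSeries.coeff h.1 (psi xx E) * ((∏ i ∈ E, (args kd).l i) * a' +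
    (∏ i ∈ E, (args kd).r i) * b'), ?_⟩
  rw [show (args kd).c = xx from rfl] at *
  rw [ha, hb]
  simp only [kern, Mg, args_l, args_r, map_mul, map_prod, mul_add, sum_add_distrib, mul_sum]
  have e1 : ∀ x y z w u : T ι, x * y * (z * w * u) = x * (z * (w * y * u)) := by intros; ring
  simp only [e1]
  ring

/-- The number of arguments in `U` allowed in both factors. -/
def nn (U : Finset ι) : ℕ := ∑ i ∈ U, eta kd i

omit [DecidableEq ι] in
lemma eta_le_one (i : ι) : eta kd i ≤ 1 := by
  rw [eta]; split_ifs <;> simp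

omit [DecidableEq ι] in
lemma nn_le_card (U : Finset ι) : nn kd U ≤ #U := by
  rw [nn, card_eq_sum_ones]
  exact sum_le_sum fun i _ => eta_le_one kd i

omit [DecidableEq ι] in
lemma nn_eq_card_iff (U : Finset ι) : nn kd U = #U ↔ ∀ i ∈ U, kd i = none := by
  rw [nn, card_eq_sum_ones, sum_eq_sum_iff_of_le fun i _ => eta_le_one kd i]
  simp [eta]

lemma nn_add_nn_sdiff {E U : Finset ι} (h : E ⊆ U) : nn kd U = nn kd E + nn kd (U \ E) := by
  rw [nn, nn, nn, add_comm, sum_sdiff h]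

omit [DecidableEq ι] in
lemma X_dvd_sm_xx (U : Finset ι) : (PowerSeries.X : T ι) ∣ sm xx U :=
  dvd_sum fun _ _ => dvd_mul_right _ _

/-- The additional order of vanishing of `kern`. -/
def gain (E : Finset ι) (k : ℕ) : ℕ := if k = 0 ∧ nn kd E = #E then 1 else 0

lemma X_pow_dvd_kern {E U : Finset ι} {k g N : ℕ} {p q : ℤ}
    (h : ∀ p q, (PowerSeries.X : T ι) ^ N ∣ Mg kd g p q U) :
    (PowerSeries.X : T ι) ^ (N + gain kd E k) ∣ kern kd E k g p q U := by
  rw [gain]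
  split_ifs with hk
  · obtain ⟨rfl, hE⟩ := hk
    rw [nn_eq_card_iff] at hE
    have hl : ∏ i ∈ E, lwt kd i = 1 := prod_eq_one fun i hi => by simp [lwt, hE i hi]
    have hr : ∏ i ∈ E, rwt kd i = 1 := prod_eq_one fun i hi => by simp [rwt, hE i hi]
    have := congrArg (PowerSeries.coeff g) ((args kd).M_add_M p q U)
    rw [map_add, PowerSeries.coeff_C_mul] at this
    simp only [kern, hl, hr, binomZ_zero, mul_one, map_one, one_mul, Nat.cast_zero, sub_zero, Mg]
    rw [this, pow_succ']
    exact mul_dvd_mul (X_dvd_sm_xx U) (h p q)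
  · exact dvd_add (dvd_mul_of_dvd_right (h _ _) _) (dvd_mul_of_dvd_right (h _ _) _)

omit [DecidableEq ι] in
lemma isHomogeneous_sm_X_pow (E : Finset ι) (k : ℕ) :
    ((sm X E : MvPolynomial ι ℚ) ^ k).IsHomogeneous k := by
  have h : IsHomogeneous (sm X E : MvPolynomial ι ℚ) 1 :=
    Submodule.sum_mem (homogeneousSubmodule ι ℚ 1) fun i _ => isHomogeneous_X ℚ i
  simpa only [one_mul] using h.pow k

omit [DecidableEq ι] in
lemma sm_xx (E : Finset ι) : sm (xx : ι → T ι) E = PowerSeries.X * PowerSeries.C (sm X E) := by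
  simp only [sm, xx, map_sum, mul_sum]

/-- The polynomial prefactors in the recursion for `Mg`. -/
lemma coeff_psi_xx_mul_pow {E : Finset ι} (hE : E ≠ ∅) (h k : ℕ) :
    ∃ y : MvPolynomial ι ℚ, y.IsHomogeneous (3 * h + (#E - 1) + k) ∧
      y ∈ supported ℚ (E : Set ι) ∧ PowerSeries.coeff h (psi xx E) * sm xx E ^ k =
        (PowerSeries.X : T ι) ^ (3 * h + (#E - 1) + k) * PowerSeries.C y := by
  have hm := coeff_psi_X_mem hE h
  refine ⟨_, IsHomogeneous.mul hm.1 (isHomogeneous_sm_X_pow E k), mul_mem hm.2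
    (pow_mem (sum_mem fun i hi => X_mem_supported.2 hi) k), ?_⟩
  rw [coeff_psi_xx, sm_xx, mul_pow, map_mul, map_pow, pow_add]
  ring

omit [DecidableEq ι] in
lemma dvd_of_natCast_mul_dvd {k : ℕ} (hk : k ≠ 0) {x y : T ι} (h : x ∣ (k : T ι) * y) :
    x ∣ y := by
  have : y = algebraMap ℚ (T ι) ((k : ℚ)⁻¹) * (k * y) := by
    rw [← map_natCast (algebraMap ℚ (T ι)), ← mul_assoc, ← map_mul,
      inv_mul_cancel₀ (by exact_mod_cast hk), map_one, one_mul]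
  rw [this]
  exact dvd_mul_of_dvd_right h _

omit [DecidableEq ι] in
lemma gain_add (E : Finset ι) (k : ℕ) :
    nn kd E + 1 ≤ #E + k + gain kd E k := by
  have := nn_le_card kd E
  rw [gain]
  split_ifs with h <;> omega

/-- Vanishing below the leading order. -/
theorem X_pow_dvd_Mg (g : ℕ) (p q : ℤ) (U : Finset ι) :
    (PowerSeries.X : T ι) ^ (g + nn kd U) ∣ Mg kd g p q U := by
  induction hn : g + #U using Nat.strong_induction_on generalizing g p q U with
  | _ n ih =>
  subst hn
  rcases Nat.eq_zero_or_pos (g + #U) with h0 | h0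
  · obtain ⟨rfl, hU⟩ : g = 0 ∧ #U = 0 := by omega
    simp [card_eq_zero.1 hU, nn]
  refine dvd_of_natCast_mul_dvd (k := 24 * g + 12 * #U) (by omega) ?_
  refine (dvd_iff_dvd_of_dvd_sub (Mg_rec kd (g + nn kd U) g p q U)).2 (dvd_add ?_ ?_)
  · split_ifs with hg
    · exact dvd_zero _
    · obtain ⟨g, rfl⟩ := Nat.exists_eq_succ_of_ne_zero hg
      have key : ∀ p q (m : ℕ), m ≠ 0 → (PowerSeries.X : T ι) ^ (g + 1 + nn kd U) ∣
          sm xx U ^ m * Mg kd g p q U := by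
        intro p q m hm
        rw [show g + 1 + nn kd U = 1 + (g + nn kd U) by ring, pow_add, pow_one]
        exact mul_dvd_mul ((X_dvd_sm_xx U).trans (dvd_pow_self _ hm)) (ih _ (by omega) g p q U rfl)
      refine dvd_sub (key p q 3 (by simp)) (dvd_mul_of_dvd_right ?_ _)
      simpa using key (p + 1) (q + 1) 1 (by simp)
  · refine dvd_mul_of_dvd_right (dvd_sum fun E hE => dvd_sum fun h hh => dvd_sum fun k _ => ?_) _
    rcases eq_or_ne E ∅ with rfl | hE0
    · simp [psi_empty]
    obtain ⟨y, -, -, hy⟩ := coeff_psi_xx_mul_pow hE0 h.1 k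
    have hE := mem_powerset.1 hE
    have hh := mem_antidiagonal.1 hh
    have hc := card_pos.2 (nonempty_iff_ne_empty.2 hE0)
    have hk := X_pow_dvd_kern kd (E := E) (k := k) (p := p) (q := q) fun p q =>
      ih (h.2 + #(U \ E)) (by have := card_sdiff_add_card_eq_card hE; omega) h.2 p q (U \ E) rfl
    rw [hy, mul_assoc]
    refine (pow_dvd_pow _ ?_).trans ((pow_add _ _ _).dvd.trans
      (mul_dvd_mul_left _ (dvd_mul_of_dvd_right hk _)))
    have := nn_add_nn_sdiff kd hE
    have := gain_add kd E k
    omega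

end Order

section Coefficients

variable {ι : Type*} [DecidableEq ι] (kd : ι → Option Bool)

lemma isSupp_Mg (g : ℕ) (p q : ℤ) (U : Finset ι) : IsSupp U (Mg kd g p q U) :=
  isSupp_coeff_M kd p q U g

lemma isSupp_kern (E : Finset ι) (k g : ℕ) (p q : ℤ) (U : Finset ι) :
    IsSupp U (kern kd E k g p q U) := by
  intro m e he
  have hc : ∀ (a : ℚ) (f : T ι), MvPolynomial.coeff e (PowerSeries.coeff m
      (algebraMap ℚ (T ι) a * f)) = a * MvPolynomial.coeff e (PowerSeries.coeff m f) := by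
    intro a f
    rw [show algebraMap ℚ (T ι) a = PowerSeries.C (MvPolynomial.C a) from
      PowerSeries.algebraMap_apply, PowerSeries.coeff_C_mul, MvPolynomial.coeff_C_mul]
  rw [kern, map_add, MvPolynomial.coeff_add, hc, hc] at he
  by_cases h : MvPolynomial.coeff e (PowerSeries.coeff m (Mg kd g (p + 1 - k) q U)) = 0
  · rw [h, mul_zero, zero_add] at he
    exact isSupp_Mg kd _ _ _ _ _ _ (right_ne_zero_of_mul he)
  · exact isSupp_Mg kd _ _ _ _ _ _ h

lemma cf_sm_xx_mul {e : ι →₀ ℕ} {U : Finset ι} (he : ∀ i ∈ U, e i ≠ 0) (f : T ι) :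
    cf e (sm xx U * f) = ∑ i ∈ U, cf (e - Finsupp.single i 1) f := by
  rw [sm, sum_mul, cf_sum]
  exact sum_congr rfl fun i hi => by rw [cf_xx_mul, if_neg (he i hi)]

lemma cf_xx_pow_mul {e : ι →₀ ℕ} {i : ι} {k : ℕ} (he : k ≤ e i) (f : T ι) :
    cf e (xx i ^ k * f) = cf (e - Finsupp.single i k) f := by
  induction k generalizing e with
  | zero => simp
  | succ k ih =>
    rw [pow_succ', mul_assoc, cf_xx_mul, if_neg (by omega), ih (by simp; omega), tsub_tsub,
      ← Finsupp.single_add, add_comm 1 k]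

lemma psi_singleton_zero (c : ι → T ι) (i : ι) : PowerSeries.coeff 0 (psi c {i}) = 1 := by
  simpa using psi_singleton_coeff c i

/-- Only two-valued splittings contribute at the two leading orders. -/
lemma cf_term_eq_zero {e : ι →₀ ℕ} {g k : ℕ} {p q : ℤ} {U E : Finset ι} {h : ℕ × ℕ}
    (he : ∀ i ∈ U, eta kd i + 1 ≤ e i) (hd : e.degree ≤ g + nn kd U + 1)
    (hE : E ⊆ U) (hh : h.1 + h.2 = g)
    (hne : cf e (PowerSeries.coeff h.1 (psi xx E) * sm xx E ^ k * kern kd E k h.2 p q (U \ E)) ≠ 0) :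
    h.1 = 0 ∧ #E = 1 ∧ k = nn kd E + 1 := by
  rcases eq_or_ne E ∅ with rfl | hE0
  · simp [psi_empty] at hne
  obtain ⟨y, hy1, hy2, hy⟩ := coeff_psi_xx_mul_pow hE0 h.1 k
  rw [hy] at hne
  have := cf_mul_ne_zero disjoint_sdiff hy1 hy2 (isSupp_kern kd _ _ _ _ _ _)
    (X_pow_dvd_kern kd fun p q => X_pow_dvd_Mg kd h.2 p q (U \ E)) hne
  have hs := sum_le_sum fun i hi => he i (hE hi)
  rw [sum_add_distrib, ← card_eq_sum_ones] at hs
  change nn kd E + _ ≤ _ at hs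
  have := nn_add_nn_sdiff kd hE
  have := gain_add kd E k
  have hc := card_pos.2 (nonempty_iff_ne_empty.2 hE0)
  have := nn_le_card kd E
  simp only [gain] at *
  split_ifs at * <;> omega

/-- The recursion for the coefficients of the two leading orders. -/
theorem cf_rec {e : ι →₀ ℕ} (g : ℕ) (p q : ℤ) (U : Finset ι)
    (he : ∀ i ∈ U, eta kd i + 1 ≤ e i) (hd : e.degree ≤ g + nn kd U + 1) :
    (2 * g + #U : ℚ) * cf e (Mg kd g p q U) =
      (if g = 0 then 0 else
        -(1 / 4) * ∑ i ∈ U, cf (e - Finsupp.single i 1) (Mg kd (g - 1) (p + 1) (q + 1) U)) +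
      ∑ i ∈ U, cf (e - Finsupp.single i (eta kd i + 1))
        (kern kd {i} (eta kd i + 1) g p q (U \ {i})) := by
  have hrec := cf_eq_zero_of_X_pow_dvd (show e.degree < e.degree + 3 by omega)
    (Mg_rec kd (e.degree + 3) g p q U)
  rw [cf_sub, sub_eq_zero, cf_natCast_mul, cf_add] at hrec
  have h1 : cf e (if g = 0 then 0 else sm xx U ^ 3 * Mg kd (g - 1) p q U -
      3 * (sm xx U * Mg kd (g - 1) (p + 1) (q + 1) U)) = if g = 0 then 0 else
        -3 * ∑ i ∈ U, cf (e - Finsupp.single i 1) (Mg kd (g - 1) (p + 1) (q + 1) U) := by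
    split_ifs with hg
    · exact cf_zero e
    · have h3 := cf_natCast_mul e 3 (sm xx U * Mg kd (g - 1) (p + 1) (q + 1) U)
      push_cast at h3
      rw [cf_sub, h3, cf_sm_xx_mul fun i hi => by have := he i hi; omega,
        cf_eq_zero_of_X_pow_dvd (N := 3 + (g - 1 + nn kd U)) (by omega)]
      · ring
      · rw [pow_add]
        exact mul_dvd_mul (pow_dvd_pow_of_dvd (X_dvd_sm_xx U) 3) (X_pow_dvd_Mg kd _ _ _ _)
  have h2 : cf e (∑ E ∈ U.powerset, ∑ h ∈ antidiagonal g, ∑ k ∈ range (e.degree + 3),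
      PowerSeries.coeff h.1 (psi xx E) * sm xx E ^ k * kern kd E k h.2 p q (U \ E)) =
      ∑ i ∈ U, cf (e - Finsupp.single i (eta kd i + 1))
        (kern kd {i} (eta kd i + 1) g p q (U \ {i})) := by
    rw [cf_sum]
    have hsub : U.map ⟨singleton, singleton_injective⟩ ⊆ U.powerset := by
      intro E hE
      obtain ⟨i, hi, rfl⟩ := mem_map.1 hE
      simpa using hi
    rw [← sum_subset hsub, sum_map]
    · refine sum_congr rfl fun i hi => ?_
      simp only [Function.Embedding.coeFn_mk, cf_sum]
      have hi' : {i} ⊆ U := by simpa using hi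
      have hn : nn kd {i} = eta kd i := by simp [nn]
      rw [sum_eq_single_of_mem (0, g) (by simp), sum_eq_single_of_mem (eta kd i + 1)]
      · rw [psi_singleton_zero, one_mul, show sm xx {i} = xx i by simp [sm],
          cf_xx_pow_mul (he i hi)]
      · have := eta_le_one kd i
        rw [mem_range]; omega
      · intro k _ hk
        by_contra hne
        exact hk (by rw [(cf_term_eq_zero kd he hd hi' (by simp) hne).2.2, hn])
      · intro h hh hne
        refine sum_eq_zero fun k _ => ?_
        by_contra hne'
        have := (cf_term_eq_zero kd he hd hi' (mem_antidiagonal.1 hh) hne').1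
        refine hne (Prod.ext this ?_)
        have := mem_antidiagonal.1 hh
        simp only; omega
    · intro E hE hE'
      rw [cf_sum]
      refine sum_eq_zero fun h hh => ?_
      rw [cf_sum]
      refine sum_eq_zero fun k _ => ?_
      by_contra hne
      obtain ⟨i, rfl⟩ := card_eq_one.1
        (cf_term_eq_zero kd he hd (mem_powerset.1 hE) (mem_antidiagonal.1 hh) hne).2.1
      exact hE' (mem_map.2 ⟨i, by simpa using hE, rfl⟩)
  have h12 := cf_natCast_mul e 12 (∑ E ∈ U.powerset, ∑ h ∈ antidiagonal g,
    ∑ k ∈ range (e.degree + 3),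
      PowerSeries.coeff h.1 (psi xx E) * sm xx E ^ k * kern kd E k h.2 p q (U \ E))
  push_cast at h12 hrec
  rw [h1, h12, h2] at hrec
  split_ifs at hrec ⊢ <;> linear_combination hrec / 12

section Insert

variable {kd} {e : ι →₀ ℕ} {U : Finset ι} {i : ι}

/-- The string equation. -/
lemma cf_string_left (hi : i ∉ U) (hk : kd i = some true) (he : e i = 0) (g : ℕ) (p q : ℤ) :
    cf e (Mg kd g p q (insert i U)) = cf e (Mg kd g (p + 1) q U) := by
  have := cf_eq_zero_of_xx_dvd he ((args kd).M_insert_dvd_left hi (by simp [args, hk])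
    (by simp [args, hk]) p q g)
  rwa [cf_sub, sub_eq_zero] at this

lemma cf_string_right (hi : i ∉ U) (hk : kd i = some false) (he : e i = 0) (g : ℕ) (p q : ℤ) :
    cf e (Mg kd g p q (insert i U)) = cf e (Mg kd g p (q + 1) U) := by
  have := cf_eq_zero_of_xx_dvd he ((args kd).M_insert_dvd_right hi (by simp [args, hk])
    (by simp [args, hk]) p q g)
  rwa [cf_sub, sub_eq_zero] at this

/-- The dilaton equation. -/
lemma cf_dilaton (hi : i ∉ U) (hk : kd i = none) (he : e i = 1) (g : ℕ) (p q : ℤ) :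
    cf e (Mg kd g p q (insert i U)) =
      (2 * g + #U + 2 + p + q) * cf (e - Finsupp.single i 1) (Mg kd g p q U) := by
  have := cf_eq_zero_of_xx_sq_dvd he.le ((args kd).M_insert_dvd_both hi (by simp [args, hk])
    (by simp [args, hk]) p q g)
  have hsupp : cf e (sm xx U * Mg kd g p q U) = 0 := by
    rw [sm, sum_mul, cf_sum]
    refine sum_eq_zero fun j hj => ?_
    rw [cf_xx_mul]
    split_ifs
    · rfl
    · have hji : j ≠ i := fun h => hi (h ▸ hj)
      refine (isSupp_Mg kd g p q U).cf_eq_zero hi ?_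
      simp [hji, he]
  rw [cf_sub, sub_eq_zero] at this
  refine this.trans ?_
  rw [cf_add]
  refine (congrArg₂ _ hsupp rfl).trans ?_
  change 0 + cf e (xx i * _) = _
  rw [zero_add, cf_xx_mul, if_neg (by omega)]
  refine (cf_intCast_mul _ _ _).trans ?_
  push_cast
  rfl

end Insert

end Coefficients

section Top

variable {ι : Type*} [DecidableEq ι] (kd : ι → Option Bool)

/-- The sign attached to an argument. -/
def sgn (i : ι) : ℚ := if kd i = some false then -1 else 1

/-- The weight attached to an argument with exponent `k`. -/
def wt (i : ι) (k : ℕ) : ℚ := sgn kd i / Nat.doubleFactorial (2 * (k - eta kd i) + 1)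

/-- The product of the weights. -/
def WW (U : Finset ι) (e : ι →₀ ℕ) : ℚ := ∏ i ∈ U, wt kd i (e i)

/-- The number of arguments allowed in only one factor. -/
def mm (U : Finset ι) : ℕ := ∑ i ∈ U, (1 - eta kd i)

/-- The parameter on which the closed formulas depend. -/
def EE (g : ℕ) (p q : ℤ) (U : Finset ι) : ℚ := 2 * g + mm kd U + p + q

omit [DecidableEq ι] in
lemma wt_succ {i : ι} {k : ℕ} (h : eta kd i < k) :
    wt kd i (k - 1) = (2 * (k - eta kd i : ℕ) + 1) * wt kd i k := by
  obtain ⟨f, hf⟩ : ∃ f, k - eta kd i = f + 1 := ⟨k - eta kd i - 1, by omega⟩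
  rw [wt, wt, hf, show k - 1 - eta kd i = f by omega, show 2 * (f + 1) + 1 = 2 * f + 1 + 2 by ring,
    Nat.doubleFactorial_add_two]
  have : (Nat.doubleFactorial (2 * f + 1) : ℚ) ≠ 0 := by exact_mod_cast (Nat.doubleFactorial_pos _).ne'
  push_cast
  field_simp
  ring

omit [DecidableEq ι] in
lemma wt_eta (i : ι) : wt kd i (eta kd i) = sgn kd i := by simp [wt]

omit [DecidableEq ι] in
lemma WW_congr {U : Finset ι} {e e' : ι →₀ ℕ} (h : ∀ i ∈ U, e i = e' i) : WW kd U e = WW kd U e' :=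
  prod_congr rfl fun i hi => by rw [h i hi]

lemma WW_insert {U : Finset ι} {i : ι} (hi : i ∉ U) (e : ι →₀ ℕ) :
    WW kd (insert i U) e = wt kd i (e i) * WW kd U e := prod_insert hi

lemma nn_insert {U : Finset ι} {i : ι} (hi : i ∉ U) : nn kd (insert i U) = eta kd i + nn kd U :=
  sum_insert hi

lemma mm_insert {U : Finset ι} {i : ι} (hi : i ∉ U) :
    mm kd (insert i U) = (1 - eta kd i) + mm kd U := sum_insert hi

omit [DecidableEq ι] in
lemma nn_add_mm (U : Finset ι) : nn kd U + mm kd U = #U := by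
  rw [nn, mm, ← sum_add_distrib, card_eq_sum_ones]
  exact sum_congr rfl fun i _ => by have := eta_le_one kd i; omega

omit [DecidableEq ι] in
lemma degree_eq_sum {U : Finset ι} {e : ι →₀ ℕ} (h : e.support ⊆ U) : e.degree = ∑ i ∈ U, e i := by
  rw [Finsupp.degree_apply, sum_subset h fun i _ hi => by simpa using hi]

lemma cf_Mg_empty (p q : ℤ) : cf 0 (Mg kd 0 p q ∅) = (-1) ^ q := by
  have hα : (args kd).α ∅ = 1 := Units.ext (by rw [(args kd).hα, sm_empty]; simp)
  have hβ : (args kd).β ∅ = -1 := Units.ext (by rw [(args kd).hβ, sm_empty]; simp)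
  have hv : PowerSeries.coeff 0 ((args kd).vv ∅ ∅) = 1 := by
    rw [Args.vv, PowerSeries.coeff_mul, Nat.antidiagonal_zero, sum_singleton, psiMark_empty_coeff,
      psiMark_empty_coeff, one_mul]
  have h1 : Mg kd 0 p q ∅ = ↑((-1 : (T ι)ˣ) ^ q) := by
    rw [Mg, Args.M, powerset_empty, sum_singleton, PowerSeries.coeff_C_mul, empty_sdiff, hv, hα, hβ]
    simp
  rw [h1]
  rcases Int.even_or_odd q with h | h
  · rw [h.neg_one_zpow, h.neg_one_zpow]; simp [cf]
  · rw [h.neg_one_zpow, h.neg_one_zpow]; simp [cf]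

omit [DecidableEq ι] in
lemma support_sub_subset {U : Finset ι} {e : ι →₀ ℕ} (h : e.support ⊆ U) (i : ι) (k : ℕ) :
    (e - Finsupp.single i k).support ⊆ U := by
  intro j hj
  refine h (Finsupp.mem_support_iff.2 fun h0 => Finsupp.mem_support_iff.1 hj ?_)
  simp [h0]

lemma support_subset_of_insert {U : Finset ι} {e : ι →₀ ℕ} {i : ι}
    (h : e.support ⊆ insert i U) (h0 : e i = 0) : e.support ⊆ U := by
  intro j hj
  rcases mem_insert.1 (h hj) with rfl | hj'
  · exact absurd h0 (Finsupp.mem_support_iff.1 hj)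
  · exact hj'

omit [DecidableEq ι] in
lemma sub_single_apply_of_mem {U : Finset ι} {i j : ι} (hi : i ∉ U) (hj : j ∈ U) (e : ι →₀ ℕ)
    (k : ℕ) : (e - Finsupp.single i k) j = e j := by
  have : i ≠ j := fun h => hi (h ▸ hj)
  simp [this]

omit [DecidableEq ι] in
lemma sum_sub_single {U : Finset ι} {i : ι} (hi : i ∉ U) (e : ι →₀ ℕ) (k : ℕ) :
    ∑ j ∈ U, (e - Finsupp.single i k) j = ∑ j ∈ U, e j :=
  sum_congr rfl fun _ hj => sub_single_apply_of_mem hi hj e k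

omit [DecidableEq ι] in
lemma kind_cases (i : ι) : (kd i = some true ∧ eta kd i = 0 ∧ sgn kd i = 1) ∨
    (kd i = some false ∧ eta kd i = 0 ∧ sgn kd i = -1) ∨
    (kd i = none ∧ eta kd i = 1 ∧ sgn kd i = 1) := by
  rcases h : kd i with _ | _ | _ <;> simp [eta, sgn, h]

omit [DecidableEq ι] in
lemma degree_sub_single {e : ι →₀ ℕ} {i : ι} {k : ℕ} (h : k ≤ e i) :
    (e - Finsupp.single i k).degree + k = e.degree := by
  conv_rhs => rw [← tsub_add_cancel_of_le (Finsupp.single_le_iff.2 h)]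
  rw [map_add, Finsupp.degree_single]

lemma WW_sub_single {U : Finset ι} {e : ι →₀ ℕ} {i : ι} (hi : i ∈ U) (h : eta kd i < e i) :
    WW kd U (e - Finsupp.single i 1) = (2 * (e i - eta kd i : ℕ) + 1) * WW kd U e := by
  obtain ⟨U, hiU, rfl⟩ : ∃ U', i ∉ U' ∧ U = insert i U' :=
    ⟨U.erase i, notMem_erase i U, (insert_erase hi).symm⟩
  rw [WW_insert kd hiU, WW_insert kd hiU,
    WW_congr kd fun j hj => sub_single_apply_of_mem hiU hj e 1, ← mul_assoc, ← wt_succ kd h]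
  simp

omit [DecidableEq ι] in
lemma EE_succ (g : ℕ) (p q : ℤ) (U : Finset ι) :
    EE kd g (p + 1) (q + 1) U = EE kd (g + 1) p q U := by
  rw [EE, EE]; push_cast; ring

omit [DecidableEq ι] in
lemma sum_odd {U : Finset ι} {e : ι →₀ ℕ} {g : ℕ} (he : ∀ i ∈ U, eta kd i ≤ e i)
    (hd : ∑ i ∈ U, e i = g + nn kd U) :
    ∑ i ∈ U, (2 * ((e i - eta kd i : ℕ) : ℚ) + 1) = 2 * g + #U := by
  have : ∑ i ∈ U, (e i - eta kd i) = g := by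
    have h : ∑ i ∈ U, (e i - eta kd i) + nn kd U = ∑ i ∈ U, e i := by
      rw [nn, ← sum_add_distrib]
      exact sum_congr rfl fun i hi => tsub_add_cancel_of_le (he i hi)
    omega
  rw [sum_add_distrib, ← mul_sum, ← Nat.cast_sum, this]
  simp

/-- The coefficients of leading order. -/
theorem cf_top (g : ℕ) (p q : ℤ) (U : Finset ι) (e : ι →₀ ℕ) (hs : e.support ⊆ U)
    (he : ∀ i ∈ U, eta kd i ≤ e i) (hd : ∑ i ∈ U, e i = g + nn kd U) :
    cf e (Mg kd g p q U) = (-1) ^ q * WW kd U e / 4 ^ g *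
      ∏ j ∈ range (nn kd U), (EE kd g p q U + 2 + j) := by
  induction hN : g + #U using Nat.strong_induction_on generalizing g p q U e with
  | _ N ih =>
  subst hN
  by_cases hz : ∃ i ∈ U, e i = eta kd i
  · obtain ⟨i, hi, hei⟩ := hz
    obtain ⟨U, hiU, rfl⟩ : ∃ U', i ∉ U' ∧ U = insert i U' :=
      ⟨U.erase i, notMem_erase i U, (insert_erase hi).symm⟩
    rw [sum_insert hiU, nn_insert kd hiU] at hd
    have hc := card_insert_of_notMem hiU
    have he' : ∀ j ∈ U, eta kd j ≤ e j := fun j hj => he j (mem_insert_of_mem hj)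
    have hcard := nn_add_mm kd U
    rw [WW_insert kd hiU, nn_insert kd hiU, hei, wt_eta, EE, mm_insert kd hiU]
    rcases kind_cases kd i with ⟨hk, h0, h1⟩ | ⟨hk, h0, h1⟩ | ⟨hk, h0, h1⟩
    · rw [h0] at hei
      rw [cf_string_left hiU hk hei, ih (g + #U) (by omega) g (p + 1) q U e
        (support_subset_of_insert hs hei) he' (by omega) rfl, EE, h0, h1, zero_add]
      push_cast
      rw [one_mul]
      congr 1
      exact prod_congr rfl fun j _ => by ring
    · rw [h0] at hei
      rw [cf_string_right hiU hk hei, ih (g + #U) (by omega) g p (q + 1) U e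
        (support_subset_of_insert hs hei) he' (by omega) rfl, EE, h0, h1, zero_add,
        zpow_add_one₀ (by norm_num)]
      push_cast
      congr 1
      · ring
      · exact prod_congr rfl fun j _ => by ring
    · rw [h0] at hei
      rw [cf_dilaton hiU hk hei, ih (g + #U) (by omega) g p q U (e - Finsupp.single i 1)
        (support_subset_of_insert (support_sub_subset hs i 1) (by simp [hei]))
        (fun j hj => by rw [sub_single_apply_of_mem hiU hj]; exact he' j hj)
        (by rw [sum_sub_single hiU]; omega) rfl, EE, h0, h1,
        WW_congr kd fun j hj => sub_single_apply_of_mem hiU hj e 1, add_comm 1 (nn kd U),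
        prod_range_succ, ← hcard]
      push_cast
      simp only [zero_add]
      ring
  · push Not at hz
    have hr : ∀ i ∈ U, eta kd i + 1 ≤ e i := fun i hi => by
      have := he i hi; have := hz i hi; omega
    have hdeg := degree_eq_sum hs
    have hrec := cf_rec kd g p q U hr (by omega)
    have hb : ∑ i ∈ U, cf (e - Finsupp.single i (eta kd i + 1))
        (kern kd {i} (eta kd i + 1) g p q (U \ {i})) = 0 := by
      refine sum_eq_zero fun i hi => ?_
      refine cf_eq_zero_of_X_pow_dvd ?_
        (X_pow_dvd_kern kd fun p q => X_pow_dvd_Mg kd g p q (U \ {i}))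
      have h1 := degree_sub_single (hr i hi)
      have h2 := nn_add_nn_sdiff kd (singleton_subset_iff.2 hi)
      rw [show nn kd {i} = eta kd i by simp [nn]] at h2
      omega
    have hsum := sum_le_sum hr
    rw [sum_add_distrib, ← card_eq_sum_ones] at hsum
    change nn kd U + _ ≤ _ at hsum
    cases g with
    | zero =>
      obtain rfl : U = ∅ := card_eq_zero.1 (by omega)
      have : e = 0 := by simpa using hs
      subst this
      simp [cf_Mg_empty, WW, nn]
    | succ g =>
      rw [hb, if_neg g.succ_ne_zero, add_zero, Nat.add_sub_cancel] at hrec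
      have hl : ∀ i ∈ U, cf (e - Finsupp.single i 1) (Mg kd g (p + 1) (q + 1) U) =
          (2 * ((e i - eta kd i : ℕ) : ℚ) + 1) * ((-1) ^ (q + 1) * WW kd U e / 4 ^ g *
            ∏ j ∈ range (nn kd U), (EE kd (g + 1) p q U + 2 + j)) := by
        intro i hi
        have h1 := degree_sub_single (e := e) (i := i) (k := 1) (by have := hr i hi; omega)
        rw [degree_eq_sum (support_sub_subset hs i 1)] at h1
        rw [ih (g + #U) (by omega) g (p + 1) (q + 1) U _ (support_sub_subset hs i 1) _ (by omega)
          rfl, EE_succ, WW_sub_single kd hi (hr i hi)]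
        · ring
        · intro j hj
          have := hr j hj
          rw [Finsupp.tsub_apply, Finsupp.single_apply]
          split_ifs <;> omega
      rw [sum_congr rfl hl, ← sum_mul, sum_odd kd he hd, zpow_add_one₀ (by norm_num)] at hrec
      have h0 : (2 * ((g + 1 : ℕ) : ℚ) + #U) ≠ 0 := by positivity
      refine mul_left_cancel₀ h0 (hrec.trans ?_)
      rw [pow_succ]
      ring

end Top

section Sub

variable {ι : Type*} [DecidableEq ι] (kd : ι → Option Bool)

/-- The contribution of an argument to the signed total exponent. -/
def rhoTerm (i : ι) (k : ℕ) : ℚ :=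
  if kd i = some true then k + 1 / 2 else if kd i = some false then -(k + 1 / 2) else 0

/-- The sum of the terms `rhoTerm` over the arguments. -/
def rho (U : Finset ι) (e : ι →₀ ℕ) : ℚ := ∑ i ∈ U, rhoTerm kd i (e i)

/-- The number of arguments of kind `o` in `U` with exponent `k`. -/
def cnt (o : Option Bool) (k : ℕ) (U : Finset ι) (e : ι →₀ ℕ) : ℕ :=
  ∑ i ∈ U, if kd i = o ∧ e i = k then 1 else 0

/-- The number of arguments allowed in both factors with exponent different from one. -/
def big (U : Finset ι) (e : ι →₀ ℕ) : ℕ := ∑ i ∈ U, if kd i = none ∧ e i ≠ 1 then 1 else 0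

/-- The closed formula for the coefficients of subleading order. -/
def subVal (E D ρ : ℚ) (p q : ℤ) (u v k w : ℕ) : ℚ :=
  (∏ j ∈ range k, (E + 1 + j)) * (∏ j ∈ range w, (E + k + 2 + j)) *
    ((ρ - (u - v) / 2) * D + (p + u - q - v) * (D - p - q + 1 - u - v) / 2)

variable {kd} {e e' : ι →₀ ℕ} {U : Finset ι} {i : ι}

lemma rho_insert (hi : i ∉ U) : rho kd (insert i U) e = rhoTerm kd i (e i) + rho kd U e :=
  sum_insert hi

lemma cnt_insert (hi : i ∉ U) (o : Option Bool) (k : ℕ) :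
    cnt kd o k (insert i U) e = (if kd i = o ∧ e i = k then 1 else 0) + cnt kd o k U e :=
  sum_insert hi

lemma big_insert (hi : i ∉ U) :
    big kd (insert i U) e = (if kd i = none ∧ e i ≠ 1 then 1 else 0) + big kd U e := sum_insert hi

omit [DecidableEq ι] in
lemma rho_congr (h : ∀ i ∈ U, e i = e' i) : rho kd U e = rho kd U e' :=
  sum_congr rfl fun i hi => by rw [h i hi]

omit [DecidableEq ι] in
lemma cnt_congr (h : ∀ i ∈ U, e i = e' i) (o : Option Bool) (k : ℕ) :
    cnt kd o k U e = cnt kd o k U e' :=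
  sum_congr rfl fun i hi => by rw [h i hi]

omit [DecidableEq ι] in
lemma big_congr (h : ∀ i ∈ U, e i = e' i) : big kd U e = big kd U e' :=
  sum_congr rfl fun i hi => by rw [h i hi]

omit [DecidableEq ι] in
lemma cnt_eq_zero {o : Option Bool} {k : ℕ} (h : ∀ i ∈ U, kd i = o → e i ≠ k) :
    cnt kd o k U e = 0 :=
  sum_eq_zero fun i hi => if_neg fun hk => h i hi hk.1 hk.2

omit [DecidableEq ι] in
lemma nn_eq_big_add : nn kd U = big kd U e + cnt kd none 1 U e := by
  rw [nn, big, cnt, ← sum_add_distrib]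
  refine sum_congr rfl fun i _ => ?_
  rw [eta]
  split_ifs <;> simp_all

variable (kd e U) in
/-- The closed formula for the coefficients of subleading order, in terms of the exponents. -/
def subF (g : ℕ) (p q : ℤ) : ℚ :=
  subVal (EE kd g p q U) (EE kd g p q U + big kd U e + 1) (rho kd U e) p q (cnt kd (some true) 0 U e)
    (cnt kd (some false) 0 U e) (big kd U e) (cnt kd none 1 U e)

lemma subF_insert_left (hi : i ∉ U) (hk : kd i = some true) (he : e i = 0) (g : ℕ) (p q : ℤ) :
    subF kd e (insert i U) g p q = subF kd e U g (p + 1) q := by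
  simp only [subF, EE, mm_insert kd hi, rho_insert hi, cnt_insert hi, big_insert hi, hk, he, rhoTerm,
    subVal, eta]
  simp
  ring_nf

lemma subF_insert_right (hi : i ∉ U) (hk : kd i = some false) (he : e i = 0) (g : ℕ) (p q : ℤ) :
    subF kd e (insert i U) g p q = subF kd e U g p (q + 1) := by
  simp only [subF, EE, mm_insert kd hi, rho_insert hi, cnt_insert hi, big_insert hi, hk, he, rhoTerm,
    subVal, eta]
  simp
  ring_nf

lemma subF_insert_both (hi : i ∉ U) (hk : kd i = none) (he : e i = 1) (g : ℕ) (p q : ℤ) :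
    subF kd e (insert i U) g p q = (2 * g + #U + 2 + p + q) * subF kd e U g p q := by
  have h1 := nn_add_mm kd U
  rw [nn_eq_big_add (e := e)] at h1
  simp only [subF, EE, mm_insert kd hi, rho_insert hi, cnt_insert hi, big_insert hi, hk, he, rhoTerm,
    subVal, eta, ← h1]
  simp only [true_and, if_true, if_false, reduceCtorEq, ne_eq, not_true, and_false, zero_add,
    add_comm 1, prod_range_succ, tsub_self]
  push_cast
  ring

omit [DecidableEq ι] in
lemma subF_congr (h : ∀ i ∈ U, e i = e' i) (g : ℕ) (p q : ℤ) :
    subF kd e U g p q = subF kd e' U g p q := by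
  rw [subF, subF, rho_congr h, cnt_congr h, cnt_congr h, cnt_congr h, big_congr h]

variable (kd) in
/-- The signed multiplicity of an argument. -/
def sig (i : ι) : ℚ := if kd i = some true then 1 else if kd i = some false then -1 else 0

variable (kd) in
/-- The coefficient of the boundary contribution of an argument. -/
def bdy (i : ι) (p q : ℤ) : ℚ :=
  if kd i = some true then p + 1 else if kd i = some false then -(q + 1) else
    (p - q) * (p + q + 1) / 2

variable (kd e U) in
/-- The contribution of lowering an exponent, in terms of the value after lowering. -/
def lowF (g : ℕ) (p q : ℤ) : ℚ :=
  subVal (EE kd g p q U) (EE kd g p q U + big kd U e + 1) (rho kd U e) (p + 1) (q + 1)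
    (cnt kd (some true) 0 U e) (cnt kd (some false) 0 U e) (big kd U e) (cnt kd none 1 U e)

lemma lowF_step (hi : i ∉ U) (hr : ∀ j ∈ U, eta kd j + 1 ≤ e j) {f : ℕ} (hf : e i = eta kd i + 1 + f)
    (g : ℕ) (p q : ℤ) :
    (2 * (f + 1) + 1) * lowF kd (e - Finsupp.single i 1) (insert i U) g p q +
      (if f = 0 then 3 * bdy kd i p q * ∏ j ∈ range (nn kd U), (EE kd g p q (insert i U) + 1 + j)
        else 0) =
      (2 * (f + 1) + 1) * ((∏ j ∈ range (nn kd (insert i U)), (EE kd g p q (insert i U) + 1 + j)) *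
        ((rho kd (insert i U) e - sig kd i) * (EE kd g p q (insert i U) + nn kd (insert i U) + 1) +
          (p - q) * (2 * g + #(insert i U)) / 2)) := by
  have hc : ∀ j ∈ U, (e - Finsupp.single i 1 : ι →₀ ℕ) j = e j := fun j hj => sub_single_apply_of_mem hi hj e 1
  have hei : (e - Finsupp.single i 1 : ι →₀ ℕ) i = eta kd i + f := by rw [Finsupp.tsub_apply, Finsupp.single_eq_same, hf]; omega
  have h0 : cnt kd (some true) 0 U e = 0 := cnt_eq_zero fun j hj _ => by have := hr j hj; omega
  have h1 : cnt kd (some false) 0 U e = 0 := cnt_eq_zero fun j hj _ => by have := hr j hj; omega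
  have h2 : cnt kd none 1 U e = 0 := cnt_eq_zero fun j hj hk => by
    have := hr j hj; simp [eta, hk] at this; omega
  have h3 : big kd U e = nn kd U := by rw [nn_eq_big_add (e := e), h2, add_zero]
  have hm := nn_add_mm kd (insert i U)
  rw [← hm]
  rw [lowF]
  set E := EE kd g p q (insert i U) with hE
  have hE' : (2 * g : ℚ) + (nn kd (insert i U) + mm kd (insert i U) : ℕ) =
      E - p - q + nn kd (insert i U) := by rw [hE, EE]; push_cast; ring
  rw [hE']
  simp only [rho_insert hi, cnt_insert hi, big_insert hi, nn_insert kd hi, rho_congr hc, cnt_congr hc,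
    big_congr hc, hei, h0, h1, h2, h3, hf, subVal]
  rcases kind_cases kd i with ⟨hk, hη, -⟩ | ⟨hk, hη, -⟩ | ⟨hk, hη, -⟩
  · rcases Nat.eq_zero_or_pos f with rfl | hf
    · simp [hk, hη, rhoTerm, bdy, sig]
      ring
    · simp [hk, hη, rhoTerm, sig, hf.ne', -mul_eq_mul_left_iff]
      ring
  · rcases Nat.eq_zero_or_pos f with rfl | hf
    · simp [hk, hη, rhoTerm, bdy, sig]
      ring
    · simp [hk, hη, rhoTerm, sig, hf.ne', -mul_eq_mul_left_iff]
      ring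
  · rcases Nat.eq_zero_or_pos f with rfl | hf
    · simp [hk, hη, rhoTerm, bdy, sig, add_comm 1 (nn kd U), prod_range_succ]
      ring
    · simp [hk, hη, rhoTerm, sig, hf.ne', -mul_eq_mul_left_iff, add_comm 1 (nn kd U), prod_range_succ]
      ring

lemma cf_kern (hi : i ∉ U) (hr : ∀ j ∈ U, eta kd j + 1 ≤ e j) {f : ℕ} (hf : e i = eta kd i + 1 + f)
    (hs : e.support ⊆ insert i U) {g : ℕ} (hd : ∑ j ∈ insert i U, e j = g + nn kd (insert i U) + 1)
    (p q : ℤ) :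
    cf (e - Finsupp.single i (eta kd i + 1)) (kern kd {i} (eta kd i + 1) g p q U) =
      (-1) ^ q * WW kd (insert i U) e / 4 ^ g * if f = 0 then 3 * bdy kd i p q *
        ∏ j ∈ range (nn kd U), (EE kd g p q (insert i U) + 1 + j) else 0 := by
  split_ifs with h
  · subst h
    have h0 : (e - Finsupp.single i (eta kd i + 1) : ι →₀ ℕ) i = 0 := by simp [hf]
    have hc : ∀ j ∈ U, (e - Finsupp.single i (eta kd i + 1) : ι →₀ ℕ) j = e j := fun j hj =>
      sub_single_apply_of_mem hi hj e _
    have htop := fun p q => cf_top kd g p q U (e - Finsupp.single i (eta kd i + 1))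
      (support_subset_of_insert (support_sub_subset hs i _) h0)
      (fun j hj => by rw [hc j hj]; exact (Nat.le_succ _).trans (hr j hj))
      (by rw [sum_insert hi, nn_insert kd hi, hf] at hd
          have : ∑ j ∈ U, e j = g + nn kd U := by omega
          exact (sum_congr rfl hc).trans this)
    have hw : wt kd i (eta kd i + 1) = sgn kd i / 3 := by
      simp [wt, Nat.doubleFactorial]
    rw [kern, cf_add, cf_algebraMap_mul, cf_algebraMap_mul, htop, htop, WW_congr kd hc,
      WW_insert kd hi, hf, add_zero, hw]
    simp only [EE, mm_insert kd hi, prod_singleton]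
    rcases kind_cases kd i with ⟨hk, hη, h1⟩ | ⟨hk, hη, h1⟩ | ⟨hk, hη, h1⟩
    · simp [hk, hη, h1, lwt, rwt, bdy, binomZ_one]
      ring_nf
    · simp [hk, hη, h1, lwt, rwt, bdy, binomZ_one]
      ring_nf
    · simp [hk, hη, h1, lwt, rwt, bdy, binomZ_two]
      have hq : (-1 : ℚ) ^ (q + 1 - 2) = -(-1) ^ q := by
        rw [show q + 1 - 2 = q - 1 by ring, zpow_sub_one₀ (by norm_num)]; norm_num
      rw [hq]
      ring_nf
  · rw [mul_zero]
    refine (isSupp_kern kd _ _ _ _ _ U).cf_eq_zero hi ?_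
    simp [hf]; omega

end Sub

section Sub

variable {ι : Type*} [DecidableEq ι] (kd : ι → Option Bool)

omit [DecidableEq ι] in
lemma subF_reduced {U : Finset ι} {e : ι →₀ ℕ} (hr : ∀ i ∈ U, eta kd i + 1 ≤ e i) (g : ℕ) (p q : ℤ) :
    subF kd e U g p q = (∏ j ∈ range (nn kd U), (EE kd g p q U + 1 + j)) *
      (rho kd U e * (EE kd g p q U + nn kd U + 1) + (p - q) * (2 * g + #U + 2) / 2) := by
  have h0 : cnt kd (some true) 0 U e = 0 := cnt_eq_zero fun j hj _ => by have := hr j hj; omega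
  have h1 : cnt kd (some false) 0 U e = 0 := cnt_eq_zero fun j hj _ => by have := hr j hj; omega
  have h2 : cnt kd none 1 U e = 0 := cnt_eq_zero fun j hj hk => by
    have := hr j hj; simp [eta, hk] at this; omega
  have h3 : big kd U e = nn kd U := by rw [nn_eq_big_add (e := e), h2, add_zero]
  rw [subF, subVal, h0, h1, h2, h3, ← nn_add_mm kd U]
  simp only [EE, prod_range_zero]
  push_cast
  ring

omit [DecidableEq ι] in
lemma rhoTerm_eq (i : ι) (k : ℕ) :
    (2 * ((k - eta kd i : ℕ) : ℚ) + 1) * sig kd i = 2 * rhoTerm kd i k := by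
  rcases kind_cases kd i with ⟨hk, hη, -⟩ | ⟨hk, hη, -⟩ | ⟨hk, hη, -⟩ <;>
    simp [sig, rhoTerm, hk, hη] <;> ring

/-- The coefficients of subleading order. -/
theorem cf_subleading (g : ℕ) (p q : ℤ) (U : Finset ι) (e : ι →₀ ℕ) (hs : e.support ⊆ U)
    (he : ∀ i ∈ U, eta kd i ≤ e i) (hd : ∑ i ∈ U, e i = g + nn kd U + 1) :
    cf e (Mg kd g p q U) = (-1) ^ q * WW kd U e / 4 ^ g * subF kd e U g p q := by
  induction hN : g + #U using Nat.strong_induction_on generalizing g p q U e with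
  | _ N ih =>
  subst hN
  by_cases hz : ∃ i ∈ U, e i = eta kd i
  · obtain ⟨i, hi, hei⟩ := hz
    obtain ⟨U, hiU, rfl⟩ : ∃ U', i ∉ U' ∧ U = insert i U' :=
      ⟨U.erase i, notMem_erase i U, (insert_erase hi).symm⟩
    rw [sum_insert hiU, nn_insert kd hiU] at hd
    have hc := card_insert_of_notMem hiU
    have he' : ∀ j ∈ U, eta kd j ≤ e j := fun j hj => he j (mem_insert_of_mem hj)
    rw [WW_insert kd hiU, hei, wt_eta]
    rcases kind_cases kd i with ⟨hk, h0, h1⟩ | ⟨hk, h0, h1⟩ | ⟨hk, h0, h1⟩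
    · rw [h0] at hei
      rw [cf_string_left hiU hk hei, ih (g + #U) (by omega) g (p + 1) q U e
        (support_subset_of_insert hs hei) he' (by omega) rfl, h1, subF_insert_left hiU hk hei,
        one_mul]
    · rw [h0] at hei
      rw [cf_string_right hiU hk hei, ih (g + #U) (by omega) g p (q + 1) U e
        (support_subset_of_insert hs hei) he' (by omega) rfl, h1, subF_insert_right hiU hk hei,
        zpow_add_one₀ (by norm_num)]
      ring
    · rw [h0] at hei
      have hcong : ∀ j ∈ U, (e - Finsupp.single i 1 : ι →₀ ℕ) j = e j := fun j hj =>
        sub_single_apply_of_mem hiU hj e 1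
      have hsum : ∑ j ∈ U, e j = g + nn kd U + 1 := by omega
      rw [cf_dilaton hiU hk hei, ih (g + #U) (by omega) g p q U (e - Finsupp.single i 1)
        (support_subset_of_insert (support_sub_subset hs i 1) (by simp [hei]))
        (fun j hj => by rw [hcong j hj]; exact he' j hj)
        ((sum_congr rfl hcong).trans hsum) rfl, h1, subF_insert_both hiU hk hei,
        WW_congr kd hcong, subF_congr hcong]
      ring
  · push Not at hz
    have hr : ∀ i ∈ U, eta kd i + 1 ≤ e i := fun i hi => by
      have := he i hi; have := hz i hi; omega
    have hdeg := degree_eq_sum hs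
    have hrec := cf_rec kd g p q U hr (by omega)
    have hb : ∀ i ∈ U, cf (e - Finsupp.single i (eta kd i + 1))
        (kern kd {i} (eta kd i + 1) g p q (U \ {i})) =
        (-1) ^ q * WW kd U e / 4 ^ g * (if e i - eta kd i - 1 = 0 then 3 * bdy kd i p q *
          ∏ j ∈ range (nn kd (U \ {i})), (EE kd g p q U + 1 + j) else 0) := by
      intro i hi
      have h1 : insert i (U \ {i}) = U := by
        rw [sdiff_singleton_eq_erase, insert_erase hi]
      have h2 := hr i hi
      have := cf_kern (kd := kd) (e := e) (U := U \ {i}) (i := i) (f := e i - eta kd i - 1) (g := g)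
        (by simp) (fun j hj => hr j (sdiff_subset hj)) (by omega)
        (by rwa [h1]) (by rwa [h1]) p q
      rwa [h1] at this
    have hsum := sum_le_sum hr
    rw [sum_add_distrib, ← card_eq_sum_ones] at hsum
    change nn kd U + _ ≤ _ at hsum
    rw [sum_congr rfl hb] at hrec
    cases g with
    | zero =>
      rw [if_pos rfl, zero_add] at hrec
      have hU1 : #U = 1 := by
        have hne : U.Nonempty := by
          rw [nonempty_iff_ne_empty]; rintro rfl
          simp at hd
        have := hne.card_pos
        omega
      obtain ⟨i, rfl⟩ := card_eq_one.1 hU1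
      have hei : e i = eta kd i + 1 := by
        have := hr i (mem_singleton_self i)
        simp [nn] at hd
        omega
      rw [sum_singleton, if_pos (by omega), card_singleton, sdiff_self] at hrec
      rw [subF_reduced kd hr]
      have hfin : (∏ j ∈ range (nn kd {i}), (EE kd 0 p q {i} + 1 + j)) *
          (rho kd {i} e * (EE kd 0 p q {i} + nn kd {i} + 1) +
            (p - q) * (2 * (0 : ℕ) + #{i} + 2) / 2) = 3 * bdy kd i p q := by
        rcases kind_cases kd i with ⟨hk, hη, -⟩ | ⟨hk, hη, -⟩ | ⟨hk, hη, -⟩ <;>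
          simp [nn, EE, mm, hη, rho, rhoTerm, hk, bdy, hei] <;> ring
      rw [hfin]
      simp [nn] at hrec
      rw [hrec]
      simp
    | succ g =>
      rw [if_neg g.succ_ne_zero, Nat.add_sub_cancel] at hrec
      have hl : ∀ i ∈ U, -(1 / 4) * cf (e - Finsupp.single i 1) (Mg kd g (p + 1) (q + 1) U) =
          (-1) ^ q * WW kd U e / 4 ^ (g + 1) * ((2 * (((e i - eta kd i - 1 : ℕ) : ℚ) + 1) + 1) *
            lowF kd (e - Finsupp.single i 1) U (g + 1) p q) := by
        intro i hi
        have h1 := degree_sub_single (e := e) (i := i) (k := 1) (by have := hr i hi; omega)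
        rw [degree_eq_sum (support_sub_subset hs i 1)] at h1
        rw [ih (g + #U) (by omega) g (p + 1) (q + 1) U _ (support_sub_subset hs i 1) _ (by omega)
          rfl, WW_sub_single kd hi (hr i hi), zpow_add_one₀ (by norm_num),
          show ((e i - eta kd i : ℕ) : ℚ) = ((e i - eta kd i - 1 : ℕ) : ℚ) + 1 by
            have := hr i hi
            rw [← Nat.cast_add_one]; congr 1; omega, subF, EE_succ, lowF, pow_succ]
        · ring
        · intro j hj
          have := hr j hj
          rw [Finsupp.tsub_apply, Finsupp.single_apply]
          split_ifs <;> omega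
      rw [mul_sum, sum_congr rfl hl, ← sum_add_distrib] at hrec
      have hD : EE kd (g + 1) p q U + nn kd U + 1 = EE kd (g + 1) p q U + nn kd U + 1 := rfl
      set D := EE kd (g + 1) p q U + nn kd U + 1
      set c := (-1 : ℚ) ^ q * WW kd U e / 4 ^ (g + 1) with hc
      set Pr := ∏ j ∈ range (nn kd U), (EE kd (g + 1) p q U + 1 + j) with hPr
      have hstep : ∀ i ∈ U, c * ((2 * (((e i - eta kd i - 1 : ℕ) : ℚ) + 1) + 1) *
            lowF kd (e - Finsupp.single i 1) U (g + 1) p q) +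
          c * (if e i - eta kd i - 1 = 0 then 3 * bdy kd i p q *
            ∏ j ∈ range (nn kd (U \ {i})), (EE kd (g + 1) p q U + 1 + j) else 0) =
          c * Pr * ((2 * ((e i - eta kd i : ℕ) : ℚ) + 1) *
            (rho kd U e * D + (p - q) * (2 * (g + 1 : ℕ) + #U) / 2)) -
          c * Pr * D * (2 * rhoTerm kd i (e i)) := by
        intro i hi
        have h1 : insert i (U \ {i}) = U := by
          rw [sdiff_singleton_eq_erase, insert_erase hi]
        have h2 := hr i hi
        have := lowF_step (kd := kd) (e := e) (U := U \ {i}) (i := i) (f := e i - eta kd i - 1)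
          (by simp) (fun j hj => hr j (sdiff_subset hj)) (by omega) (g + 1) p q
        rw [h1] at this
        have h3 : ((e i - eta kd i : ℕ) : ℚ) = ((e i - eta kd i - 1 : ℕ) : ℚ) + 1 := by
          rw [← Nat.cast_add_one]; congr 1; omega
        rw [← rhoTerm_eq, h3, ← mul_add, this]
        ring
      rw [sum_congr rfl hstep, sum_sub_distrib, ← mul_sum, ← mul_sum, ← sum_mul, ← mul_sum,
        sum_odd kd (g := g + 1 + 1) he (by omega)] at hrec
      change _ = _ - c * Pr * D * (2 * rho kd U e) at hrec
      rw [subF_reduced kd hr]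
      have hN : (2 * ((g + 1 : ℕ) : ℚ) + #U) ≠ 0 := by positivity
      refine mul_left_cancel₀ hN (hrec.trans ?_)
      push_cast
      ring

end Sub

section Kinds

variable (a b n : ℕ)

/-- The kinds of the variables `z`, `w`, `x`. -/
def kdm (v : Fin (a + b + n)) : Option Bool :=
  if v.1 < a then some true else if v.1 < a + b then some false else none

@[to_additive]
lemma prod_three {β : Type*} [CommMonoid β] (f : Fin (a + b + n) → β) :
    ∏ v, f v = (∏ i, f (zIdx a b n i)) * (∏ i, f (wIdx a b n i)) * ∏ i, f (xIdx a b n i) := by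
  rw [Fin.prod_univ_add, Fin.prod_univ_add]
  rfl

lemma kdm_z (i : Fin a) : kdm a b n (zIdx a b n i) = some true := by simp [kdm, zIdx]

lemma kdm_w (i : Fin b) : kdm a b n (wIdx a b n i) = some false := by simp [kdm, wIdx]

lemma kdm_x (i : Fin n) : kdm a b n (xIdx a b n i) = none := by
  rw [kdm, if_neg, if_neg] <;> simp [xIdx]; omega

variable (r : Fin a → ℕ) (s : Fin b → ℕ) (d : Fin n → ℕ)

lemma expVec_z (i : Fin a) : expVec a b n r s d (zIdx a b n i) = r i := by simp [expVec, zIdx]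

lemma expVec_w (i : Fin b) : expVec a b n r s d (wIdx a b n i) = s i := by simp [expVec, wIdx]

lemma expVec_x (i : Fin n) : expVec a b n r s d (xIdx a b n i) = d i := by
  have h : ¬ (a + b + i.1 < a) := by omega
  have h' : ¬ (a + b + i.1 < a + b) := by omega
  simp [expVec, xIdx, h]

/-- The closed formula in terms of the data of the three groups of variables. -/
theorem cf_Mg_kdm (g : ℕ) (hd : ∀ j, 1 ≤ d j)
    (hsum : ∑ j, r j + ∑ j, s j + ∑ j, d j = g + n + 1)
    (u v w : ℕ)
    (hu : u = (univ.filter (fun j => r j = 0)).card)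
    (hv : v = (univ.filter (fun j => s j = 0)).card)
    (hw : w = (univ.filter (fun j => d j = 1)).card)
    (hden : (2*(g : ℤ) + n + a + b - 3 - w) ≠ 0) :
    cf (Finsupp.equivFunOnFinite.symm (expVec a b n r s d))
        (Mg (kdm a b n) g (-2) (-2) univ)
      = (((∑ j, (r j : ℚ)) - (∑ j, (s j : ℚ)) + ((a : ℚ) - (b : ℚ))/2
            + (((5 : ℚ) - (u : ℚ)) * (u : ℚ) - ((5 : ℚ) - (v : ℚ)) * (v : ℚ)) /
                (2*((2*(g : ℚ) + (n : ℚ) + (a : ℚ) + (b : ℚ) - 3 - (w : ℚ))))) /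
           ((∏ j, (Nat.doubleFactorial (2*(r j)+1) : ℚ)) *
            (∏ j, (Nat.doubleFactorial (2*(s j)+1) : ℚ))))
        * ((-1 : ℚ)^b * (∏ i ∈ Finset.range (n+1), (((2*(g : ℤ) - 4 + a + b + i + 1) : ℤ) : ℚ)) /
            (4^g * ∏ j, (Nat.doubleFactorial (2*(d j)-1) : ℚ))) := by
  set e := Finsupp.equivFunOnFinite.symm (expVec a b n r s d) with hedef
  have hz : ∀ i, e (zIdx a b n i) = r i := expVec_z a b n r s d
  have hw' : ∀ i, e (wIdx a b n i) = s i := expVec_w a b n r s d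
  have hx : ∀ i, e (xIdx a b n i) = d i := expVec_x a b n r s d
  have ez : ∀ i, eta (kdm a b n) (zIdx a b n i) = 0 := fun i => by simp [eta, kdm_z]
  have ew : ∀ i, eta (kdm a b n) (wIdx a b n i) = 0 := fun i => by simp [eta, kdm_w]
  have ex : ∀ i, eta (kdm a b n) (xIdx a b n i) = 1 := fun i => by simp [eta, kdm_x]
  have hnn : nn (kdm a b n) univ = n := by simp [nn, sum_three, ez, ew, ex]
  have hmm : mm (kdm a b n) univ = a + b := by simp [mm, sum_three, ez, ew, ex]
  have hu' : cnt (kdm a b n) (some true) 0 univ e = u := by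
    rw [cnt, sum_three]; simp [kdm_z, kdm_w, kdm_x, hz, hu]
  have hv' : cnt (kdm a b n) (some false) 0 univ e = v := by
    rw [cnt, sum_three]; simp [kdm_z, kdm_w, kdm_x, hw', hv]
  have hww : cnt (kdm a b n) none 1 univ e = w := by
    rw [cnt, sum_three]; simp [kdm_z, kdm_w, kdm_x, hx, hw]
  have hbig : (big (kdm a b n) univ e) + w = n := by rw [← hww, ← nn_eq_big_add, hnn]
  have hrho : rho (kdm a b n) univ e = (∑ j, (r j : ℚ)) - (∑ j, (s j : ℚ)) + ((a : ℚ) - b) / 2 := by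
    simp [rho, rhoTerm, sum_three, kdm_z, kdm_w, kdm_x, hz, hw', sum_add_distrib]
    ring
  have hWW : WW (kdm a b n) univ e = (-1) ^ b / ((∏ j, (Nat.doubleFactorial (2*(r j)+1) : ℚ)) *
      (∏ j, (Nat.doubleFactorial (2*(s j)+1) : ℚ)) *
      ∏ j, (Nat.doubleFactorial (2*(d j)-1) : ℚ)) := by
    have hd2 : ∀ j, 2 * (d j - 1) + 1 = 2 * d j - 1 := fun j => by have := hd j; omega
    simp only [WW, prod_three, wt, sgn, kdm_z, kdm_w, kdm_x, ez, ew, ex, hz, hw', hx, hd2]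
    simp [prod_div_distrib]
    field_simp
  rw [cf_subleading (kdm a b n) g (-2) (-2) univ e (subset_univ _), hWW, subF, hu', hv', hww, subVal,
    hrho]
  · set k := big (kdm a b n) univ e
    have hk : (n : ℚ) = k + w := by rw [← hbig]; push_cast; rfl
    have hE : EE (kdm a b n) g (-2) (-2) univ = 2 * g - 4 + a + b := by
      rw [EE, hmm]; push_cast; ring
    have hden' : (2*(g : ℚ) + (n : ℚ) + (a : ℚ) + (b : ℚ) - 3 - (w : ℚ)) ≠ 0 := by exact_mod_cast hden
    have hp : (∏ i ∈ Finset.range (n+1), (((2*(g : ℤ) - 4 + a + b + i + 1) : ℤ) : ℚ)) =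
        (∏ j ∈ range k, (2 * (g : ℚ) - 4 + a + b + 1 + j)) *
        (2*(g : ℚ) + (n : ℚ) + (a : ℚ) + (b : ℚ) - 3 - (w : ℚ)) *
        ∏ j ∈ range w, (2 * (g : ℚ) - 4 + a + b + k + 2 + j) := by
      rw [show n + 1 = k + 1 + w by omega, prod_range_add, prod_range_succ]
      congr 1
      · congr 1
        · exact prod_congr rfl fun j _ => by push_cast; ring
        · rw [hk]; push_cast; ring
      · exact prod_congr rfl fun j _ => by push_cast; ring
    rw [hp, hE]
    have hD : 2 * (g : ℚ) - 4 + a + b + k + 1 = 2*(g : ℚ) + (n : ℚ) + (a : ℚ) + (b : ℚ) - 3 - (w : ℚ) := by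
      rw [hk]; ring
    rw [hD]
    set D := 2*(g : ℚ) + (n : ℚ) + (a : ℚ) + (b : ℚ) - 3 - (w : ℚ)
    have h1 : (∏ j, (Nat.doubleFactorial (2*(r j)+1) : ℚ)) ≠ 0 :=
      prod_ne_zero_iff.2 fun j _ => by positivity
    have h2 : (∏ j, (Nat.doubleFactorial (2*(s j)+1) : ℚ)) ≠ 0 :=
      prod_ne_zero_iff.2 fun j _ => by positivity
    have h3 : (∏ j, (Nat.doubleFactorial (2*(d j)-1) : ℚ)) ≠ 0 :=
      prod_ne_zero_iff.2 fun j _ => by positivity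
    norm_num
    field_simp
    ring
  · intro i _
    by_cases hi : kdm a b n i = none
    · obtain ⟨j, rfl⟩ : ∃ j, i = xIdx a b n j := by
        have h : ¬ i.1 < a + b := fun h => by
          rw [kdm] at hi; split_ifs at hi
        exact ⟨⟨i.1 - (a + b), by omega⟩, Fin.ext (by simp [xIdx]; omega)⟩
      rw [ex, hx]; exact hd j
    · simp [eta, hi]
  · rw [sum_three, hnn]; simp only [hz, hw', hx, hsum]

end Kinds

section Exp

variable {A : Type*} [CommRing A] [Algebra ℚ A]

/-- The power series `exp (t X)`. -/
def expSer (t : A) : A⟦X⟧ := PowerSeries.rescale t (PowerSeries.exp A)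

lemma coeff_expSer (t : A) (d : ℕ) :
    PowerSeries.coeff d (expSer t) = t ^ d * algebraMap ℚ A (1 / d.factorial) := by
  rw [expSer, PowerSeries.coeff_rescale, PowerSeries.coeff_exp]

lemma expSer_add (s t : A) : expSer (s + t) = expSer s * expSer t :=
  (PowerSeries.exp_mul_exp_eq_exp_add s t).symm

lemma theta_expSer (t : A) : theta A (expSer t) = PowerSeries.X * PowerSeries.C t * expSer t := by
  ext g
  rw [coeff_theta, mul_assoc]
  cases g with
  | zero => simp
  | succ g =>
    rw [PowerSeries.coeff_succ_X_mul, PowerSeries.coeff_C_mul, coeff_expSer, coeff_expSer]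
    have : algebraMap ℚ A (1 / g.factorial) = (g + 1 : ℕ) * algebraMap ℚ A (1 / (g + 1).factorial) := by
      rw [← map_natCast (algebraMap ℚ A), ← map_mul]
      congr 1
      rw [Nat.factorial_succ]; push_cast; field_simp
    rw [this]; ring

lemma map_expSer {B : Type*} [CommRing B] [Algebra ℚ B] (φ : A →+* B) (t : A) :
    PowerSeries.map φ (expSer t) = expSer (φ t) := by
  ext g
  rw [PowerSeries.coeff_map, coeff_expSer, coeff_expSer, map_mul, map_pow]
  congr 1
  exact RingHom.congr_fun (Subsingleton.elim (φ.comp (algebraMap ℚ A)) (algebraMap ℚ B)) _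

end Exp

section Fuel

/-- The quadratic expression defining `Ppoly` for an arbitrary family of functions. -/
def quadOf (G : (k : ℕ) → ℕ → K k) (n r : ℕ) : K n :=
  (2 * SX n)⁻¹ *
    ∑ I : Finset (Fin n),
      if I ≠ ∅ ∧ I ≠ univ then
        (algebraMap (R n) (K n) (∑ i ∈ I, X i))^2 *
        (algebraMap (R n) (K n) (∑ i ∈ Iᶜ, X i))^2 *
        ∑ r' ∈ Finset.range (r+1), emb I (G I.card r') * emb Iᶜ (G Iᶜ.card (r - r'))
      else 0

lemma card_lt_of_ne_univ {n : ℕ} {I : Finset (Fin n)} (h : I ≠ univ) : #I < n := by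
  have := card_lt_univ_of_notMem (s := I) (not_forall.1 (mt eq_univ_iff_forall.2 h)).choose_spec
  simpa using this

lemma quadOf_congr {G G' : (k : ℕ) → ℕ → K k} {n : ℕ} (h : ∀ k < n, ∀ r, G k r = G' k r) (r : ℕ) :
    quadOf G n r = quadOf G' n r := by
  rw [quadOf, quadOf]
  congr 1
  refine sum_congr rfl fun I _ => ?_
  split_ifs with hI
  · congr 1
    refine sum_congr rfl fun s _ => ?_
    rw [h _ (card_lt_of_ne_univ hI.2), h _ (card_lt_of_ne_univ (by simpa using hI.1))]
  · rfl

lemma Gf_add_two (fuel n g : ℕ) : Gf (fuel + 1) (n + 2) g = ∑ s ∈ Finset.range (g+1),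
    (((Nat.doubleFactorial (2*(g-s)+(n+2)-3) : ℚ) /
      (4^s * (Nat.doubleFactorial (2*g+(n+2)-1) : ℚ))) : K (n+2)) *
      quadOf (Gf fuel) (n + 2) (g - s) * (Dlt (n+2))^s := by
  rw [Gf]; rfl

lemma Gf_of_le (n : ℕ) : ∀ m g, n ≤ m → Gf m n g = Gnpt n g := by
  induction n using Nat.strong_induction_on with
  | _ n ih =>
  intro m g hm
  rcases n with _ | _ | n
  · simp [Gnpt, Gf]
  · cases g <;> simp [Gnpt, Gf]
  · obtain ⟨m, rfl⟩ : ∃ m', m = m' + 1 := ⟨m - 1, by omega⟩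
    rw [Gnpt, Gf_add_two, Gf_add_two]
    refine sum_congr rfl fun s _ => ?_
    rw [quadOf_congr fun k hk r => (ih k hk m r (by omega)).trans (ih k hk (n + 1) r (by omega)).symm]

lemma Gnpt_add_two (n g : ℕ) : Gnpt (n + 2) g = ∑ s ∈ Finset.range (g+1),
    (((Nat.doubleFactorial (2*(g-s)+(n+2)-3) : ℚ) /
      (4^s * (Nat.doubleFactorial (2*g+(n+2)-1) : ℚ))) : K (n+2)) *
      Ppoly (n + 2) (g - s) * (Dlt (n+2))^s := by
  rw [Gnpt, Gf_add_two]
  refine sum_congr rfl fun s _ => ?_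
  rw [quadOf_congr (G' := Gnpt) fun k hk r => Gf_of_le k (n + 1) r (by omega)]
  rfl

lemma doubleFactorial_sum_rec {k : Type*} [Field k] [CharZero k] (n : ℕ) (D : k) (P G : ℕ → k)
    (hG : ∀ g, G g = ∑ s ∈ Finset.range (g+1),
      ((Nat.doubleFactorial (2*(g-s)+(n+2)-3) : k) /
        (4^s * (Nat.doubleFactorial (2*g+(n+2)-1) : k))) * P (g - s) * D ^ s) (g : ℕ) :
    (2 * g + n + 1) * G g = P g + (if g = 0 then 0 else D / 4 * G (g - 1)) := by
  have key : ∀ g, (Nat.doubleFactorial (2*g+(n+2)-1) : k) =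
      (2 * g + n + 1) * (Nat.doubleFactorial (2*g+(n+2)-3) : k) := fun g => by
    rw [show 2 * g + (n + 2) - 1 = 2 * g + n + 1 by omega, Nat.doubleFactorial_add_one,
      show 2 * g + n - 1 = 2 * g + (n + 2) - 3 by omega]
    push_cast; ring
  have hne : ∀ g : ℕ, (2 * g + n + 1 : k) ≠ 0 := fun g => by exact_mod_cast (2 * g + n).succ_ne_zero
  have hne' : ∀ m, (Nat.doubleFactorial m : k) ≠ 0 := fun m => by
    exact_mod_cast (Nat.doubleFactorial_pos m).ne'
  rw [hG, sum_range_succ', mul_add, add_comm]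
  congr 1
  · have h1 := hne g
    have h2 := hne' (2*g+(n+2)-3)
    simp only [Nat.sub_zero, pow_zero, mul_one, one_mul]
    rw [key]
    field_simp
  · cases g with
    | zero => simp
    | succ g =>
      rw [if_neg g.succ_ne_zero, Nat.add_sub_cancel, hG g, mul_sum, mul_sum]
      refine sum_congr rfl fun s _ => ?_
      have h1 := hne (g + 1)
      have h2 := hne' (2*g+(n+2)-1)
      rw [Nat.add_sub_add_right, key (g + 1),
        show 2 * (g + 1) + (n + 2) - 3 = 2 * g + (n + 2) - 1 by omega, pow_succ, pow_succ]
      field_simp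

lemma Gnpt_rec (n g : ℕ) : (2 * g + n + 1) * Gnpt (n + 2) g =
    Ppoly (n + 2) g + (if g = 0 then 0 else Dlt (n + 2) / 4 * Gnpt (n + 2) (g - 1)) :=
  doubleFactorial_sum_rec n _ (Ppoly (n + 2)) (Gnpt (n + 2))
    (fun g => by simpa using Gnpt_add_two n g) g

end Fuel

section Link

/-- The variables as rational functions. -/
def xK (n : ℕ) (i : Fin n) : K n := algebraMap (R n) (K n) (X i)

lemma algebraMap_sum_X {n : ℕ} (I : Finset (Fin n)) :
    algebraMap (R n) (K n) (∑ i ∈ I, X i) = sm (xK n) I := map_sum _ _ _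

lemma sm_xK_ne_zero {n : ℕ} {I : Finset (Fin n)} (h : I ≠ ∅) : sm (xK n) I ≠ 0 := by
  rw [← algebraMap_sum_X, Ne, IsFractionRing.to_map_eq_zero_iff]
  intro h0
  obtain ⟨i, hi⟩ := nonempty_iff_ne_empty.2 h
  have := congrArg (MvPolynomial.coeff (Finsupp.single i 1)) h0
  classical
  simp [MvPolynomial.coeff_sum, MvPolynomial.coeff_X, Finsupp.single_left_inj, hi] at this

lemma SX_eq (n : ℕ) : SX n = sm (xK n) univ := algebraMap_sum_X univ

lemma SX3_eq (n : ℕ) : SX3 n = ∑ i, xK n i ^ 3 := by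
  simp [SX3, xK]

lemma emb_xK {n : ℕ} (I : Finset (Fin n)) (i : Fin #I) :
    emb I (xK #I i) = xK n (I.orderEmbOfFin rfl i) := by
  rw [emb, xK, IsFractionRing.lift_algebraMap]
  simp [embRH, xK]

lemma sum_orderEmb {n : ℕ} {β : Type*} [AddCommMonoid β] (I : Finset (Fin n)) (f : Fin n → β) :
    ∑ i, f (I.orderEmbOfFin rfl i) = ∑ i ∈ I, f i := by
  conv_rhs => rw [← map_orderEmbOfFin_univ I rfl]
  rw [sum_map]; rfl

/-- The generating series of the normalized functions. -/
def gSer (n : ℕ) : (K n)⟦X⟧ := PowerSeries.mk (Gnpt n)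

/-- The generating series of the `n`-point functions. -/
def fSer (n : ℕ) : (K n)⟦X⟧ := PowerSeries.mk (Fnpt n)

lemma fSer_eq (n : ℕ) : fSer n = expSer (SX3 n / 24) * gSer n := by
  ext g
  rw [fSer, PowerSeries.coeff_mk, PowerSeries.coeff_mul, Nat.sum_antidiagonal_eq_sum_range_succ_mk,
    Fnpt]
  refine sum_congr rfl fun d _ => ?_
  rw [coeff_expSer, gSer, PowerSeries.coeff_mk, mul_comm ((1 / _ : K n))]
  simp

/-- The polynomial multiple of the generating series. -/
def sqSer (n : ℕ) : (K n)⟦X⟧ := PowerSeries.C (SX n ^ 2) * fSer n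

lemma psi_one : psi (xK 1) univ = sqSer 1 := by
  have hx : xK 1 0 ≠ 0 := by simpa using sm_xK_ne_zero (n := 1) (I := {0}) (by simp)
  have hS : SX 1 = xK 1 0 := by simp [SX_eq, sm]
  have h : sqSer 1 = expSer (xK 1 0 ^ 3 / 24) := by
    have hg : gSer 1 = PowerSeries.C (xK 1 0 ^ (-2 : ℤ)) := by
      ext g
      rw [gSer, PowerSeries.coeff_mk, PowerSeries.coeff_C]
      cases g <;> simp [Gnpt, Gf, xK]
    rw [sqSer, fSer_eq, hg, hS, SX3_eq, mul_left_comm, ← map_mul, ← zpow_natCast, ← zpow_add₀ hx]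
    simp
  have h1 := psi_kdv (xK 1) univ
  have hu : (univ : Finset (Fin 1)).powerset = {∅, univ} := rfl
  rw [hu, sum_pair (by simp)] at h1
  refine euler_unique (m := 0) (s := xK 1 0 ^ 3) (q := 0) ?_ ?_ fun _ => ?_
  · simpa [sm] using h1
  · have h24 : (24 : (K 1)⟦X⟧) = PowerSeries.C 24 := (map_ofNat PowerSeries.C 24).symm
    have : (24 : (K 1)⟦X⟧) * PowerSeries.C (xK 1 0 ^ 3 / 24) = PowerSeries.C (xK 1 0 ^ 3) := by
      rw [h24, ← map_mul]; congr 1; field_simp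
    rw [h, theta_expSer, ← this]
    push_cast; ring
  · rw [h, coeff_expSer, show (univ : Finset (Fin 1)) = {0} from rfl, psi_singleton_coeff]
    simp

lemma psi_eq_map_emb {n : ℕ} (I : Finset (Fin n)) :
    psi (xK n) I = PowerSeries.map (emb I) (psi (xK #I) univ) := by
  rw [← psi_map]
  simp only [emb_xK]
  have h := psi_comp (I.orderEmbOfFin rfl).toEmbedding (xK n) univ
  rw [map_orderEmbOfFin_univ] at h
  exact h.symm

lemma map_emb_sqSer {n : ℕ} (I : Finset (Fin n)) :
    PowerSeries.map (emb I) (sqSer #I) = PowerSeries.C (sm (xK n) I ^ 2) *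
      (expSer ((∑ i ∈ I, xK n i ^ 3) / 24) * PowerSeries.map (emb I) (gSer #I)) := by
  have h1 : emb I (SX #I) = sm (xK n) I := by
    rw [SX_eq, sm, map_sum]
    simp only [emb_xK]
    exact sum_orderEmb I (xK n)
  have h2 : emb I (SX3 #I) = ∑ i ∈ I, xK n i ^ 3 := by
    rw [SX3_eq, map_sum]
    simp only [map_pow, emb_xK]
    exact sum_orderEmb I fun i => xK n i ^ 3
  rw [sqSer, fSer_eq, map_mul, map_mul, PowerSeries.map_C, map_expSer, map_pow, h1, map_div₀, h2,
    map_ofNat]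

lemma gSer_rec (n : ℕ) : 24 * theta (K (n + 2)) (gSer (n + 2)) + 12 * ((n + 1 : ℕ) : (K (n + 2))⟦X⟧) * gSer (n + 2) =
    PowerSeries.X * PowerSeries.C (SX (n + 2) ^ 3 - SX3 (n + 2)) * gSer (n + 2) +
      12 * PowerSeries.mk (Ppoly (n + 2)) := by
  ext g
  have h24 : (24 : (K (n + 2))⟦X⟧) = PowerSeries.C 24 := (map_ofNat PowerSeries.C 24).symm
  have h12 : (12 : (K (n + 2))⟦X⟧) = PowerSeries.C 12 := (map_ofNat PowerSeries.C 12).symm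
  have hn : ((n + 1 : ℕ) : (K (n + 2))⟦X⟧) = PowerSeries.C ((n + 1 : ℕ) : K (n + 2)) :=
    (map_natCast PowerSeries.C _).symm
  have h := Gnpt_rec n g
  rw [h24, h12, hn, mul_assoc, mul_assoc]
  simp only [map_add, PowerSeries.coeff_C_mul, coeff_theta, gSer, PowerSeries.coeff_mk]
  rcases g with _ | g
  · simp at h ⊢
    linear_combination h
  · rw [PowerSeries.coeff_succ_X_mul]
    simp only [PowerSeries.coeff_C_mul, PowerSeries.coeff_mk]
    rw [if_neg g.succ_ne_zero, Nat.add_sub_cancel, Dlt] at h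
    push_cast at h ⊢
    linear_combination 12 * h

lemma Ppoly_ser (n : ℕ) (ih : ∀ k < n, psi (xK k) univ = sqSer k) :
    PowerSeries.C (SX n ^ 2) * (12 * (expSer (SX3 n / 24) * PowerSeries.mk (Ppoly n))) =
      6 * PowerSeries.C (sm (xK n) univ) *
        ∑ J ∈ univ.powerset, psi (xK n) J * psi (xK n) (univ \ J) := by
  rcases Nat.eq_zero_or_pos n with rfl | hn
  · simp [SX]
  have hS : SX n ≠ 0 := by
    rw [SX_eq]
    exact sm_xK_ne_zero (univ_nonempty_iff.2 ⟨⟨0, hn⟩⟩).ne_empty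
  have h1 : PowerSeries.C (2 * SX n) * PowerSeries.mk (Ppoly n) = ∑ I : Finset (Fin n),
      if I ≠ ∅ ∧ I ≠ univ then PowerSeries.C (sm (xK n) I ^ 2) * PowerSeries.C (sm (xK n) Iᶜ ^ 2) *
        (PowerSeries.map (emb I) (gSer #I) * PowerSeries.map (emb Iᶜ) (gSer #Iᶜ)) else 0 := by
    ext g
    rw [PowerSeries.coeff_C_mul, PowerSeries.coeff_mk, Ppoly, mul_inv_cancel_left₀ (by simpa using hS),
      map_sum]
    refine sum_congr rfl fun I _ => ?_
    split_ifs with hI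
    · rw [← map_mul, PowerSeries.coeff_C_mul, PowerSeries.coeff_mul,
        Nat.sum_antidiagonal_eq_sum_range_succ_mk, algebraMap_sum_X, algebraMap_sum_X]
      simp [gSer]
    · simp
  have h2 : expSer (SX3 n / 24) * (PowerSeries.C (2 * SX n) * PowerSeries.mk (Ppoly n)) =
      ∑ J ∈ univ.powerset, psi (xK n) J * psi (xK n) (univ \ J) := by
    rw [h1, mul_sum, powerset_univ]
    refine sum_congr rfl fun I _ => ?_
    rw [← compl_eq_univ_sdiff]
    split_ifs with hI
    · rw [psi_eq_map_emb I, psi_eq_map_emb Iᶜ, ih _ (card_lt_of_ne_univ hI.2),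
        ih _ (card_lt_of_ne_univ (by simpa using hI.1)), map_emb_sqSer, map_emb_sqSer, SX3_eq,
        ← sum_add_sum_compl I, add_div, expSer_add]
      ring
    · rw [not_and_or, not_not, not_not] at hI
      rcases hI with rfl | rfl <;> simp
  rw [← h2, ← SX_eq, pow_two, map_mul, map_mul, map_ofNat]
  ring

theorem psi_xK (n : ℕ) : psi (xK n) univ = sqSer n := by
  induction n using Nat.strong_induction_on with
  | _ n ih =>
  rcases n with _ | _ | n
  · simp [sqSer, SX]
  · exact psi_one
  · have h1 := psi_kdv (xK (n + 2)) univ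
    refine euler_unique (m := n + 1) (s := sm (xK (n + 2)) univ ^ 3)
      (q := 6 * PowerSeries.C (sm (xK (n + 2)) univ) *
        ∑ J ∈ univ.powerset, psi (xK (n + 2)) J * psi (xK (n + 2)) (univ \ J)) ?_ ?_ (by omega)
    · rw [← h1, card_univ, Fintype.card_fin]
      push_cast; ring
    · rw [← Ppoly_ser _ ih, sqSer, fSer_eq, theta_C_mul, theta_mul, theta_expSer]
      have h := gSer_rec n
      have h24 : (24 : (K (n + 2))⟦X⟧) = PowerSeries.C 24 := (map_ofNat PowerSeries.C 24).symm
      have hS : (24 : (K (n + 2))⟦X⟧) * PowerSeries.C (SX3 (n + 2) / 24) =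
          PowerSeries.C (SX3 (n + 2)) := by
        rw [h24, ← map_mul]; congr 1; field_simp
      rw [map_sub] at h
      rw [← SX_eq]
      linear_combination PowerSeries.C (SX (n + 2) ^ 2) * expSer (SX3 (n + 2) / 24) * h +
        PowerSeries.C (SX (n + 2) ^ 2) * PowerSeries.X * expSer (SX3 (n + 2) / 24) *
          gSer (n + 2) * hS

end Link

section Conv

variable {κ : Type*} [DecidableEq κ] {A : Type*} [CommRing A] [Algebra ℚ A]

/-- The self-convolution of the generating series. -/
def psiSq (c : κ → A) (I : Finset κ) : A⟦X⟧ := ∑ J ∈ I.powerset, psi c J * psi c (I \ J)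

lemma sum_sm_pow_psi_psi {c : κ → A} {U : Finset κ} (h : sm c U = 0) :
    ∑ J ∈ U.powerset, PowerSeries.C (sm c J ^ 3) * psi c J * psi c (U \ J) = 0 := by
  have h1 : ∑ J ∈ U.powerset, PowerSeries.C (sm c J ^ 3) * psi c J * psi c (U \ J) =
      -∑ J ∈ U.powerset, PowerSeries.C (sm c J ^ 3) * psi c J * psi c (U \ J) := by
    refine (sum_powerset_sdiff U fun J K => PowerSeries.C (sm c J ^ 3) * psi c J * psi c K).trans ?_
    rw [← sum_neg_distrib]
    refine sum_congr rfl fun J hJ => ?_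
    rw [mem_powerset] at hJ
    have : sm c (U \ J) = -sm c J := by linear_combination sm_sdiff c hJ + h
    rw [this, Odd.neg_pow (by decide), map_neg]
    ring
  refine natCast_mul_cancel (k := 2) two_ne_zero ?_
  push_cast
  linear_combination h1

lemma sum_sm_psiSq_psi {c : κ → A} {U : Finset κ} (h : sm c U = 0) :
    ∑ J ∈ U.powerset, PowerSeries.C (sm c J) * psiSq c J * psi c (U \ J) = 0 := by
  set T := ∑ J ∈ U.powerset, PowerSeries.C (sm c J) * psiSq c J * psi c (U \ J) with hT
  set T' := ∑ J ∈ U.powerset, psiSq c J * (PowerSeries.C (sm c (U \ J)) * psi c (U \ J)) with hT'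
  have h1 : T + T' = 0 := by
    rw [hT, hT', ← sum_add_distrib]
    refine sum_eq_zero fun J hJ => ?_
    have hs := congrArg (PowerSeries.C (R := A)) ((sm_sdiff c (mem_powerset.1 hJ)).trans h)
    rw [map_add, map_zero] at hs
    linear_combination psiSq c J * psi c (U \ J) * hs
  have h2 : T = 2 * T' := by
    have e1 : ∀ J, PowerSeries.C (sm c J) * psiSq c J =
        2 * ∑ L ∈ J.powerset, PowerSeries.C (sm c L) * psi c L * psi c (J \ L) := fun J => by
      have e2 := sum_powerset_sdiff J fun L M => PowerSeries.C (sm c L) * psi c L * psi c M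
      rw [two_mul]
      nth_rw 2 [e2]
      rw [psiSq, mul_sum, ← sum_add_distrib]
      refine sum_congr rfl fun L hL => ?_
      rw [← sm_sdiff c (mem_powerset.1 hL), map_add]
      ring
    have e3 := sum_powerset_powerset U fun L M N =>
      PowerSeries.C (sm c L) * psi c L * psi c M * psi c N
    have e4 := sum_powerset_sdiff U fun L M => PowerSeries.C (sm c L) * psi c L * psiSq c M
    rw [hT, hT']
    simp only [e1, mul_assoc (2 : A⟦X⟧)]
    rw [← mul_sum]
    simp only [sum_mul]
    rw [e3]
    simp only [mul_assoc, ← mul_sum] at e4 ⊢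
    congr 1
    refine e4.trans (sum_congr rfl fun L _ => ?_)
    ring
  refine natCast_mul_cancel (k := 3) three_ne_zero ?_
  push_cast
  linear_combination 2 * h1 + h2

lemma psiSq_eq_zero {c : κ → A} {U : Finset κ} (h : sm c U = 0) {g : ℕ} (hg : 2 * g + #U ≠ 2) :
    PowerSeries.coeff g (psiSq c U) = 0 := by
  have hθ : theta A (psiSq c U) = 2 * ∑ J ∈ U.powerset, theta A (psi c J) * psi c (U \ J) := by
    have e := sum_powerset_sdiff U fun J K => theta A (psi c J) * psi c K
    rw [two_mul]
    nth_rw 2 [e]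
    rw [psiSq, map_sum, ← sum_add_distrib]
    refine sum_congr rfl fun J _ => ?_
    rw [theta_mul]
    ring
  have hc : 2 * ∑ J ∈ U.powerset, ((#J : A⟦X⟧) - 1) * psi c J * psi c (U \ J) =
      ((#U : A⟦X⟧) - 2) * psiSq c U := by
    have e := sum_powerset_sdiff U fun J K => ((#J : A⟦X⟧) - 1) * psi c J * psi c K
    rw [two_mul]
    nth_rw 2 [e]
    rw [psiSq, mul_sum, ← sum_add_distrib]
    refine sum_congr rfl fun J hJ => ?_
    rw [← card_sdiff_add_card_eq_card (mem_powerset.1 hJ)]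
    push_cast
    ring
  have hk : 24 * theta A (psiSq c U) + 12 * (((#U : A⟦X⟧) - 2) * psiSq c U) = 0 := by
    rw [hθ, ← hc]
    have : ∑ J ∈ U.powerset, 24 * theta A (psi c J) * psi c (U \ J) =
        ∑ J ∈ U.powerset, (PowerSeries.X * (PowerSeries.C (sm c J ^ 3) * psi c J * psi c (U \ J)) +
          6 * (PowerSeries.C (sm c J) * psiSq c J * psi c (U \ J)) -
          12 * (((#J : A⟦X⟧) - 1) * psi c J * psi c (U \ J))) := by
      refine sum_congr rfl fun J _ => ?_
      have := psi_kdv c J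
      rw [psiSq]
      linear_combination psi c (U \ J) * this
    rw [sum_sub_distrib, sum_add_distrib, ← mul_sum, ← mul_sum, ← mul_sum, sum_sm_pow_psi_psi h,
      sum_sm_psiSq_psi h] at this
    simp only [mul_assoc, ← mul_sum] at this ⊢
    linear_combination 2 * this
  have hcoef := congrArg (PowerSeries.coeff g) hk
  have e24 : (24 : A⟦X⟧) = PowerSeries.C (24 : A) := (map_ofNat PowerSeries.C 24).symm
  have e12 : (12 * (((#U : A⟦X⟧) - 2) * psiSq c U)) = PowerSeries.C (12 * ((#U : A) - 2)) * psiSq c U := by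
    rw [map_mul, map_sub, map_natCast, map_ofNat, map_ofNat, mul_assoc]
  rw [e24, e12, map_add, PowerSeries.coeff_C_mul, PowerSeries.coeff_C_mul, coeff_theta, map_zero] at hcoef
  rcases lt_or_gt_of_ne hg with hlt | hgt
  · obtain ⟨k, hk⟩ := Nat.exists_eq_add_of_lt hlt
    have hk' : (2 : A) = 2 * g + #U + k + 1 := by exact_mod_cast congrArg (Nat.cast (R := A)) hk
    refine natCast_mul_cancel (k := 12 * (k + 1)) (by omega) ?_
    push_cast
    linear_combination -hcoef - 12 * PowerSeries.coeff g (psiSq c U) * hk'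
  · obtain ⟨k, hk⟩ := Nat.exists_eq_add_of_lt hgt
    have hk' : (2 * g + #U : A) = 2 + k + 1 := by exact_mod_cast congrArg (Nat.cast (R := A)) hk
    refine natCast_mul_cancel (k := 12 * (k + 1)) (by omega) ?_
    push_cast
    linear_combination hcoef - 12 * PowerSeries.coeff g (psiSq c U) * hk' 

lemma psiSq_map {B : Type*} [CommRing B] [Algebra ℚ B] (φ : A →+* B) (c : κ → A) (I : Finset κ) :
    psiSq (fun i => φ (c i)) I = PowerSeries.map φ (psiSq c I) := by
  simp only [psiSq, psi_map, map_sum, map_mul]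

lemma sm_dvd_coeff_psiSq (c : κ → A) {U : Finset κ} {g : ℕ} (hg : 2 * g + #U ≠ 2) :
    sm c U ∣ PowerSeries.coeff g (psiSq c U) := by
  rw [← Ideal.mem_span_singleton, ← Ideal.Quotient.eq_zero_iff_mem]
  set φ := Ideal.Quotient.mk (Ideal.span {sm c U})
  rw [← PowerSeries.coeff_map, ← psiSq_map]
  refine psiSq_eq_zero ?_ hg
  change ∑ i ∈ U, φ (c i) = 0
  rw [← map_sum]
  exact Ideal.Quotient.eq_zero_iff_mem.2 (Ideal.mem_span_singleton_self _)

lemma sm_sq_dvd_coeff_psi (c : κ → A) {U : Finset κ} (hU : U ≠ ∅) {g : ℕ} (hg : 2 * g + #U ≠ 2)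
    (hg' : 2 * g + #U ≠ 1) : sm c U ^ 2 ∣ PowerSeries.coeff g (psi c U) := by
  have hc : 0 < #U := card_pos.2 (nonempty_iff_ne_empty.2 hU)
  rw [← Ideal.mem_span_singleton]
  refine mem_of_natCast_mul_mem (P := (Ideal.span {sm c U ^ 2}).restrictScalars ℚ)
    (k := 12 * (2 * g + #U - 1)) (by omega) ?_
  rw [Submodule.restrictScalars_mem, Ideal.mem_span_singleton]
  have h := congrArg (PowerSeries.coeff g) (psi_kdv c U)
  have e24 : (24 : A⟦X⟧) = PowerSeries.C (24 : A) := (map_ofNat PowerSeries.C 24).symm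
  have e12 : (12 * ((#U : A⟦X⟧) - 1)) = PowerSeries.C (12 * ((#U : A) - 1)) := by
    rw [map_mul, map_sub, map_natCast, map_one, map_ofNat]
  have e6 : 6 * PowerSeries.C (sm c U) = PowerSeries.C (6 * sm c U) := by
    rw [map_mul, map_ofNat]
  change _ = PowerSeries.coeff g (_ + 6 * PowerSeries.C (sm c U) * psiSq c U) at h
  rw [e24, e12, e6, mul_assoc PowerSeries.X, map_add, map_add] at h
  simp only [PowerSeries.coeff_C_mul, coeff_theta] at h
  have e : ((12 * (2 * g + #U - 1) : ℕ) : A) = 24 * g + 12 * ((#U : A) - 1) := by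
    rw [show 12 * (2 * g + #U - 1) = 24 * g + 12 * (#U - 1) by omega]
    push_cast [Nat.cast_sub hc]; ring
  have e' : ((12 * (2 * g + #U - 1) : ℕ) : A) * PowerSeries.coeff g (psi c U) =
      PowerSeries.coeff g (PowerSeries.X * (PowerSeries.C (sm c U ^ 3) * psi c U)) +
        6 * sm c U * PowerSeries.coeff g (psiSq c U) := by
    rw [e]; linear_combination h
  rw [e']
  refine dvd_add ?_ ?_
  · cases g with
    | zero => simp
    | succ g =>
      rw [PowerSeries.coeff_succ_X_mul, PowerSeries.coeff_C_mul]
      exact Dvd.intro (sm c U * PowerSeries.coeff g (psi c U)) (by ring)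
  · obtain ⟨k, hk⟩ := sm_dvd_coeff_psiSq c hg
    rw [hk]
    exact Dvd.intro (6 * k) (by ring)

end Conv

section Polynomial

lemma algebraMap_polyOf {n : ℕ} {f : K n} (h : ∃ p : R n, algebraMap (R n) (K n) p = f) :
    algebraMap (R n) (K n) (polyOf f) = f := by
  rw [polyOf, dif_pos h]; exact h.choose_spec

/-- The polynomial `n`-point functions in terms of the universal generating series. -/
theorem sq_mul_polyOf {n g : ℕ} (hn : n ≠ 0) (h1 : 2 * g + n ≠ 1) (h2 : 2 * g + n ≠ 2) :
    sm (X : Fin n → R n) univ ^ 2 * polyOf (Fnpt n g) =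
      PowerSeries.coeff g (psi (X : Fin n → R n) univ) := by
  have hu : (univ : Finset (Fin n)) ≠ ∅ := (univ_nonempty_iff.2 ⟨⟨0, Nat.pos_of_ne_zero hn⟩⟩).ne_empty
  have hm : algebraMap (R n) (K n) (PowerSeries.coeff g (psi (X : Fin n → R n) univ)) =
      SX n ^ 2 * Fnpt n g := by
    rw [← PowerSeries.coeff_map, ← psi_map]
    change PowerSeries.coeff g (psi (xK n) univ) = _
    rw [psi_xK, sqSer, PowerSeries.coeff_C_mul, fSer, PowerSeries.coeff_mk]
  have hS : SX n ≠ 0 := by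
    rw [SX_eq]; exact sm_xK_ne_zero hu
  have hSX : algebraMap (R n) (K n) (sm (X : Fin n → R n) univ) = SX n := rfl
  obtain ⟨p, hp⟩ := sm_sq_dvd_coeff_psi (X : Fin n → R n) hu (g := g) (by simpa using h2)
    (by simpa using h1)
  have hex : ∃ p : R n, algebraMap (R n) (K n) p = Fnpt n g := by
    refine ⟨p, mul_left_cancel₀ (pow_ne_zero 2 hS) ?_⟩
    rw [← hm, hp, map_mul, map_pow, hSX]
  refine IsFractionRing.injective (R n) (K n) ?_
  rw [map_mul, map_pow, algebraMap_polyOf hex, hm, hSX]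

end Polynomial

section Expansion

variable {N : ℕ}

/-- The arguments `±y, x_1, …, x_N` as Laurent series. -/
def cLau (N : ℕ) (σ : Bool) : Option (Fin N) → Lau N
  | none => yLau N σ
  | some i => HahnSeries.C (X i)

lemma binomZ_neg_one (k : ℕ) : binomZ (-1) k = (-1) ^ k := by
  have h : ∏ i ∈ range k, (((-1 : ℤ) : ℚ) - i) = (-1) ^ k * k.factorial := by
    induction k with
    | zero => simp
    | succ k ih => rw [prod_range_succ, ih, Nat.factorial_succ]; push_cast; ring
  rw [binomZ, h]
  field_simp

lemma yExpAdd_neg_one (c : R N) :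
    yExpAdd c (-1) * (HahnSeries.single (-1 : ℤ) (1 : R N) + HahnSeries.C c) = 1 := by
  have h1 : (HahnSeries.single (1 : ℤ) (1 : R N) : Lau N) *
      (HahnSeries.single (-1 : ℤ) (1 : R N) + HahnSeries.C c) =
      HahnSeries.ofPowerSeries ℤ (R N) (1 + PowerSeries.X * PowerSeries.C c) := by
    rw [map_add, map_mul, HahnSeries.ofPowerSeries_X, HahnSeries.ofPowerSeries_C,
      (HahnSeries.ofPowerSeries ℤ (R N)).map_one, mul_add, HahnSeries.single_mul_single]
    simp
  have h2 : (PowerSeries.mk fun k => MvPolynomial.C (binomZ (-1) k) * c ^ k) *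
      (1 + PowerSeries.X * PowerSeries.C c) = 1 := by
    ext1 k
    rw [mul_add, mul_one, map_add, mul_left_comm]
    cases k with
    | zero => simp [binomZ_neg_one]
    | succ k =>
      rw [PowerSeries.coeff_succ_X_mul, PowerSeries.coeff_mul_C, PowerSeries.coeff_mk,
        PowerSeries.coeff_mk, binomZ_neg_one, binomZ_neg_one, PowerSeries.coeff_one,
        if_neg k.succ_ne_zero, pow_succ, pow_succ]
      simp
      ring
  rw [yExpAdd, neg_neg, mul_comm (HahnSeries.single _ _), mul_assoc, h1, ← map_mul, h2,
    (HahnSeries.ofPowerSeries ℤ (R N)).map_one]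

lemma LExp_neg_one (σ : Bool) (c : R N) : LExp σ c (-1) * (yLau N σ + HahnSeries.C c) = 1 := by
  have h : ¬ Even (-1 : ℤ) := by decide
  cases σ
  · have := yExpAdd_neg_one (-1 * c)
    rw [LExp, yLau]
    simp only [h, if_false, Bool.false_eq_true]
    rw [map_mul, map_neg, (HahnSeries.C : R N →+* Lau N).map_one] at this
    linear_combination this
  · have := yExpAdd_neg_one c
    simpa [LExp, yLau] using this

lemma coeff_zero_psi_pair {κ A : Type*} [DecidableEq κ] [CommRing A] [Algebra ℚ A] (c : κ → A)
    {i j : κ} (h : i ≠ j) : PowerSeries.coeff 0 (psi c {i, j}) = c i + c j := by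
  have h1 := congrArg (PowerSeries.coeff 0) (psi_kdv c {i, j})
  have hij : ({i, j} : Finset κ) \ {i} = {j} := by ext k; simp; grind
  have hji : ({i, j} : Finset κ) \ {j} = {i} := by ext k; simp; grind
  have hs : ∑ J ∈ ({i, j} : Finset κ).powerset, psi c J * psi c ({i, j} \ J) =
      2 * (psi c {i} * psi c {j}) := by
    rw [sum_powerset_insert (by simpa using h), show ({j} : Finset κ).powerset = {∅, {j}} from rfl, sum_pair (by simp),
      sum_pair (by simp)]
    simp [psi_empty, hij, hji]
    ring
  have h0 : PowerSeries.constantCoeff (theta A (psi c {i, j})) = 0 := by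
    rw [← PowerSeries.coeff_zero_eq_constantCoeff_apply, coeff_theta]; simp
  have hsm : sm c {i, j} = c i + c j := by rw [sm, sum_pair h]
  have hi := psi_singleton_coeff c i
  have hj := psi_singleton_coeff c j
  rw [hs, card_pair h, hsm] at h1
  simp only [PowerSeries.coeff_zero_eq_constantCoeff_apply, map_add, map_sub, map_mul, h0, map_one,
    map_ofNat, PowerSeries.constantCoeff_X, PowerSeries.constantCoeff_C, map_natCast] at h1 hi hj ⊢
  rw [hi, hj] at h1
  refine natCast_mul_cancel (k := 12) (by norm_num) ?_
  push_cast at h1 ⊢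
  linear_combination h1

lemma sm_cLau (σ : Bool) (I : Finset (Fin N)) :
    sm (cLau N σ) (insertNone I) = yLau N σ + HahnSeries.C (∑ i ∈ I, X i) := by
  rw [insertNone_eq_insert, sm_insert _ (by simp)]
  simp [sm, cLau]

theorem FExp_mul_sq (σ : Bool) (g : ℕ) (I : Finset (Fin N)) :
    FExp σ g I * sm (cLau N σ) (insertNone I) ^ 2 =
      PowerSeries.coeff g (psi (cLau N σ) (insertNone I)) := by
  by_cases h0 : g = 0 ∧ #I = 0
  · obtain ⟨rfl, hI⟩ := h0
    obtain rfl := card_eq_zero.1 hI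
    have : (insertNone (∅ : Finset (Fin N))) = {none} := by simp [insertNone_eq_insert]
    rw [this, psi_singleton_coeff, FExp, if_pos (by simp)]
    have e : (HahnSeries.single (-1 : ℤ) (1 : R N) : Lau N) * HahnSeries.single (-1) 1 =
        HahnSeries.single (-2) 1 := by simp [HahnSeries.single_mul_single]
    have e' : (HahnSeries.single (2 : ℤ) (1 : R N) : Lau N) * HahnSeries.single (-2) 1 = 1 := by
      simp [HahnSeries.single_mul_single]
    have hs : sm (cLau N σ) {none} = yLau N σ := by simp [sm, cLau]
    rw [hs, ← e', ← e, yLau]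
    cases σ <;> simp only [if_true, if_false, Bool.false_eq_true] <;> ring
  by_cases h1 : g = 0 ∧ #I = 1
  · rw [FExp, if_neg h0, if_pos h1]
    obtain ⟨rfl, hI⟩ := h1
    obtain ⟨i, rfl⟩ := card_eq_one.1 hI
    have h2 : (insertNone ({i} : Finset (Fin N))) = {none, some i} := by simp [insertNone_eq_insert]
    have h3 := coeff_zero_psi_pair (cLau N σ) (i := none) (j := some i) (by simp)
    have h4 := LExp_neg_one σ (X i : R N)
    rw [pow_two, ← mul_assoc, sm_cLau, sum_singleton, h4, one_mul, h2, h3]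
    rfl
  · rw [FExp, if_neg h0, if_neg h1]
    set v : Fin (#I + 1) → Lau N := Fin.cons (yLau N σ)
      (fun i : Fin #I => HahnSeries.C (X ((I.orderIsoOfFin rfl) i : Fin N))) with hv
    set φ := MvPolynomial.eval₂Hom ((HahnSeries.C (Γ := ℤ)).comp (algebraMap ℚ (R N))) v
    change φ _ * _ = _
    let f : Fin (#I + 1) ↪ Option (Fin N) := ⟨Fin.cons none fun i => some (I.orderEmbOfFin rfl i), by
      refine Fin.cons_injective_iff.2 ⟨by simp, fun i j h => ?_⟩
      simpa using h⟩
    have hf : univ.map f = insertNone I := by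
      ext o
      rw [mem_map]
      simp only [mem_univ, true_and, f, Function.Embedding.coeFn_mk]
      rw [Fin.exists_fin_succ]
      have hr : ∀ i, (∃ j, I.orderEmbOfFin rfl j = i) ↔ i ∈ I := fun i => by
        rw [← mem_coe, ← range_orderEmbOfFin I rfl]; rfl
      cases o <;> simp [hr]
    have hφ : ∀ j, φ (X j) = cLau N σ (f j) := by
      intro j
      refine Fin.cases ?_ (fun i => ?_) j <;> simp [φ, f, hv, cLau]
    have hs : φ (sm X univ) = sm (cLau N σ) (insertNone I) := by
      rw [sm, map_sum, ← hf, sm, sum_map]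
      exact sum_congr rfl fun j _ => hφ j
    rw [← hs, ← map_pow, ← map_mul, mul_comm, sq_mul_polyOf (by omega) (by omega) (by omega),
      ← PowerSeries.coeff_map, ← psi_map, ← hf, ← psi_comp]
    simp only [hφ]

end Expansion

section Scaling

variable {N : ℕ}

lemma single_neg_one_pow (k : ℕ) :
    (HahnSeries.single (-1 : ℤ) (1 : R N) : Lau N) ^ k = HahnSeries.single (-(k : ℤ)) 1 := by
  rw [HahnSeries.single_pow]; simp

lemma cLau_eq (σ : Bool) (o : Option (Fin N)) :
    cLau N σ o = HahnSeries.single (-1 : ℤ) (1 : R N) *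
      HahnSeries.ofPowerSeries ℤ (R N) (withMark xx (if σ then 1 else -1) o) := by
  cases o with
  | none => cases σ <;> simp [cLau, yLau, withMark, mul_comm]
  | some i =>
    rw [cLau, withMark, Option.elim_some, xx, map_mul, HahnSeries.ofPowerSeries_X,
      HahnSeries.ofPowerSeries_C, ← mul_assoc, HahnSeries.single_mul_single]
    simp

theorem FExp_eq (σ : Bool) (g : ℕ) (I : Finset (Fin N)) (u : (T (Fin N))ˣ)
    (hu : (u : T (Fin N)) = (if σ then 1 else -1) + sm xx I) :
    FExp σ g I = HahnSeries.single (2 - 3 * g - #I : ℤ) (1 : R N) *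
      HahnSeries.ofPowerSeries ℤ (R N) (↑(u ^ (-2 : ℤ)) *
        PowerSeries.coeff g (psiMark xx (if σ then 1 else -1) I)) := by
  set y : Lau N := HahnSeries.single (-1 : ℤ) (1 : R N) with hy
  set φ := HahnSeries.ofPowerSeries ℤ (R N) with hφ
  set ε : T (Fin N) := if σ then 1 else -1 with hε
  have hc : cLau N σ = fun o => y * φ (withMark xx ε o) := funext (cLau_eq σ)
  have hs : sm (cLau N σ) (insertNone I) = y * φ u := by
    rw [hc, sm, ← mul_sum, ← map_sum, hu, ← sm, insertNone_eq_insert, sm_insert _ (by simp)]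
    simp [sm, withMark]
  have hψ : PowerSeries.coeff g (psi (cLau N σ) (insertNone I)) =
      y ^ (3 * g + #I) * φ (PowerSeries.coeff g (psiMark xx ε I)) := by
    rw [hc, psi_smul, psi_map, PowerSeries.coeff_map, card_insertNone, Nat.add_sub_cancel]
    rfl
  have h := FExp_mul_sq σ g I
  rw [hs, hψ] at h
  have hy1 : y * HahnSeries.single (1 : ℤ) (1 : R N) = 1 := by
    rw [hy, HahnSeries.single_mul_single]; simp
  have hu1 : φ u * φ ↑u⁻¹ = 1 := by rw [← map_mul, Units.mul_inv, φ.map_one]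
  have hu2 : ((u ^ (-2 : ℤ) : (T (Fin N))ˣ) : T (Fin N)) = ↑u⁻¹ * ↑u⁻¹ := by
    rw [zpow_neg, ← inv_zpow]; simp [pow_two]
  have hs2 : (HahnSeries.single (2 - 3 * g - #I : ℤ) (1 : R N) : Lau N) =
      y ^ (3 * g + #I) * (HahnSeries.single (1 : ℤ) (1 : R N) * HahnSeries.single (1 : ℤ) (1 : R N)) := by
    rw [single_neg_one_pow, HahnSeries.single_mul_single, HahnSeries.single_mul_single, mul_one,
      mul_one, show (2 - 3 * g - #I : ℤ) = -((3 * g + #I : ℕ) : ℤ) + (1 + 1) by push_cast; ring]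
  rw [hs2, map_mul, hu2, map_mul]
  calc FExp σ g I = FExp σ g I * (y * HahnSeries.single (1 : ℤ) (1 : R N)) ^ 2 *
        (φ u * φ ↑u⁻¹) ^ 2 := by rw [hy1, hu1]; simp
    _ = (FExp σ g I * (y * φ u) ^ 2) * (HahnSeries.single (1 : ℤ) (1 : R N) *
        HahnSeries.single (1 : ℤ) (1 : R N)) * (φ ↑u⁻¹ * φ ↑u⁻¹) := by ring
    _ = _ := by rw [h]; ring

lemma FExp_true (g : ℕ) (kd : Fin N → Option Bool) (I : Finset (Fin N)) :
    FExp true g I = HahnSeries.single (2 - 3 * g - #I : ℤ) (1 : R N) *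
      HahnSeries.ofPowerSeries ℤ (R N) (↑((args kd).α I ^ (-2 : ℤ)) *
        PowerSeries.coeff g (psiMark (args kd).c 1 I)) :=
  FExp_eq true g I _ (by rw [if_pos rfl]; exact (args kd).hα I)

lemma FExp_false (g : ℕ) (kd : Fin N → Option Bool) (I : Finset (Fin N)) :
    FExp false g I = HahnSeries.single (2 - 3 * g - #I : ℤ) (1 : R N) *
      HahnSeries.ofPowerSeries ℤ (R N) (↑((args kd).β I ^ (-2 : ℤ)) *
        PowerSeries.coeff g (psiMark (args kd).c (-1) I)) :=
  FExp_eq false g I _ (by rw [if_neg (by simp)]; exact (args kd).hβ I)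

/-- The product of expansions of two `n`-point functions. -/
lemma FExp_mul_FExp (g h : ℕ) (kd : Fin N → Option Bool) (I J : Finset (Fin N)) :
    FExp true g I * FExp false h J =
      HahnSeries.single (4 - 3 * (g + h) - (#I + #J) : ℤ) (1 : R N) *
        HahnSeries.ofPowerSeries ℤ (R N)
          (↑((args kd).α I ^ (-2 : ℤ)) * ↑((args kd).β J ^ (-2 : ℤ)) *
            (PowerSeries.coeff g (psiMark (args kd).c 1 I) *
              PowerSeries.coeff h (psiMark (args kd).c (-1) J))) := by
  rw [FExp_true g kd, FExp_false h kd, mul_mul_mul_comm, HahnSeries.single_mul_single, ← map_mul,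
    mul_mul_mul_comm, mul_one, show (2 - 3 * g - #I + (2 - 3 * h - #J) : ℤ) =
      4 - 3 * (g + h) - (#I + #J) by ring]

end Scaling

section Splitting

variable (a b n : ℕ)

lemma xIdx_injective : Function.Injective (xIdx a b n) := fun i j h => by
  simpa [xIdx, Fin.ext_iff] using h

/-- The arguments of the first factor. -/
def leftArgs (I : Finset (Fin n)) : Finset (Fin (a + b + n)) :=
  univ.image (zIdx a b n) ∪ I.image (xIdx a b n)

/-- The arguments of the second factor. -/
def rightArgs (I : Finset (Fin n)) : Finset (Fin (a + b + n)) :=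
  univ.image (wIdx a b n) ∪ I.image (xIdx a b n)

variable {a b n}

lemma forall_three {p : Fin (a + b + n) → Prop} (hz : ∀ i, p (zIdx a b n i))
    (hw : ∀ i, p (wIdx a b n i)) (hx : ∀ i, p (xIdx a b n i)) (v) : p v := by
  by_cases h : v.1 < a
  · exact hz ⟨v, h⟩
  by_cases h' : v.1 < a + b
  · convert hw ⟨v.1 - a, by omega⟩
    ext
    exact (Nat.add_sub_of_le (not_lt.1 h)).symm
  · convert hx ⟨v.1 - (a + b), by omega⟩
    ext
    exact (Nat.add_sub_of_le (not_lt.1 h')).symm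

lemma mem_leftArgs_z (I : Finset (Fin n)) (i) : zIdx a b n i ∈ leftArgs a b n I := by
  simp [leftArgs]

lemma mem_leftArgs_w (I : Finset (Fin n)) (i) : wIdx a b n i ∉ leftArgs a b n I := by
  simp only [leftArgs, mem_union, mem_image, zIdx, wIdx, xIdx, Fin.ext_iff]
  rintro (⟨j, -, h⟩ | ⟨j, -, h⟩) <;> omega

lemma mem_leftArgs_x (I : Finset (Fin n)) (i) : xIdx a b n i ∈ leftArgs a b n I ↔ i ∈ I := by
  rw [leftArgs, mem_union, (xIdx_injective a b n).mem_finset_image, or_iff_right]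
  simp only [mem_image, zIdx, xIdx, Fin.ext_iff]
  rintro ⟨j, -, h⟩; omega

lemma mem_rightArgs_z (I : Finset (Fin n)) (i) : zIdx a b n i ∉ rightArgs a b n I := by
  simp only [rightArgs, mem_union, mem_image, zIdx, wIdx, xIdx, Fin.ext_iff]
  rintro (⟨j, -, h⟩ | ⟨j, -, h⟩) <;> omega

lemma mem_rightArgs_w (I : Finset (Fin n)) (i) : wIdx a b n i ∈ rightArgs a b n I := by
  simp [rightArgs]

lemma mem_rightArgs_x (I : Finset (Fin n)) (i) : xIdx a b n i ∈ rightArgs a b n I ↔ i ∈ I := by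
  rw [rightArgs, mem_union, (xIdx_injective a b n).mem_finset_image, or_iff_right]
  simp only [mem_image, wIdx, xIdx, Fin.ext_iff]
  rintro ⟨j, -, h⟩; omega

lemma univ_sdiff_leftArgs (I : Finset (Fin n)) :
    univ \ leftArgs a b n I = rightArgs a b n Iᶜ := by
  ext v
  revert v
  refine forall_three (fun i => ?_) (fun i => ?_) (fun i => ?_) <;>
    simp [mem_leftArgs_z, mem_leftArgs_w, mem_leftArgs_x, mem_rightArgs_z, mem_rightArgs_w,
      mem_rightArgs_x]

/-- Splittings compatible with the kinds of the arguments. -/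
lemma sum_splittings {B : Type*} [CommRing B] (f : Finset (Fin (a + b + n)) → B)
    (D : Args (Fin (a + b + n)) B) (hD : ∀ v, D.l v = if kdm a b n v = some false then 0 else 1)
    (hD' : ∀ v, D.r v = if kdm a b n v = some true then 0 else 1) :
    ∑ U, ((∏ v ∈ U, D.l v) * ∏ v ∈ univ \ U, D.r v) * f U = ∑ I, f (leftArgs a b n I) := by
  have hinj : Function.Injective (leftArgs a b n) := fun I J h => by
    ext i; rw [← mem_leftArgs_x (a := a) (b := b), h, mem_leftArgs_x]
  rw [← sum_image (f := f) hinj.injOn]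
  symm
  rw [← sum_subset (subset_univ (univ.image (leftArgs a b n)))]
  · refine sum_congr rfl fun U hU => ?_
    obtain ⟨I, -, rfl⟩ := mem_image.1 hU
    rw [prod_eq_one, prod_eq_one]
    · simp
    · intro v hv
      rw [univ_sdiff_leftArgs] at hv
      rw [hD', if_neg]
      revert v
      refine forall_three (fun i => ?_) (fun i => ?_) (fun i => ?_) <;>
        simp [mem_rightArgs_z, kdm_w, kdm_x]
    · intro v hv
      rw [hD, if_neg]
      revert v
      refine forall_three (fun i => ?_) (fun i => ?_) (fun i => ?_) <;>
        simp [mem_leftArgs_w, kdm_z, kdm_x]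
  · intro U _ hU
    by_cases h1 : ∃ i, wIdx a b n i ∈ U
    · obtain ⟨i, hi⟩ := h1
      rw [prod_eq_zero hi (by simp [hD, kdm_w])]
      simp
    by_cases h2 : ∃ i, zIdx a b n i ∉ U
    · obtain ⟨i, hi⟩ := h2
      rw [prod_eq_zero (i := zIdx a b n i) (s := univ \ U) (by simpa using hi)
        (by simp [hD', kdm_z])]
      simp
    push Not at h1 h2
    refine absurd (mem_image.2 ⟨univ.filter fun i => xIdx a b n i ∈ U, mem_univ _, ?_⟩) hU
    ext v
    revert v
    refine forall_three (fun i => ?_) (fun i => ?_) (fun i => ?_) <;>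
      simp [mem_leftArgs_z, mem_leftArgs_w, mem_leftArgs_x, h1, h2]

theorem LLm_eq (g : ℕ) : LLm g n a b =
    HahnSeries.single (4 - 3 * g - (a + b + n : ℕ) : ℤ) (1 : R (a + b + n)) *
      HahnSeries.ofPowerSeries ℤ _ (Mg (kdm a b n) g (-2) (-2) univ) := by
  have hM : Mg (kdm a b n) g (-2) (-2) univ = ∑ gp ∈ range (g + 1), ∑ I : Finset (Fin n),
      ↑((args (kdm a b n)).α (leftArgs a b n I) ^ (-2 : ℤ)) *
        ↑((args (kdm a b n)).β (rightArgs a b n Iᶜ) ^ (-2 : ℤ)) *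
      (PowerSeries.coeff gp (psiMark (args (kdm a b n)).c 1 (leftArgs a b n I)) *
        PowerSeries.coeff (g - gp)
          (psiMark (args (kdm a b n)).c (-1) (rightArgs a b n Iᶜ))) := by
    rw [sum_comm, Mg, Args.M, powerset_univ, map_sum]
    simp only [PowerSeries.coeff_C_mul, mul_assoc]
    have := sum_splittings (fun U => ↑((args (kdm a b n)).α U ^ (-2 : ℤ)) *
      (↑((args (kdm a b n)).β (univ \ U) ^ (-2 : ℤ)) *
        PowerSeries.coeff g ((args (kdm a b n)).vv U (univ \ U)))) (args (kdm a b n))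
      (fun v => rfl) (fun v => rfl)
    simp only [mul_assoc, univ_sdiff_leftArgs] at this
    rw [this]
    refine sum_congr rfl fun I _ => ?_
    rw [Args.vv, PowerSeries.coeff_mul, Nat.sum_antidiagonal_eq_sum_range_succ
      (fun i j => PowerSeries.coeff i (psiMark (args (kdm a b n)).c 1 (leftArgs a b n I)) *
        PowerSeries.coeff j (psiMark (args (kdm a b n)).c (-1) (rightArgs a b n Iᶜ))),
      mul_sum, mul_sum]
  rw [hM, map_sum, mul_sum, LLm]
  refine sum_congr rfl fun gp hgp => ?_
  rw [map_sum, mul_sum]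
  refine sum_congr rfl fun I _ => ?_
  have hcard : #(leftArgs a b n I) + #(rightArgs a b n Iᶜ) = a + b + n := by
    rw [← univ_sdiff_leftArgs, card_univ_sdiff, Fintype.card_fin]
    have := card_le_univ (leftArgs a b n I)
    rw [Fintype.card_fin] at this
    omega
  have hg : gp ≤ g := by simpa [Nat.lt_succ_iff] using hgp
  have h := FExp_mul_FExp gp (g - gp) (kdm a b n) (leftArgs a b n I) (rightArgs a b n Iᶜ)
  rw [show (4 - 3 * ((gp : ℤ) + (g - gp : ℕ)) - (#(leftArgs a b n I) + #(rightArgs a b n Iᶜ)) : ℤ) =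
    4 - 3 * g - (a + b + n : ℕ) by
      have := congrArg (Nat.cast (R := ℤ)) hcard
      push_cast [hg] at this ⊢
      linear_combination -this] at h
  exact h

end Splitting

theorem coeffL_LLm (g n a b : ℕ) (e : Fin (a + b + n) → ℕ) (he : ∑ v, e v = g + n + 1) :
    coeffL (LLm g n a b) (2 * (g : ℤ) - 5 + a + b) e =
      cf (Finsupp.equivFunOnFinite.symm e) (Mg (kdm a b n) g (-2) (-2) univ) := by
  have hdeg : (Finsupp.equivFunOnFinite.symm e).degree = g + n + 1 := by
    rw [degree_eq_sum (subset_univ _), ← he]; rfl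
  rw [coeffL, cf, hdeg, LLm_eq,
    show -(2 * (g : ℤ) - 5 + a + b) = (g + n + 1 : ℕ) + (4 - 3 * g - (a + b + n : ℕ)) by
      push_cast; ring,
    HahnSeries.coeff_single_mul_add, one_mul, HahnSeries.ofPowerSeries_apply_coeff]

end NPoint

/-- For `r_j, s_j ≥ 0`, `d_j ≥ 1` with `Σ r_j + Σ s_j + Σ d_j = g + n + 1`, setting
`u = #{r_j = 0}`, `v = #{s_j = 0}`, `w = #{d_j = 1}` and assuming `2g+n+a+b−3−w ≠ 0`,
the coefficient of `y^{2g−5+a+b} Π z_j^{r_j} Π w_j^{s_j} Π x_j^{d_j}` in `L_g(y; z; w; x)`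
equals `(C/(Π (2r_j+1)!! Π (2s_j+1)!!)) · (−1)^b (2g−3+n+a+b)!/(4^g (2g−4+a+b)! Π (2d_j−1)!!)`
with `C = Σ r_j − Σ s_j + (a−b)/2 + ((5−u)u − (5−v)v)/(2(2g+n+a+b−3−w))`, the quotient of
factorials being read as `Π_{i=1}^{n+1} (2g−4+a+b+i)`. -/
theorem Lmulti_subtop_coeff (g n a b : ℕ) (hn : 1 ≤ n)
    (r : Fin a → ℕ) (s : Fin b → ℕ) (d : Fin n → ℕ) (hd : ∀ j, 1 ≤ d j)
    (hsum : ∑ j, r j + ∑ j, s j + ∑ j, d j = g + n + 1)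
    (u v w : ℕ)
    (hu : u = (univ.filter (fun j => r j = 0)).card)
    (hv : v = (univ.filter (fun j => s j = 0)).card)
    (hw : w = (univ.filter (fun j => d j = 1)).card)
    (hden : (2*(g : ℤ) + n + a + b - 3 - w) ≠ 0) :
    coeffL (LLm g n a b) (2*(g : ℤ) - 5 + a + b) (expVec a b n r s d)
      = (((∑ j, (r j : ℚ)) - (∑ j, (s j : ℚ)) + ((a : ℚ) - (b : ℚ))/2
            + (((5 : ℚ) - (u : ℚ)) * (u : ℚ) - ((5 : ℚ) - (v : ℚ)) * (v : ℚ)) /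
                (2*((2*(g : ℚ) + (n : ℚ) + (a : ℚ) + (b : ℚ) - 3 - (w : ℚ))))) /
           ((∏ j, (Nat.doubleFactorial (2*(r j)+1) : ℚ)) *
            (∏ j, (Nat.doubleFactorial (2*(s j)+1) : ℚ))))
        * ((-1 : ℚ)^b * (∏ i ∈ Finset.range (n+1), (((2*(g : ℤ) - 4 + a + b + i + 1) : ℤ) : ℚ)) /
            (4^g * ∏ j, (Nat.doubleFactorial (2*(d j)-1) : ℚ))) := by
  rw [NPoint.coeffL_LLm g n a b _ (by
    rw [NPoint.sum_three]
    simp only [NPoint.expVec_z, NPoint.expVec_w, NPoint.expVec_x, hsum])]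
  exact NPoint.cf_Mg_kdm (hd := hd) (hsum := hsum) (hu := hu) (hv := hv) (hw := hw) (hden := hden)

end
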